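/- arXiv:2301.12365 — 9 statements merged into one kernel-verified Lean document; each statement's English description precedes it below -/
import Mathlib

section
/- Let B : ℝ → ℝ be a C^∞ function with B(x+1) = B(x) + 1 and B'(x) > 0 for all x ∈ ℝ (a lift of a smooth orientation-preserving circle diffeomorphism), and suppose its rotation number ρ = lim_{n→∞} Bⁿ(0)/n is Diophantine. Then the induced circle diffeomorphism is ergodic with respect to Lebesgue measure: every 1-periodic measurable function f : ℝ → ℂ that is square-integrable on [0,1] and satisfies f(B(x)) = f(x) for almost every x ∈ ℝ is constant almost everywhere. -/
open Filter MeasureTheory Set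

/-- A real number `r` is Diophantine with constants `c, β > 0` if
`|r − p/q| ≥ c/q^(2+β)` for all `p ∈ ℤ` and all integers `q ≥ 1`. -/
def DiophantineWith (c β r : ℝ) : Prop :=
  ∀ (p : ℤ) (q : ℕ), 1 ≤ q → c / (q : ℝ) ^ (2 + β) ≤ |r - (p : ℝ) / (q : ℝ)|

/-- `r` is Diophantine if it is Diophantine with some constants `c, β > 0`. -/
def Diophantine (r : ℝ) : Prop :=
  ∃ c > (0 : ℝ), ∃ β > (0 : ℝ), DiophantineWith c β r

/-- Intervals that are pairwise non-overlapping modulo `1` have total length at most `1`. -/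
theorem sum_sub_le_one_of_separated_mod_one (N : ℕ) (a b : ℕ → ℝ)
    (hab : ∀ i < N, a i ≤ b i)
    (hsep : ∀ i < N, ∀ j < N, ∀ m : ℤ, (i ≠ j ∨ m ≠ 0) → b i ≤ a j + m ∨ b j + m ≤ a i) :
    ∑ i ∈ Finset.range N, (b i - a i) ≤ 1 := by
  rcases Nat.eq_zero_or_pos N with rfl | hN
  · simp
  set m : ℕ → ℤ := fun i => ⌊a i - a 0⌋ with hm
  have hm0 : m 0 = 0 := by simp [hm]
  have hm1 : ∀ i, a 0 ≤ a i - m i := fun i => by linarith [Int.floor_le (a i - a 0)]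
  have hm2 : ∀ i, a i - m i < a 0 + 1 := fun i => by linarith [Int.lt_floor_add_one (a i - a 0)]
  have hb : ∀ i < N, b i - m i ≤ a 0 + 1 := by
    intro i hi
    have h2 := hm2 i
    have h3 := hab 0 hN
    rcases hsep i hi 0 hN (m i + 1) (by
      by_cases h : i = 0
      · subst h; simp [hm0]
      · exact Or.inl h) with h | h <;> push_cast at h <;> linarith
  have hdisj : Set.PairwiseDisjoint (↑(Finset.range N))
      (fun i => Ioc (a i - m i) (b i - m i)) := by
    intro i hi j hj hij
    have hi' : i < N := by simpa using hi
    have hj' : j < N := by simpa using hj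
    refine Set.disjoint_left.2 fun x hx hx' => ?_
    rcases hsep i hi' j hj' (m i - m j) (Or.inl hij) with h | h <;> push_cast at h <;>
      linarith [hx.1, hx.2, hx'.1, hx'.2]
  have hmeas := measure_biUnion_finset (μ := volume) hdisj (fun i _ => measurableSet_Ioc)
  have hle : volume (⋃ i ∈ Finset.range N, Ioc (a i - m i) (b i - m i)) ≤ ENNReal.ofReal 1 := by
    refine (measure_mono (t := Ioc (a 0) (a 0 + 1)) ?_).trans (by simp)
    refine iUnion₂_subset fun i hi => Ioc_subset_Ioc (hm1 i) (hb i (by simpa using hi))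
  rw [hmeas] at hle
  simp only [Real.volume_Ioc, sub_sub_sub_cancel_right] at hle
  rw [← ENNReal.ofReal_sum_of_nonneg fun i hi => sub_nonneg.2 (hab i (by simpa using hi))] at hle
  exact (ENNReal.ofReal_le_ofReal_iff zero_le_one).1 hle

/-- Let `h` carry two orbit segments to orbit segments of the translation by `τ` which differ by
`α`. If the first `N` multiples of `τ` are `|α|`-separated modulo `1`, then the intervals between
corresponding points have total length at most `1`. -/
theorem sum_abs_sub_le_one_of_semiconj (h : CircleDeg1Lift) (τ α c : ℝ) (N : ℕ) (s t : ℕ → ℝ)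
    (hs : ∀ k, h (s k) = c + k * τ) (ht : ∀ k, h (t k) = c + k * τ + α) (hα1 : |α| < 1)
    (hsep : (StrictMono h ∧ ∀ j : ℕ, 0 < j → j < N → ∀ m : ℤ, |α| ≤ |j * τ - m|) ∨
      ∀ j : ℕ, 0 < j → j < N → ∀ m : ℤ, |α| < |j * τ - m|) :
    ∑ k ∈ Finset.range N, |t k - s k| ≤ 1 := by
  have hmin : ∀ k, h (min (s k) (t k)) = c + k * τ + min 0 α := fun k => by
    rw [h.monotone.map_min, hs, ht, ← min_add_add_left, add_zero]
  have hmax : ∀ k, h (max (s k) (t k)) = c + k * τ + min 0 α + |α| := fun k => by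
    rw [h.monotone.map_max, hs, ht]
    rcases le_total 0 α with h0 | h0
    · rw [max_eq_right (by linarith), min_eq_left h0, abs_of_nonneg h0]; ring
    · rw [max_eq_left (by linarith), min_eq_right h0, abs_of_nonpos h0]; ring
  have habs : ∀ k, |t k - s k| = max (s k) (t k) - min (s k) (t k) := fun k => by
    rw [max_sub_min_eq_abs]
  simp only [habs]
  have hle : ∀ i < N, ∀ j < N, ∀ m : ℤ, (i ≠ j ∨ m ≠ 0) →
      c + i * τ + min 0 α + |α| ≤ c + j * τ + min 0 α + m →
      max (s i) (t i) ≤ min (s j) (t j) + m := by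
    intro i hi j hj m hij hle
    rcases hsep with ⟨hmono, -⟩ | hsep
    · refine hmono.le_iff_le.1 ?_
      rw [h.map_add_int, hmin, hmax]; exact hle
    · refine (h.monotone.reflect_lt ?_).le
      rw [h.map_add_int, hmin, hmax]
      refine lt_of_le_of_ne hle fun heq => ?_
      rcases lt_trichotomy i j with hlt | rfl | hlt
      · have := hsep (j - i) (by omega) (by omega) (-m)
        rw [Nat.cast_sub hlt.le] at this
        push_cast at this
        rw [show ((j : ℝ) - i) * τ - -m = |α| by linarith, abs_abs] at this
        exact this.false
      · have hm : (m : ℝ) = |α| := by linarith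
        have h1 : (m : ℝ) < 1 := hm ▸ hα1
        have h0 : (0 : ℝ) ≤ m := hm ▸ abs_nonneg α
        have h1' : m < 1 := by exact_mod_cast h1
        have h0' : 0 ≤ m := by exact_mod_cast h0
        rcases hij with hij | hij
        · exact hij rfl
        · omega
      · have := hsep (i - j) (by omega) (by omega) m
        rw [Nat.cast_sub hlt.le] at this
        rw [show ((i : ℝ) - j) * τ - m = -|α| by linarith, abs_neg, abs_abs] at this
        exact this.false
  have hsep' : ∀ j : ℕ, 0 < j → j < N → ∀ m : ℤ, |α| ≤ |j * τ - m| := by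
    rcases hsep with ⟨-, h⟩ | h
    · exact h
    · exact fun j h0 h1 m => (h j h0 h1 m).le
  have hcase : ∀ i < N, ∀ j < N, ∀ m : ℤ, (i ≠ j ∨ m ≠ 0) → |α| ≤ |((i : ℝ) - j) * τ - m| := by
    intro i hi j hj m hij
    rcases lt_trichotomy i j with hlt | rfl | hlt
    · have := hsep' (j - i) (by omega) (by omega) (-m)
      rw [Nat.cast_sub hlt.le] at this
      push_cast at this
      rwa [← abs_neg (((j : ℝ) - i) * τ - -m),
        show -(((j : ℝ) - i) * τ - -m) = ((i : ℝ) - j) * τ - m by ring] at this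
    · have hm : m ≠ 0 := hij.resolve_left fun h => h rfl
      have : (1 : ℝ) ≤ |(m : ℝ)| := by exact_mod_cast Int.one_le_abs hm
      simp only [sub_self, zero_mul, zero_sub, abs_neg]
      linarith
    · have := hsep' (i - j) (by omega) (by omega) m
      rwa [Nat.cast_sub hlt.le] at this
  refine sum_sub_le_one_of_separated_mod_one N _ _ (fun i _ => min_le_max) ?_
  intro i hi j hj m hij
  have := hcase i hi j hj m hij
  rcases le_total (((i : ℝ) - j) * τ - m) 0 with h0 | h0
  · rw [abs_of_nonpos h0] at this
    exact Or.inl (hle i hi j hj m hij (by linarith))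
  · rw [abs_of_nonneg h0] at this
    refine Or.inr ?_
    have := hle j hj i hi (-m) (hij.imp Ne.symm (by simp)) (by push_cast; linarith)
    push_cast at this
    linarith

/-- Orbits of two points with the same image under the semiconjugacy are asymptotic. -/
theorem tendsto_sub_of_semiconj_eq (h : CircleDeg1Lift) (τ c : ℝ) (hτ : Irrational τ) (a b : ℕ → ℝ)
    (ha : ∀ k, h (a k) = c + k * τ) (hb : ∀ k, h (b k) = c + k * τ) :
    Tendsto (fun k => |b k - a k|) atTop (nhds 0) := by
  have hsum : ∀ N, ∑ k ∈ Finset.range N, |b k - a k| ≤ 1 := by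
    intro N
    refine sum_abs_sub_le_one_of_semiconj h τ 0 c N a b ha (by simpa using hb) (by simp)
      (Or.inr fun j hj _ m => ?_)
    rw [abs_zero, abs_pos, sub_ne_zero]
    exact ((hτ.natCast_mul hj.ne').ne_int m)
  exact (summable_of_sum_range_le (fun _ => abs_nonneg _) hsum).tendsto_atTop_zero

theorem exists_abs_natCast_mul_sub_lt (τ ε : ℝ) (hε : 0 < ε) :
    ∃ n : ℕ, 0 < n ∧ |n * τ - round (n * τ)| < ε := by
  obtain ⟨N, hN⟩ := exists_nat_one_div_lt hε
  obtain ⟨k, hk, -, h⟩ := Real.exists_nat_abs_mul_sub_round_le τ (Nat.succ_pos N)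
  refine ⟨k, hk, h.trans_lt (lt_of_le_of_lt ?_ hN)⟩
  push_cast
  gcongr
  linarith

theorem exists_forall_le_abs_natCast_mul_sub (τ : ℝ) (hτ : Irrational τ) (N : ℕ) :
    ∃ ε > 0, ∀ j : ℕ, 0 < j → j ≤ N → ε ≤ |j * τ - round (j * τ)| := by
  induction N with
  | zero => exact ⟨1, one_pos, by omega⟩
  | succ N ih =>
    obtain ⟨ε, hε, h⟩ := ih
    refine ⟨min ε |((N + 1 : ℕ) : ℝ) * τ - round (((N + 1 : ℕ) : ℝ) * τ)|,
      lt_min hε ?_, fun j hj hjN => ?_⟩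
    · rw [abs_pos, sub_ne_zero]
      exact (hτ.natCast_mul N.succ_ne_zero).ne_int _
    · rcases Nat.lt_or_ge N j with h1 | h1
      · obtain rfl : j = N + 1 := by omega
        exact min_le_right _ _
      · exact (min_le_left _ _).trans (h j hj h1)

/-- Existence of closest return times of an irrational rotation, together with the first later
time that returns on the other side. -/
theorem exists_closest_return (τ : ℝ) (hτ : Irrational τ) (ε : ℝ) (hε : 0 < ε) :
    ∃ (n n' : ℕ) (p p' : ℤ), 0 < n ∧ n < n' ∧ 0 < |n * τ - p| ∧ |n * τ - p| < ε ∧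
      (∀ j : ℕ, 0 < j → j < n → ∀ m : ℤ, |n * τ - p| < |j * τ - m|) ∧
      (∀ j : ℕ, 0 < j → j < n' → ∀ m : ℤ, |n * τ - p| ≤ |j * τ - m|) ∧
      |n' * τ - p'| < |n * τ - p| ∧ (n * τ - p) * (n' * τ - p') < 0 := by
  classical
  have hne : ∀ j : ℕ, 0 < j → ∀ m : ℤ, (j : ℝ) * τ - m ≠ 0 := fun j hj m =>
    sub_ne_zero.2 ((hτ.natCast_mul hj.ne').ne_int m)
  have hE := exists_abs_natCast_mul_sub_lt τ ε hε
  obtain ⟨hn0, hnε⟩ := Nat.find_spec hE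
  have hnmin := fun j => Nat.find_min hE (m := j)
  set n := Nat.find hE
  set p := round ((n : ℝ) * τ)
  have hδ : 0 < |n * τ - p| := abs_pos.2 (hne n hn0 p)
  have hE' := exists_abs_natCast_mul_sub_lt τ _ hδ
  obtain ⟨hn0', hnε'⟩ := Nat.find_spec hE'
  have hnmin' := fun j => Nat.find_min hE' (m := j)
  set n' := Nat.find hE'
  set p' := round ((n' : ℝ) * τ)
  have h1 : ∀ j : ℕ, 0 < j → j < n → ∀ m : ℤ, |n * τ - p| < |j * τ - m| := by
    intro j hj hjn m
    have := hnmin j hjn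
    push Not at this
    exact hnε.trans_le ((this hj).trans (round_le _ m))
  have h2 : ∀ j : ℕ, 0 < j → j < n' → ∀ m : ℤ, |n * τ - p| ≤ |j * τ - m| := by
    intro j hj hjn m
    have := hnmin' j hjn
    push Not at this
    exact (this hj).trans (round_le _ m)
  have hlt : n < n' := by
    rcases lt_trichotomy n n' with h | h | h
    · exact h
    · exfalso
      have := hnε'
      simp only [p', ← h] at this
      exact this.false
    · exact absurd (h1 n' hn0' h p') hnε'.not_gt
  refine ⟨n, n', p, p', hn0, hlt, hδ, hnε, h1, h2, hnε', ?_⟩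
  by_contra hcon
  have h3 := h2 (n' - n) (by omega) (by omega) (p' - p)
  rw [Nat.cast_sub hlt.le] at h3
  push_cast at h3
  rw [show ((n' : ℝ) - n) * τ - (p' - p) = (n' * τ - p') - (n * τ - p) by ring] at h3
  clear_value p p' n n'
  have hx := hne n hn0 p
  have hy := hne n' hn0' p'
  generalize (n : ℝ) * τ - p = x at *
  generalize (n' : ℝ) * τ - p' = y at *
  rcases lt_or_gt_of_ne hx with hx | hx <;> rcases lt_or_gt_of_ne hy with hy | hy
  · rw [abs_of_neg hx, abs_of_neg hy] at *
    rw [abs_of_nonneg (by linarith)] at h3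
    linarith
  · exact hcon (mul_neg_of_neg_of_pos hx hy)
  · exact hcon (mul_neg_of_pos_of_neg hx hy)
  · rw [abs_of_pos hx, abs_of_pos hy] at *
    rw [abs_of_nonpos (by linarith)] at h3
    linarith

/-- The first `n'` balls of radius `|α|` along an orbit of the rotation by `τ` cover the circle,
when `n` and `n'` return on opposite sides, within `|α|` of the origin. -/
theorem exists_abs_sub_lt_of_return (τ : ℝ) (n n' : ℕ) (p p' : ℤ) (hn : 0 < n) (hnn' : n ≤ n')
    (hlt : |n' * τ - p'| < |n * τ - p|)
    (hopp : (n * τ - p) * (n' * τ - p') < 0) (y : ℝ) :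
    ∃ k < n', ∃ m : ℤ, |y - (k * τ + m)| < |n * τ - p| := by
  classical
  have hδ : 0 < |n * τ - p| := (abs_nonneg _).trans_lt hlt
  have hE : ∃ k : ℕ, ∃ m : ℤ, |y - (k * τ + m)| < |n * τ - p| := by
    have hα : (n * τ - p) ≠ 0 := abs_pos.1 hδ
    generalize hαdef : (n : ℝ) * τ - p = α at *
    obtain ⟨m, hm⟩ : ∃ m : ℤ, 0 ≤ (y + m) / α := by
      rcases lt_or_gt_of_ne hα with h | h
      · exact ⟨-⌈y⌉, div_nonneg_of_nonpos (by push_cast; linarith [Int.le_ceil y]) h.le⟩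
      · exact ⟨-⌊y⌋, div_nonneg (by push_cast; linarith [Int.floor_le y]) h.le⟩
    refine ⟨⌊(y + m) / α⌋₊ * n, -m - ⌊(y + m) / α⌋₊ * p, ?_⟩
    have h1 := Nat.floor_le hm
    have h2 := Nat.lt_floor_add_one ((y + m) / α)
    push_cast
    have h3 : y - (⌊(y + m) / α⌋₊ * n * τ + (-m - ⌊(y + m) / α⌋₊ * p)) =
        ((y + m) / α - ⌊(y + m) / α⌋₊) * α := by
      rw [sub_mul, div_mul_cancel₀ _ hα, ← hαdef]; ring
    rw [h3, abs_mul, abs_of_nonneg (by linarith)]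
    nlinarith
  obtain ⟨m, hm⟩ := Nat.find_spec hE
  have hmin := fun j => Nat.find_min hE (m := j)
  set k := Nat.find hE
  clear_value k
  refine ⟨k, ?_, m, hm⟩
  by_contra! hk
  have hnk : n ≤ k := hnn'.trans hk
  have h1 := hmin (k - n) (by omega)
  have h2 := hmin (k - n') (by omega)
  push Not at h1 h2
  have h1 := h1 (m + p)
  have h2 := h2 (m + p')
  rw [Nat.cast_sub hnk] at h1
  rw [Nat.cast_sub hk] at h2
  push_cast at h1 h2
  rw [show y - (((k : ℝ) - n) * τ + (m + p)) = (y - (k * τ + m)) + (n * τ - p) by ring] at h1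
  rw [show y - (((k : ℝ) - n') * τ + (m + p')) = (y - (k * τ + m)) + (n' * τ - p') by ring] at h2
  generalize (n : ℝ) * τ - p = α at *
  generalize (n' : ℝ) * τ - p' = α' at *
  generalize y - (k * τ + m) = z at *
  rcases lt_or_gt_of_ne (abs_pos.1 hδ) with ha | ha
  · have ha' : 0 < α' := pos_of_mul_neg_right hopp ha.le
    rw [abs_of_neg ha] at *
    rw [abs_of_pos ha'] at *
    rw [abs_lt] at hm
    rw [le_abs'] at h1 h2
    rcases h1 with h1 | h1 <;> rcases h2 with h2 | h2 <;> linarith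
  · have ha' : α' < 0 := neg_of_mul_neg_right hopp ha.le
    rw [abs_of_pos ha] at *
    rw [abs_of_neg ha'] at *
    rw [abs_lt] at hm
    rw [le_abs'] at h1 h2
    rcases h1 with h1 | h1 <;> rcases h2 with h2 | h2 <;> linarith

theorem hasDerivAt_iterate_exp_birkhoffSum (B φ : ℝ → ℝ)
    (hB : ∀ x, HasDerivAt B (Real.exp (φ x)) x) (n : ℕ) (x : ℝ) :
    HasDerivAt B^[n] (Real.exp (birkhoffSum B φ n x)) x := by
  induction n with
  | zero => simpa using hasDerivAt_id x
  | succ n ih =>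
    rw [Function.iterate_succ', birkhoffSum_succ, add_comm, Real.exp_add]
    exact (hB _).comp x ih

theorem exists_iterate_sub_eq_exp_birkhoffSum (B φ : ℝ → ℝ)
    (hB : ∀ x, HasDerivAt B (Real.exp (φ x)) x) (n : ℕ) {x y : ℝ} (hxy : x < y) :
    ∃ ξ ∈ Icc x y, B^[n] y - B^[n] x = Real.exp (birkhoffSum B φ n ξ) * (y - x) := by
  have hd := hasDerivAt_iterate_exp_birkhoffSum B φ hB n
  obtain ⟨ξ, hξ, h⟩ := exists_hasDerivAt_eq_slope B^[n] _ hxy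
    (fun z _ => (hd z).continuousAt.continuousWithinAt) (fun z _ => hd z)
  refine ⟨ξ, Ioo_subset_Icc_self hξ, ?_⟩
  rw [h, div_mul_cancel₀ _ (sub_pos.2 hxy).ne']

theorem map_iterate_of_semiconj_translate (h : CircleDeg1Lift) (B : ℝ → ℝ) (τ : ℝ)
    (hB : ∀ x, h (B x) = h x + τ) (n : ℕ) (x : ℝ) : h (B^[n] x) = h x + n * τ := by
  induction n with
  | zero => simp
  | succ n ih => rw [Function.iterate_succ_apply', hB, ih]; push_cast; ring

/-- Denjoy's distortion estimate. -/
theorem abs_birkhoffSum_sub_le_of_semiconj (h : CircleDeg1Lift) (B φ : ℝ → ℝ) (τ K : ℝ)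
    (hB : ∀ x, h (B x) = h x + τ) (hK : 0 ≤ K) (hφ : ∀ x y, |φ x - φ y| ≤ K * |x - y|)
    (α : ℝ) (hα1 : |α| < 1) (N n : ℕ) (hnN : n ≤ N)
    (hsep : (StrictMono h ∧ ∀ j : ℕ, 0 < j → j < N → ∀ m : ℤ, |α| ≤ |j * τ - m|) ∨
      ∀ j : ℕ, 0 < j → j < N → ∀ m : ℤ, |α| < |j * τ - m|)
    (x y : ℝ) (hxy : h y = h x + α) :
    |birkhoffSum B φ n x - birkhoffSum B φ n y| ≤ K := by
  have hsum := sum_abs_sub_le_one_of_semiconj h τ α (h x) N (fun k => B^[k] x) (fun k => B^[k] y)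
    (fun k => map_iterate_of_semiconj_translate h B τ hB k x)
    (fun k => by rw [map_iterate_of_semiconj_translate h B τ hB k y, hxy]; ring) hα1 hsep
  rw [birkhoffSum, birkhoffSum, ← Finset.sum_sub_distrib]
  calc |∑ k ∈ Finset.range n, (φ (B^[k] x) - φ (B^[k] y))|
      ≤ ∑ k ∈ Finset.range n, |φ (B^[k] x) - φ (B^[k] y)| := Finset.abs_sum_le_sum_abs _ _
    _ ≤ ∑ k ∈ Finset.range n, K * |B^[k] y - B^[k] x| :=
        Finset.sum_le_sum fun k _ => (hφ _ _).trans_eq (by rw [abs_sub_comm])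
    _ ≤ ∑ k ∈ Finset.range N, K * |B^[k] y - B^[k] x| :=
        Finset.sum_le_sum_of_subset_of_nonneg (Finset.range_mono hnN)
          fun _ _ _ => mul_nonneg hK (abs_nonneg _)
    _ = K * ∑ k ∈ Finset.range N, |B^[k] y - B^[k] x| := by rw [Finset.mul_sum]
    _ ≤ K := mul_le_of_le_one_right hK hsum

/-- **Denjoy's theorem**: the semiconjugacy to the rotation is injective. -/
theorem strictMono_of_semiconj_translate (F h : CircleDeg1Lift) (φ : ℝ → ℝ) (τ K : ℝ)
    (hτ : Irrational τ) (hF : Function.Surjective F)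
    (hh : ∀ x, h (F x) = h x + τ) (hK : 0 ≤ K) (hφ : ∀ x y, |φ x - φ y| ≤ K * |x - y|)
    (hd : ∀ x, HasDerivAt F (Real.exp (φ x)) x) : StrictMono h := by
  intro a b hab
  refine lt_of_le_of_ne (h.monotone hab.le) fun heq => ?_
  choose G hG using hF
  have hG' : ∀ x, h (G x) = h x + (-τ) := fun x => by
    have := hh (G x); rw [hG] at this; linarith
  have hFG : ∀ n x, F^[n] (G^[n] x) = x := fun n =>
    Function.LeftInverse.iterate (g := F) (f := G) hG n
  have l1 := tendsto_sub_of_semiconj_eq h τ (h a) hτ (fun k => F^[k] a) (fun k => F^[k] b)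
    (fun k => map_iterate_of_semiconj_translate h F τ hh k a)
    (fun k => by rw [map_iterate_of_semiconj_translate h F τ hh k b, heq])
  have l2 := tendsto_sub_of_semiconj_eq h (-τ) (h a) hτ.neg (fun k => G^[k] a) (fun k => G^[k] b)
    (fun k => map_iterate_of_semiconj_translate h G (-τ) hG' k a)
    (fun k => by rw [map_iterate_of_semiconj_translate h G (-τ) hG' k b, heq])
  have l3 := l1.mul l2
  rw [mul_zero] at l3
  have hba : 0 < b - a := sub_pos.2 hab
  obtain ⟨N, hN⟩ := eventually_atTop.1 (l3.eventually_lt_const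
    (show 0 < Real.exp (-K) * (b - a) ^ 2 by positivity))
  obtain ⟨ε, hε, hεN⟩ := exists_forall_le_abs_natCast_mul_sub τ hτ N
  obtain ⟨n, -, p, -, hn0, -, -, hnε, hsep, -⟩ :=
    exists_closest_return τ hτ (min ε 1) (lt_min hε one_pos)
  have hnN : N ≤ n := by
    by_contra! hlt
    exact (((hεN n hn0 hlt.le).trans (round_le _ p)).trans_lt hnε).not_ge (min_le_left _ _)
  have hsmall := hN n hnN
  have hshift : ∀ z, F^[n] (G^[n] z + p) = z + p := fun z => by
    rw [← CircleDeg1Lift.coe_pow, CircleDeg1Lift.map_add_int, CircleDeg1Lift.coe_pow, hFG]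
  have hFn : Monotone F^[n] := F.monotone.iterate n
  have hab' : G^[n] a + p < G^[n] b + p := hFn.reflect_lt (by rw [hshift, hshift]; linarith)
  obtain ⟨ξ, hξ, e1⟩ := exists_iterate_sub_eq_exp_birkhoffSum F φ hd n hab'
  obtain ⟨η, hη, e2⟩ := exists_iterate_sub_eq_exp_birkhoffSum F φ hd n hab
  rw [hshift, hshift] at e1
  have hhη : h η = h a := le_antisymm ((h.monotone hη.2).trans_eq heq.symm) (h.monotone hη.1)
  have hhG : ∀ z, h (G^[n] z + p) = h z - n * τ + p := fun z => by
    rw [h.map_add_int, map_iterate_of_semiconj_translate h G (-τ) hG']; ring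
  have hhξ : h ξ = h a - n * τ + p :=
    le_antisymm ((h.monotone hξ.2).trans_eq (by rw [hhG, heq]))
      ((hhG a).symm.trans_le (h.monotone hξ.1))
  have hdist := abs_birkhoffSum_sub_le_of_semiconj h F φ τ K hh hK hφ (n * τ - p)
    (hnε.trans_le (min_le_right _ _)) n n le_rfl (Or.inr hsep) ξ η (by rw [hhη, hhξ]; ring)
  rw [e2, abs_mul, abs_of_pos hba, Real.abs_exp,
    show G^[n] b - G^[n] a = (G^[n] b + p) - (G^[n] a + p) by ring, abs_of_pos (sub_pos.2 hab')]
    at hsmall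
  have hexp : Real.exp (-K) * Real.exp (birkhoffSum F φ n ξ) ≤ Real.exp (birkhoffSum F φ n η) := by
    rw [← Real.exp_add, Real.exp_le_exp]
    linarith [(abs_le.1 hdist).2]
  have : Real.exp (-K) * (b - a) ^ 2 ≤ Real.exp (birkhoffSum F φ n η) * (b - a) *
      ((G^[n] b + p) - (G^[n] a + p)) := by
    have hpos : 0 < (b - a) * ((G^[n] b + p) - (G^[n] a + p)) := mul_pos hba (sub_pos.2 hab')
    calc Real.exp (-K) * (b - a) ^ 2 = Real.exp (-K) * (b - a) * (b + p - (a + p)) := by ring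
      _ = Real.exp (-K) * Real.exp (birkhoffSum F φ n ξ) *
          ((b - a) * ((G^[n] b + p) - (G^[n] a + p))) := by rw [e1]; ring
      _ ≤ Real.exp (birkhoffSum F φ n η) * ((b - a) * ((G^[n] b + p) - (G^[n] a + p))) := by
        gcongr
      _ = _ := by ring
  exact this.not_gt hsmall

theorem volume_image_iterate_le (F φ : ℝ → ℝ) (hd : ∀ x, HasDerivAt F (Real.exp (φ x)) x)
    (n : ℕ) (u v C : ℝ) (huv : u < v)
    (hC : ∀ x ∈ Icc u v, ∀ y ∈ Icc u v, birkhoffSum F φ n x - birkhoffSum F φ n y ≤ C)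
    (E : Set ℝ) (hE : E ⊆ Icc u v) :
    volume (F^[n] '' E) ≤
      ENNReal.ofReal (Real.exp C * (F^[n] v - F^[n] u) / (v - u)) * volume E := by
  obtain ⟨ξ, hξ, e⟩ := exists_iterate_sub_eq_exp_birkhoffSum F φ hd n huv
  have huv' : 0 < v - u := sub_pos.2 huv
  have hLip : LipschitzOnWith (Real.exp C * (F^[n] v - F^[n] u) / (v - u)).toNNReal F^[n]
      (Icc u v) := by
    refine (convex_Icc u v).lipschitzOnWith_of_nnnorm_hasDerivWithin_le
      (fun x _ => (hasDerivAt_iterate_exp_birkhoffSum F φ hd n x).hasDerivWithinAt) fun x hx => ?_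
    rw [← NNReal.coe_le_coe, coe_nnnorm, Real.norm_eq_abs, Real.abs_exp]
    refine le_trans ?_ (Real.le_coe_toNNReal _)
    rw [e, ← mul_assoc, mul_div_cancel_right₀ _ huv'.ne', ← Real.exp_add, Real.exp_le_exp]
    linarith [hC x hx ξ hξ]
  have := (hLip.mono hE).hausdorffMeasure_image_le zero_le_one
  rwa [MeasureTheory.hausdorffMeasure_real, ENNReal.rpow_one] at this

/-- Around every point there are arbitrarily small intervals whose first iterates cover the circle
with bounded multiplicity and bounded distortion. -/
theorem exists_interval_iterates_cover (F h : CircleDeg1Lift) (φ : ℝ → ℝ) (τ K : ℝ)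
    (hτ : Irrational τ) (hF : Function.Surjective F) (hmono : StrictMono h)
    (hh : ∀ x, h (F x) = h x + τ) (hK : 0 ≤ K) (hφ : ∀ x y, |φ x - φ y| ≤ K * |x - y|)
    (x₀ η : ℝ) (hη : 0 < η) :
    ∃ (u v : ℝ) (N : ℕ), x₀ - η < u ∧ u < x₀ ∧ x₀ < v ∧ v < x₀ + η ∧
      (∀ k < N, ∀ x ∈ Icc u v, ∀ y ∈ Icc u v,
        birkhoffSum F φ k x - birkhoffSum F φ k y ≤ 2 * K) ∧
      ∑ k ∈ Finset.range N, (F^[k] v - F^[k] u) ≤ 2 ∧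
      ∀ y, ∃ k < N, ∃ m : ℤ, ∃ z ∈ Icc u v, F^[k] z = y + m := by
  have hr : h x₀ < h (x₀ + η) := hmono (by linarith)
  have hl : h (x₀ - η) < h x₀ := hmono (by linarith)
  obtain ⟨n, n', p, p', hn, hnn', hδ, hδε, -, hsep, hlt, hopp⟩ := exists_closest_return τ hτ
    (min 1 (min (h (x₀ + η) - h x₀) (h x₀ - h (x₀ - η))))
    (lt_min one_pos (lt_min (sub_pos.2 hr) (sub_pos.2 hl)))
  have hδ1 := hδε.trans_le (min_le_left _ _)
  have hδr := hδε.trans_le ((min_le_right _ _).trans (min_le_left _ _))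
  have hδl := hδε.trans_le ((min_le_right _ _).trans (min_le_right _ _))
  have hpt : ∃ w, h w = h x₀ + (n * τ - p) :=
    ⟨F^[n] x₀ - p, by rw [h.map_sub_int, map_iterate_of_semiconj_translate h F τ hh]; ring⟩
  have hpt' : ∃ w, h w = h x₀ - (n * τ - p) := by
    obtain ⟨w, hw⟩ := hF.iterate n x₀
    refine ⟨w + p, ?_⟩
    have := map_iterate_of_semiconj_translate h F τ hh n w
    rw [hw] at this
    rw [h.map_add_int, this]; ring
  obtain ⟨⟨v, hv⟩, ⟨u, hu⟩⟩ : (∃ w, h w = h x₀ + |n * τ - p|) ∧ ∃ w, h w = h x₀ - |n * τ - p| := by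
    rcases abs_choice (n * τ - p) with h1 | h1 <;> rw [h1]
    · exact ⟨hpt, hpt'⟩
    · exact ⟨by simpa [sub_eq_add_neg] using hpt', by simpa [sub_eq_add_neg] using hpt⟩
  have hcov := exists_abs_sub_lt_of_return τ n n' p p' hn hnn'.le hlt hopp
  generalize |n * τ - p| = δ at *
  have hux : u < x₀ := hmono.lt_iff_lt.1 (by linarith)
  have hxv : x₀ < v := hmono.lt_iff_lt.1 (by linarith)
  have hsep' : ∀ α : ℝ, |α| ≤ δ → ∀ j : ℕ, 0 < j → j < n' → ∀ m : ℤ, |α| ≤ |j * τ - m| :=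
    fun α hα j h0 h1 m => hα.trans (hsep j h0 h1 m)
  have hdist : ∀ k < n', ∀ x ∈ Icc u v, |birkhoffSum F φ k x₀ - birkhoffSum F φ k x| ≤ K := by
    intro k hk x hx
    have hα : |h x - h x₀| ≤ δ := by
      rw [abs_le]
      constructor <;> linarith [hmono.monotone hx.1, hmono.monotone hx.2]
    exact abs_birkhoffSum_sub_le_of_semiconj h F φ τ K hh hK hφ (h x - h x₀) (hα.trans_lt hδ1)
      n' k hk.le (Or.inl ⟨hmono, hsep' _ hα⟩) x₀ x (by ring)
  have hsum : ∀ w, |h w - h x₀| ≤ δ → ∑ k ∈ Finset.range n', |F^[k] w - F^[k] x₀| ≤ 1 := by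
    intro w hw
    refine sum_abs_sub_le_one_of_semiconj h τ (h w - h x₀) (h x₀) n' (fun k => F^[k] x₀)
      (fun k => F^[k] w) (fun k => map_iterate_of_semiconj_translate h F τ hh k x₀)
      (fun k => ?_) (hw.trans_lt hδ1) (Or.inl ⟨hmono, hsep' _ hw⟩)
    rw [map_iterate_of_semiconj_translate h F τ hh k w]; ring
  refine ⟨u, v, n', ?_, hux, hxv, ?_, ?_, ?_, ?_⟩
  · exact hmono.lt_iff_lt.1 (by linarith)
  · exact hmono.lt_iff_lt.1 (by linarith)
  · intro k hk x hx y hy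
    linarith [(abs_le.1 (hdist k hk x hx)).1, (abs_le.1 (hdist k hk y hy)).2]
  · have h1 := hsum v (by rw [hv, add_sub_cancel_left, abs_of_pos hδ])
    have h2 := hsum u (by rw [hu, sub_sub_cancel_left, abs_neg, abs_of_pos hδ])
    calc ∑ k ∈ Finset.range n', (F^[k] v - F^[k] u)
        ≤ ∑ k ∈ Finset.range n', (|F^[k] v - F^[k] x₀| + |F^[k] u - F^[k] x₀|) := by
          refine Finset.sum_le_sum fun k _ => ?_
          linarith [le_abs_self (F^[k] v - F^[k] x₀), neg_abs_le (F^[k] u - F^[k] x₀)]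
      _ ≤ 2 := by rw [Finset.sum_add_distrib]; linarith
  · intro y
    obtain ⟨k, hk, m, hm⟩ := hcov (h y - h x₀)
    obtain ⟨z, hz⟩ := hF.iterate k (y - m)
    have hhz := map_iterate_of_semiconj_translate h F τ hh k z
    rw [hz, h.map_sub_int] at hhz
    rw [abs_lt] at hm
    refine ⟨k, hk, -m, z, ⟨hmono.le_iff_le.1 ?_, hmono.le_iff_le.1 ?_⟩, ?_⟩
    · linarith
    · linarith
    · rw [hz]; push_cast; ring

theorem volume_setOf_exists_add_int_mem_le (E : Set ℝ) :
    volume {y ∈ Ico (0 : ℝ) 1 | ∃ m : ℤ, y + m ∈ E} ≤ volume E := by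
  have hsub : {y ∈ Ico (0 : ℝ) 1 | ∃ m : ℤ, y + m ∈ E} ⊆
      ⋃ m : ℤ, (fun y : ℝ => y + m) ⁻¹' (Ico (m : ℝ) (m + 1) ∩ E) := by
    rintro y ⟨⟨h0, h1⟩, m, hm⟩
    exact mem_iUnion.2 ⟨m, ⟨by linarith, by linarith⟩, hm⟩
  calc volume {y ∈ Ico (0 : ℝ) 1 | ∃ m : ℤ, y + m ∈ E}
      ≤ ∑' m : ℤ, volume ((fun y : ℝ => y + m) ⁻¹' (Ico (m : ℝ) (m + 1) ∩ E)) :=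
        (measure_mono hsub).trans (measure_iUnion_le _)
    _ = ∑' m : ℤ, volume.restrict E (Ico (m : ℝ) (m + 1)) := by
        congr with m
        rw [measure_preimage_add_right, Measure.restrict_apply measurableSet_Ico]
    _ = volume.restrict E (⋃ m : ℤ, Ico (m : ℝ) (m + 1)) :=
        (measure_iUnion (Set.pairwise_disjoint_Ico_intCast ℝ) fun _ => measurableSet_Ico).symm
    _ ≤ volume E := by
        rw [iUnion_Ico_intCast, Measure.restrict_apply_univ]

theorem exists_null_iterate_mem_of_ae_invariant (F : ℝ → ℝ) (hF : Differentiable ℝ F) (A : Set ℝ)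
    (hinv : ∀ᵐ x, F x ∈ A ↔ x ∈ A) (k : ℕ) :
    ∃ Z : Set ℝ, volume Z = 0 ∧ ∀ x ∈ A, F^[k] x ∉ A → F^[k] x ∈ Z := by
  have himage : ∀ Z : Set ℝ, volume Z = 0 → volume (F '' Z) = 0 := fun Z hZ =>
    addHaar_image_eq_zero_of_differentiableOn_of_addHaar_eq_zero volume hF.differentiableOn hZ
  induction k with
  | zero => exact ⟨∅, measure_empty, fun x hx hx' => absurd hx hx'⟩
  | succ k ih =>
    obtain ⟨Z, hZ, h⟩ := ih
    refine ⟨F '' Z ∪ F '' {x | ¬(F x ∈ A ↔ x ∈ A)},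
      measure_union_null (himage _ hZ) (himage _ hinv), fun x hx hx' => ?_⟩
    rw [Function.iterate_succ_apply'] at hx' ⊢
    by_cases hk : F^[k] x ∈ A
    · exact Or.inr ⟨_, by simp [hk, hx'], rfl⟩
    · exact Or.inl ⟨_, h x hx hk, rfl⟩

theorem volume_compl_inter_Ico_le (F : CircleDeg1Lift) (φ : ℝ → ℝ) (C : ℝ)
    (hd : ∀ x, HasDerivAt F (Real.exp (φ x)) x) (A : Set ℝ)
    (hper : ∀ (x : ℝ) (m : ℤ), x + m ∈ A ↔ x ∈ A) (hinv : ∀ᵐ x, F x ∈ A ↔ x ∈ A)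
    (u v : ℝ) (N : ℕ) (huv : u < v)
    (hC : ∀ k < N, ∀ x ∈ Icc u v, ∀ y ∈ Icc u v, birkhoffSum F φ k x - birkhoffSum F φ k y ≤ C)
    (hsum : ∑ k ∈ Finset.range N, (F^[k] v - F^[k] u) ≤ 2)
    (hcov : ∀ y, ∃ k < N, ∃ m : ℤ, ∃ z ∈ Icc u v, F^[k] z = y + m)
    (ε : ℝ) (hε : 0 ≤ ε) (hA : volume (Aᶜ ∩ Icc u v) ≤ ENNReal.ofReal (ε * (v - u))) :
    volume (Aᶜ ∩ Ico 0 1) ≤ ENNReal.ofReal (Real.exp C * 2 * ε) := by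
  choose Z hZ0 hZ using exists_null_iterate_mem_of_ae_invariant F
    (fun x => (hd x).differentiableAt) A hinv
  have huv' : 0 < v - u := sub_pos.2 huv
  have hmono : ∀ k, 0 ≤ F^[k] v - F^[k] u := fun k =>
    sub_nonneg.2 (F.monotone.iterate k huv.le)
  have hsub : Aᶜ ∩ Ico 0 1 ⊆ ⋃ k ∈ Finset.range N,
      {y ∈ Ico (0 : ℝ) 1 | ∃ m : ℤ, y + m ∈ F^[k] '' (Aᶜ ∩ Icc u v) ∪ Z k} := by
    rintro y ⟨hyA, hy⟩
    obtain ⟨k, hk, m, z, hz, e⟩ := hcov y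
    refine mem_iUnion₂.2 ⟨k, Finset.mem_range.2 hk, hy, m, ?_⟩
    by_cases hzA : z ∈ A
    · refine Or.inr (e ▸ hZ k z hzA ?_)
      rw [e, hper]; exact hyA
    · exact Or.inl ⟨z, ⟨hzA, hz⟩, e⟩
  calc volume (Aᶜ ∩ Ico 0 1)
      ≤ ∑ k ∈ Finset.range N,
          volume {y ∈ Ico (0 : ℝ) 1 | ∃ m : ℤ, y + m ∈ F^[k] '' (Aᶜ ∩ Icc u v) ∪ Z k} :=
        (measure_mono hsub).trans (measure_biUnion_finset_le _ _)
    _ ≤ ∑ k ∈ Finset.range N, ENNReal.ofReal (Real.exp C * ε * (F^[k] v - F^[k] u)) := by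
        refine Finset.sum_le_sum fun k hk => (volume_setOf_exists_add_int_mem_le _).trans ?_
        refine (measure_union_le _ _).trans ?_
        rw [hZ0, add_zero]
        refine (volume_image_iterate_le F φ hd k u v C huv (hC k (Finset.mem_range.1 hk)) _
          inter_subset_right).trans ?_
        refine (mul_le_mul_right hA _).trans ?_
        rw [← ENNReal.ofReal_mul
          (div_nonneg (mul_nonneg (Real.exp_pos C).le (hmono k)) huv'.le)]
        refine ENNReal.ofReal_le_ofReal (le_of_eq ?_)
        field_simp
    _ = ENNReal.ofReal (Real.exp C * ε * ∑ k ∈ Finset.range N, (F^[k] v - F^[k] u)) := by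
        rw [← ENNReal.ofReal_sum_of_nonneg fun k _ =>
          mul_nonneg (mul_nonneg (Real.exp_pos C).le hε) (hmono k), Finset.mul_sum]
    _ ≤ ENNReal.ofReal (Real.exp C * 2 * ε) := by
        refine ENNReal.ofReal_le_ofReal ?_
        calc _ ≤ Real.exp C * ε * 2 := by gcongr
          _ = _ := by ring

/-- An invariant set of positive measure is conull. -/
theorem ae_mem_of_ae_invariant (F h : CircleDeg1Lift) (φ : ℝ → ℝ) (τ K : ℝ)
    (hτ : Irrational τ) (hF : Function.Surjective F)
    (hh : ∀ x, h (F x) = h x + τ) (hK : 0 ≤ K) (hφ : ∀ x y, |φ x - φ y| ≤ K * |x - y|)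
    (hd : ∀ x, HasDerivAt F (Real.exp (φ x)) x) (A : Set ℝ) (hAm : MeasurableSet A)
    (hper : ∀ (x : ℝ) (m : ℤ), x + m ∈ A ↔ x ∈ A) (hinv : ∀ᵐ x, F x ∈ A ↔ x ∈ A)
    (hA : volume A ≠ 0) : ∀ᵐ x, x ∈ A := by
  have hmono := strictMono_of_semiconj_translate F h φ τ K hτ hF hh hK hφ hd
  obtain ⟨x₀, hx₀A, hx₀⟩ : ∃ x ∈ A, Tendsto (fun a => volume (Aᶜ ∩ a) / volume a)
      ((IsUnifLocDoublingMeasure.vitaliFamily (volume : Measure ℝ) 1).filterAt x)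
      (nhds (Aᶜ.indicator 1 x)) := by
    by_contra! hcon
    refine hA (measure_mono_null (fun x hx => hcon x hx)
      ((IsUnifLocDoublingMeasure.vitaliFamily (volume : Measure ℝ)
        1).ae_tendsto_measure_inter_div_of_measurableSet hAm.compl))
  rw [indicator_of_notMem (by simpa using hx₀A)] at hx₀
  choose u v N hu hux hxv hv hC hsum hcov using fun i : ℕ =>
    exists_interval_iterates_cover F h φ τ K hτ hF hmono hh hK hφ x₀ (1 / ((i : ℝ) + 1))
      Nat.one_div_pos_of_nat
  have hball : ∀ i, Metric.closedBall ((u i + v i) / 2) ((v i - u i) / 2) = Icc (u i) (v i) :=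
    fun i => by rw [Real.closedBall_eq_Icc]; congr 1 <;> ring
  have hlim : Tendsto (fun i => (v i - u i) / 2) atTop (nhdsWithin 0 (Ioi 0)) := by
    refine tendsto_nhdsWithin_iff.2 ⟨?_, Eventually.of_forall fun i => ?_⟩
    · refine squeeze_zero (fun i => ?_) (fun i => ?_)
        (tendsto_one_div_add_atTop_nhds_zero_nat (𝕜 := ℝ))
      · linarith [hux i, hxv i]
      · linarith [hu i, hv i]
    · simp only [mem_Ioi]; linarith [hux i, hxv i]
  have hdens := hx₀.comp (IsUnifLocDoublingMeasure.tendsto_closedBall_filterAt volume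
    (K := 1) (fun i => (u i + v i) / 2) (fun i => (v i - u i) / 2) hlim
    (Eventually.of_forall fun i => by
      rw [one_mul, hball]; exact ⟨(hux i).le, (hxv i).le⟩))
  have hbound : ∀ ε : ℝ, 0 < ε →
      volume (Aᶜ ∩ Ico 0 1) ≤ ENNReal.ofReal (Real.exp (2 * K) * 2 * ε) := by
    intro ε hε
    obtain ⟨i, hi⟩ := (hdens.eventually_lt_const (ENNReal.ofReal_pos.2 hε)).exists
    have huv : u i < v i := (hux i).trans (hxv i)
    simp only [Function.comp_apply, hball, Real.volume_Icc] at hi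
    refine volume_compl_inter_Ico_le F φ (2 * K) hd A hper hinv (u i) (v i) (N i) huv (hC i)
      (hsum i) (hcov i) ε hε.le ?_
    rw [ENNReal.ofReal_mul hε.le]
    exact (ENNReal.div_le_iff (ENNReal.ofReal_pos.2 (sub_pos.2 huv)).ne'
      ENNReal.ofReal_ne_top).1 hi.le
  have hzero : volume (Aᶜ ∩ Ico 0 1) = 0 := by
    refine le_antisymm (ENNReal.le_of_forall_pos_le_add fun ε hε _ => ?_) zero_le
    refine (hbound (ε / (Real.exp (2 * K) * 2)) (by positivity)).trans ?_
    rw [mul_div_cancel₀ _ (by positivity), ENNReal.ofReal_coe_nnreal, zero_add]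
  refine measure_mono_null (t := ⋃ m : ℤ, (fun y : ℝ => y + m) ⁻¹' (Aᶜ ∩ Ico 0 1)) ?_
    (measure_iUnion_null fun m => by rw [measure_preimage_add_right, hzero])
  intro y hy
  refine mem_iUnion.2 ⟨-⌊y⌋, fun hA => hy ((hper y _).1 hA), ?_, ?_⟩
  · push_cast; linarith [Int.floor_le y]
  · push_cast; linarith [Int.lt_floor_add_one y]

theorem Diophantine.irrational {r : ℝ} (hr : Diophantine r) : Irrational r := by
  obtain ⟨c, hc, β, -, h⟩ := hr
  rintro ⟨q, rfl⟩
  have hq := h q.num q.den q.pos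
  rw [← Rat.cast_def, sub_self, abs_zero] at hq
  have hden : (0 : ℝ) < q.den := by exact_mod_cast q.pos
  exact hq.not_gt (by positivity)

theorem exists_lipschitz_log_deriv (B : ℝ → ℝ) (hB : ContDiff ℝ 2 B)
    (hlift : ∀ x, B (x + 1) = B x + 1) (hpos : ∀ x, 0 < deriv B x) :
    ∃ K, 0 ≤ K ∧ ∀ x y,
      |Real.log (deriv B x) - Real.log (deriv B y)| ≤ K * |x - y| := by
  have hB' : ContDiff ℝ 1 (deriv B) := (contDiff_succ_iff_deriv (n := 1).1 hB).2.2
  have hφ : ContDiff ℝ 1 fun x => Real.log (deriv B x) := hB'.log fun x => (hpos x).ne'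
  have hper : Function.Periodic (deriv B) 1 := fun x => by
    rw [← deriv_comp_add_const, funext hlift, deriv_add_const]
  have hper' : Function.Periodic (deriv fun x => Real.log (deriv B x)) 1 := fun x => by
    rw [← deriv_comp_add_const]
    simp only [hper _]
  obtain ⟨K, hK⟩ := (hper'.isBounded_of_continuous one_ne_zero
    (hφ.continuous_deriv le_rfl)).exists_norm_le
  have hK' : ∀ x, ‖deriv (fun x => Real.log (deriv B x)) x‖ ≤ K := fun x => hK _ (mem_range_self x)
  refine ⟨K, (norm_nonneg _).trans (hK' 0), fun x y => ?_⟩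
  exact convex_univ.norm_image_sub_le_of_norm_deriv_le
    (fun z _ => (hφ.differentiable one_ne_zero) z) (fun z _ => hK' z) (mem_univ y) (mem_univ x)

/-- A smooth circle diffeomorphism with Diophantine rotation number is ergodic
with respect to Lebesgue measure. -/
theorem stmt_4 (B : ℝ → ℝ) (hB : ContDiff ℝ (⊤ : ℕ∞) B)
    (hlift : ∀ x, B (x + 1) = B x + 1) (hpos : ∀ x, 0 < deriv B x)
    (ρ : ℝ) (hρ : Tendsto (fun n : ℕ => B^[n] 0 / (n : ℝ)) atTop (nhds ρ))
    (hdio : Diophantine ρ)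
    (f : ℝ → ℂ) (hf : Measurable f) (hper : ∀ x, f (x + 1) = f x)
    (hL2 : IntegrableOn (fun x => ‖f x‖ ^ 2) (Icc (0 : ℝ) 1) volume)
    (hinv : ∀ᵐ x : ℝ, f (B x) = f x) :
    ∃ a : ℂ, ∀ᵐ x : ℝ, f x = a := by
  have hcont : Continuous B := hB.continuous
  let F : CircleDeg1Lift := ⟨⟨B, (strictMono_of_deriv_pos hpos).monotone⟩, hlift⟩
  have hFB : ⇑F = B := rfl
  have hirr : Irrational ρ := hdio.irrational
  have hsurj : Function.Surjective F := F.continuous_iff_surjective.1 hcont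
  have hτ : F.translationNumber = ρ :=
    tendsto_nhds_unique F.tendsto_translation_number₀
      (by simpa only [CircleDeg1Lift.coe_pow, hFB] using hρ)
  obtain ⟨h, hsemi⟩ := CircleDeg1Lift.semiconj_of_bijective_of_translationNumber_eq
    (f₁ := F) (f₂ := CircleDeg1Lift.translate (Multiplicative.ofAdd ρ))
    ⟨(strictMono_of_deriv_pos hpos).injective, hsurj⟩
    (CircleDeg1Lift.isUnit_iff_bijective.1 (Units.isUnit _))
    (by rw [hτ, CircleDeg1Lift.translationNumber_translate])
  have hh : ∀ x, h (F x) = h x + ρ := fun x => by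
    rw [hsemi x, CircleDeg1Lift.translate_apply, add_comm]
  obtain ⟨K, hK, hφ⟩ := exists_lipschitz_log_deriv B
    (hB.of_le (WithTop.coe_le_coe.2 le_top)) hlift hpos
  have hd : ∀ x, HasDerivAt F (Real.exp (Real.log (deriv B x))) x := fun x => by
    rw [Real.exp_log (hpos x)]
    exact ((hB.differentiable (by simp)) x).hasDerivAt
  have hperZ : ∀ (x : ℝ) (m : ℤ), f (x + m) = f x := fun x m => by
    simpa using (Function.Periodic.int_mul hper m) x
  have hmain := fun (U : Set ℂ) (hU : MeasurableSet U) =>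
    ae_mem_of_ae_invariant F h _ ρ K hirr hsurj hh hK hφ hd (f ⁻¹' U) (hf hU)
      (fun x m => by rw [mem_preimage, mem_preimage, hperZ])
      (hinv.mono fun x hx => by rw [mem_preimage, mem_preimage, hFB, hx])
  refine Filter.exists_eventuallyEq_const_of_forall_separating MeasurableSet fun U hU => ?_
  by_cases h0 : volume (f ⁻¹' U) = 0
  · exact Or.inr (measure_eq_zero_iff_ae_notMem.1 h0)
  · exact Or.inl (hmain U hU h0)
end

section
/- Let λ₀ ∈ (0,1) and suppose that r = λ₀/(√(1−λ₀²) + λ₀) is Diophantine with constants c, β > 0. Then there exists c' > 0 such that for all integers k₁ ≥ 1 and k₂ ≥ 1, |k₁λ₀ − k₂√(1−λ₀²)| ≥ c'/(k₁+k₂)^{1+β}. -/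
open Set

theorem stmt_5 (lam c β : ℝ) (hlam : lam ∈ Ioo (0 : ℝ) 1)
    (hc : 0 < c) (hβ : 0 < β)
    (hdio : DiophantineWith c β (lam / (Real.sqrt (1 - lam ^ 2) + lam))) :
    ∃ c' > (0 : ℝ), ∀ k₁ k₂ : ℕ, 1 ≤ k₁ → 1 ≤ k₂ →
      c' / ((k₁ : ℝ) + (k₂ : ℝ)) ^ (1 + β) ≤
        |(k₁ : ℝ) * lam - (k₂ : ℝ) * Real.sqrt (1 - lam ^ 2)| := by
  set s := Real.sqrt (1 - lam ^ 2)
  have hs : 0 < s + lam := add_pos_of_nonneg_of_pos (Real.sqrt_nonneg _) hlam.1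
  refine ⟨c * (s + lam), mul_pos hc hs, fun k₁ k₂ h₁ _ => ?_⟩
  have h := hdio k₂ (k₁ + k₂) (by lia)
  push_cast at h
  have hk₁ : (1 : ℝ) ≤ k₁ := by exact_mod_cast h₁
  have hq : (0 : ℝ) < k₁ + k₂ := by positivity
  have hfactor : (k₁ : ℝ) * lam - k₂ * s =
      ((s + lam) * (k₁ + k₂)) * (lam / (s + lam) - k₂ / (k₁ + k₂)) := by
    field_simp
    ring
  have hpow : ((k₁ : ℝ) + k₂) ^ (2 + β) = (k₁ + k₂) * (k₁ + k₂) ^ (1 + β) := by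
    rw [show 2 + β = 1 + (1 + β) by ring, Real.rpow_add hq, Real.rpow_one]
  rw [hfactor, abs_mul, abs_of_pos (mul_pos hs hq)]
  calc c * (s + lam) / ((k₁ : ℝ) + k₂) ^ (1 + β)
      = ((s + lam) * (k₁ + k₂)) * (c / ((k₁ : ℝ) + k₂) ^ (2 + β)) := by
        rw [hpow]
        field_simp
    _ ≤ _ := mul_le_mul_of_nonneg_left h (mul_pos hs hq).le
end

section
/- Let λ₀ ∈ (0,1) and suppose that r = λ₀/(√(1−λ₀²) + λ₀) is Diophantine with constants c, β > 0. Then there exists c' > 0 such that for all integers k₁ ≥ 1 and k₂ ≥ 1, |λ₀²k₁² − (1−λ₀²)k₂²| ≥ c'/(k₁² + k₂²)^{(1+β)/2}. -/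
open Set

theorem stmt_6 (lam c β : ℝ) (hlam : lam ∈ Ioo (0 : ℝ) 1)
    (hc : 0 < c) (hβ : 0 < β)
    (hdio : DiophantineWith c β (lam / (Real.sqrt (1 - lam ^ 2) + lam))) :
    ∃ c' > (0 : ℝ), ∀ k₁ k₂ : ℕ, 1 ≤ k₁ → 1 ≤ k₂ →
      c' / ((k₁ : ℝ) ^ 2 + (k₂ : ℝ) ^ 2) ^ ((1 + β) / 2) ≤
        |lam ^ 2 * (k₁ : ℝ) ^ 2 - (1 - lam ^ 2) * (k₂ : ℝ) ^ 2| := by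
  obtain ⟨h0, h1⟩ := hlam
  have hs2 : Real.sqrt (1 - lam ^ 2) ^ 2 = 1 - lam ^ 2 := Real.sq_sqrt (by nlinarith)
  have hs0 : 0 ≤ Real.sqrt (1 - lam ^ 2) := Real.sqrt_nonneg _
  set s := Real.sqrt (1 - lam ^ 2) with hs
  have hsl : 0 < s + lam := by linarith
  refine ⟨c * (s + lam) ^ 2 / 2 ^ ((1 + β) / 2), by positivity, fun k₁ k₂ hk₁ hk₂ => ?_⟩
  have hd := hdio k₂ (k₁ + k₂) (by omega)
  have hx : (1 : ℝ) ≤ k₁ := by exact_mod_cast hk₁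
  have hy : (1 : ℝ) ≤ k₂ := by exact_mod_cast hk₂
  push_cast at hd
  generalize (k₁ : ℝ) = x at *
  generalize (k₂ : ℝ) = y at *
  have hq : 0 < x + y := by linarith
  have hdiff : lam / (s + lam) - y / (x + y) = (lam * x - s * y) / ((s + lam) * (x + y)) := by
    field_simp
    ring
  rw [hdiff, abs_div, abs_of_pos (mul_pos hsl hq), le_div_iff₀ (mul_pos hsl hq)] at hd
  have hpow : (x + y) ^ (2 + β) = (x + y) ^ (1 + β) * (x + y) := by
    rw [← Real.rpow_add_one hq.ne']
    ring_nf
  have hlin : c * (s + lam) / (x + y) ^ (1 + β) ≤ |lam * x - s * y| := by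
    refine le_of_eq_of_le ?_ hd
    rw [hpow]
    field_simp
  have hsum : s + lam ≤ lam * x + s * y := by nlinarith
  have hle : (x + y) ^ (1 + β) ≤ 2 ^ ((1 + β) / 2) * (x ^ 2 + y ^ 2) ^ ((1 + β) / 2) := by
    rw [← Real.mul_rpow (by norm_num) (by positivity)]
    calc (x + y) ^ (1 + β) = ((x + y) ^ 2) ^ ((1 + β) / 2) := by
          rw [← Real.rpow_natCast_mul hq.le]
          congr 1
          push_cast
          ring
      _ ≤ (2 * (x ^ 2 + y ^ 2)) ^ ((1 + β) / 2) := by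
          apply Real.rpow_le_rpow (by positivity) _ (by positivity)
          nlinarith [sq_nonneg (x - y)]
  have hfac : lam ^ 2 * x ^ 2 - (1 - lam ^ 2) * y ^ 2
      = (lam * x - s * y) * (lam * x + s * y) := by
    rw [← hs2]
    ring
  rw [hfac, abs_mul, abs_of_pos (hsl.trans_le hsum), div_div]
  calc _ ≤ c * (s + lam) ^ 2 / (x + y) ^ (1 + β) := by gcongr
    _ = c * (s + lam) / (x + y) ^ (1 + β) * (s + lam) := by ring
    _ ≤ _ := by gcongr
end

section
/- Let λ₀ ∈ (0,1) and suppose that r = λ₀/(√(1−λ₀²) + λ₀) is Diophantine with constants c, β > 0. Then there exists c' > 0 such that for all integers k₁ ≥ 1 and k₂ ≥ 1, |k₂²/(k₁² + k₂²) − λ₀²| ≥ c'/(k₁² + k₂²)^{(3+β)/2}. In particular, for every ε > 0, any pair (k₁,k₂) with |k₂²/(k₁²+k₂²) − λ₀²| ≤ ε satisfies k₁² + k₂² ≥ (c'/ε)^{2/(3+β)}. -/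
open Set

/-- The distance from `y² / (x² + y²)` to `l²` is controlled from below by the distance from
`l / (m + l)` to `y / (x + y)`, where `(l, m)` is a point of the open first-quadrant arc. -/
lemma mul_abs_sub_le_abs_sq_div_sub_sq {l m x y : ℝ} (hl : 0 < l) (hm : 0 < m)
    (hlm : m ^ 2 + l ^ 2 = 1) (hx : 0 < x) (hy : 0 < y) :
    m * l * |l / (m + l) - y / (x + y)| ≤ |y ^ 2 / (x ^ 2 + y ^ 2) - l ^ 2| := by
  have hl1 : l ≤ 1 := by nlinarith
  have hm1 : m ≤ 1 := by nlinarith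
  have hfactor : y ^ 2 / (x ^ 2 + y ^ 2) - l ^ 2 =
      -((m + l) * (x + y) * (m * y + l * x) / (x ^ 2 + y ^ 2)) *
        (l / (m + l) - y / (x + y)) := by
    have hml : m + l ≠ 0 := by positivity
    have hxy : x + y ≠ 0 := by positivity
    have hN : x ^ 2 + y ^ 2 ≠ 0 := by positivity
    field_simp
    linear_combination (-y ^ 2) * hlm
  have hcoef : 0 < (m + l) * (x + y) * (m * y + l * x) / (x ^ 2 + y ^ 2) := by positivity
  rw [hfactor, abs_mul, abs_neg, abs_of_pos hcoef]
  gcongr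
  rw [le_div_iff₀ (by positivity)]
  have hsum : 1 ≤ m + l := by nlinarith
  have hlin : m * l * (x + y) ≤ m * y + l * x := by
    have hmly : m * l * y ≤ m * y := by nlinarith [mul_pos hm hy]
    have hmlx : m * l * x ≤ l * x := by nlinarith [mul_pos hl hx]
    linarith
  calc m * l * (x ^ 2 + y ^ 2) ≤ 1 * (x + y) * (m * l * (x + y)) := by
        nlinarith [mul_pos (mul_pos hm hl) (mul_pos hx hy)]
    _ ≤ (m + l) * (x + y) * (m * y + l * x) := by gcongr

/-- A power of `x + y` is at most a constant times a larger power of the Euclidean norm. -/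
lemma add_rpow_le_mul_sq_add_sq_rpow {x y s t : ℝ} (hx : 1 ≤ x) (hy : 0 < y) (hs : 0 ≤ s)
    (hst : s ≤ t) :
    (x + y) ^ s ≤ 2 ^ (s / 2) * (x ^ 2 + y ^ 2) ^ (t / 2) := by
  have hx0 : 0 < x := by linarith
  calc (x + y) ^ s = ((x + y) ^ (2 : ℝ)) ^ (s / 2) := by
        rw [← Real.rpow_mul (by positivity)]; congr 1; ring
    _ ≤ (2 * (x ^ 2 + y ^ 2)) ^ (s / 2) := by
        gcongr
        rw [Real.rpow_two]
        nlinarith [sq_nonneg (x - y)]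
    _ = 2 ^ (s / 2) * (x ^ 2 + y ^ 2) ^ (s / 2) :=
        Real.mul_rpow (by positivity) (by positivity)
    _ ≤ 2 ^ (s / 2) * (x ^ 2 + y ^ 2) ^ (t / 2) := by
        gcongr
        nlinarith

theorem stmt_7 (lam c β : ℝ) (hlam : lam ∈ Ioo (0 : ℝ) 1)
    (hc : 0 < c) (hβ : 0 < β)
    (hdio : DiophantineWith c β (lam / (Real.sqrt (1 - lam ^ 2) + lam))) :
    ∃ c' > (0 : ℝ),
      (∀ k₁ k₂ : ℕ, 1 ≤ k₁ → 1 ≤ k₂ →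
        c' / ((k₁ : ℝ) ^ 2 + (k₂ : ℝ) ^ 2) ^ ((3 + β) / 2) ≤
          |(k₂ : ℝ) ^ 2 / ((k₁ : ℝ) ^ 2 + (k₂ : ℝ) ^ 2) - lam ^ 2|) ∧
      (∀ ε > (0 : ℝ), ∀ k₁ k₂ : ℕ, 1 ≤ k₁ → 1 ≤ k₂ →
        |(k₂ : ℝ) ^ 2 / ((k₁ : ℝ) ^ 2 + (k₂ : ℝ) ^ 2) - lam ^ 2| ≤ ε →
        (c' / ε) ^ ((2 : ℝ) / (3 + β)) ≤ (k₁ : ℝ) ^ 2 + (k₂ : ℝ) ^ 2) := by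
  obtain ⟨hl, hl1⟩ := hlam
  set m := Real.sqrt (1 - lam ^ 2) with hm_def
  have hpos : 0 < 1 - lam ^ 2 := by nlinarith
  have hm : 0 < m := Real.sqrt_pos.mpr hpos
  have hlm : m ^ 2 + lam ^ 2 = 1 := by rw [hm_def, Real.sq_sqrt hpos.le]; ring
  have hbound : ∀ k₁ k₂ : ℕ, 1 ≤ k₁ → 1 ≤ k₂ →
      m * lam * c / 2 ^ ((2 + β) / 2) / ((k₁ : ℝ) ^ 2 + (k₂ : ℝ) ^ 2) ^ ((3 + β) / 2) ≤
        |(k₂ : ℝ) ^ 2 / ((k₁ : ℝ) ^ 2 + (k₂ : ℝ) ^ 2) - lam ^ 2| := by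
    intro k₁ k₂ h₁ h₂
    have hx : (1 : ℝ) ≤ k₁ := by exact_mod_cast h₁
    have hx0 : (0 : ℝ) < k₁ := by linarith
    have hy : (0 : ℝ) < k₂ := by exact_mod_cast h₂
    have hd := hdio k₂ (k₁ + k₂) (by omega)
    push_cast at hd
    calc _ = m * lam * (c / (2 ^ ((2 + β) / 2) *
            ((k₁ : ℝ) ^ 2 + (k₂ : ℝ) ^ 2) ^ ((3 + β) / 2))) := by
          rw [div_div, mul_div_assoc]
      _ ≤ m * lam * (c / ((k₁ : ℝ) + k₂) ^ (2 + β)) := by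
          gcongr
          exact add_rpow_le_mul_sq_add_sq_rpow hx hy (by linarith) (by linarith)
      _ ≤ m * lam * |lam / (m + lam) - k₂ / (k₁ + k₂)| := by gcongr
      _ ≤ _ := mul_abs_sub_le_abs_sq_div_sub_sq hl hm hlm hx0 hy
  refine ⟨m * lam * c / 2 ^ ((2 + β) / 2), by positivity, hbound, ?_⟩
  intro ε hε k₁ k₂ h₁ h₂ hclose
  have hx : (0 : ℝ) < k₁ := by exact_mod_cast h₁
  have hle := (hbound k₁ k₂ h₁ h₂).trans hclose
  rw [div_le_comm₀ (by positivity) hε] at hle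
  calc _ ≤ (((k₁ : ℝ) ^ 2 + (k₂ : ℝ) ^ 2) ^ ((3 + β) / 2)) ^ ((2 : ℝ) / (3 + β)) := by gcongr
    _ = (k₁ : ℝ) ^ 2 + (k₂ : ℝ) ^ 2 := by
        rw [← Real.rpow_mul (by positivity), div_mul_div_cancel₀ (by positivity),
          div_self (by positivity), Real.rpow_one]
end

section
/- Let λ₀ ∈ (0,1) and suppose that r = λ₀/(√(1−λ₀²) + λ₀) is Diophantine. Let f : ℝ² → ℝ be a C^∞ function whose support is a compact subset of the open square (0,1)², and for integers k₁,k₂ ≥ 1 set f̂(k₁,k₂) = ∫_{[0,1]²} f(x₁,x₂) sin(πk₁x₁) sin(πk₂x₂) dx₁dx₂. Then for every N ∈ ℕ there exists a constant C such that for every ε ∈ (0,1], Σ f̂(k₁,k₂)² ≤ C·ε^N, where the sum ranges over all integers k₁,k₂ ≥ 1 with |k₂²/(k₁²+k₂²) − λ₀²| ≤ ε. -/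
open Set MeasureTheory

/-- The coefficients of `f` in the Dirichlet sine basis on the unit square. -/
noncomputable def sineCoef (f : ℝ × ℝ → ℝ) (k₁ k₂ : ℕ) : ℝ :=
  ∫ x in Icc (0 : ℝ) 1 ×ˢ Icc (0 : ℝ) 1,
    f x * Real.sin (Real.pi * (k₁ : ℝ) * x.1) * Real.sin (Real.pi * (k₂ : ℝ) * x.2)

theorem ContDiff.directional_fderiv {f : ℝ × ℝ → ℝ} (hf : ContDiff ℝ (⊤ : ℕ∞) f) (v : ℝ × ℝ) :
    ContDiff ℝ (⊤ : ℕ∞) (fun x => fderiv ℝ f x v) :=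
  (hf.fderiv_right (m := (⊤ : ℕ∞)) (by exact_mod_cast le_top)).clm_apply contDiff_const

theorem integral_mul_fderiv_eq_of_hasCompactSupport {f g : ℝ × ℝ → ℝ}
    (hf : ContDiff ℝ (⊤ : ℕ∞) f) (hc : HasCompactSupport f) (hg : ContDiff ℝ (⊤ : ℕ∞) g)
    (v : ℝ × ℝ) :
    ∫ x, f x * fderiv ℝ g x v = - ∫ x, fderiv ℝ f x v * g x := by
  have hf' := hf.directional_fderiv v
  have hg' := hg.directional_fderiv v
  refine integral_mul_fderiv_eq_neg_fderiv_mul_of_integrable ?_ ?_ ?_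
    (fun x _ => (hf.differentiable (by simp)) x) (fun x _ => (hg.differentiable (by simp)) x)
  · exact (hf'.continuous.mul hg.continuous).integrable_of_hasCompactSupport
      ((hc.fderiv_apply ℝ v).mul_right)
  · exact (hf.continuous.mul hg'.continuous).integrable_of_hasCompactSupport hc.mul_right
  · exact (hf.continuous.mul hg.continuous).integrable_of_hasCompactSupport hc.mul_right

theorem integral_mul_second_fderiv_eq_of_hasCompactSupport {f g : ℝ × ℝ → ℝ}
    (hf : ContDiff ℝ (⊤ : ℕ∞) f) (hc : HasCompactSupport f) (hg : ContDiff ℝ (⊤ : ℕ∞) g)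
    (v : ℝ × ℝ) :
    ∫ x, f x * fderiv ℝ (fun y => fderiv ℝ g y v) x v =
      ∫ x, fderiv ℝ (fun y => fderiv ℝ f y v) x v * g x := by
  rw [integral_mul_fderiv_eq_of_hasCompactSupport hf hc (hg.directional_fderiv v),
    integral_mul_fderiv_eq_of_hasCompactSupport (hf.directional_fderiv v)
      (hc.fderiv_apply ℝ v) hg, neg_neg]

theorem fderiv_mul_fst_snd {S T S' T' : ℝ → ℝ} (hS : ∀ t, HasDerivAt S (S' t) t)
    (hT : ∀ t, HasDerivAt T (T' t) t) (x v : ℝ × ℝ) :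
    fderiv ℝ (fun y : ℝ × ℝ => S y.1 * T y.2) x v =
      v.1 * (S' x.1 * T x.2) + v.2 * (S x.1 * T' x.2) := by
  have h1 := (hS x.1).comp_hasFDerivAt x (hasFDerivAt_fst (𝕜 := ℝ) (p := x))
  have h2 := (hT x.2).comp_hasFDerivAt x (hasFDerivAt_snd (𝕜 := ℝ) (p := x))
  have h := (h1.mul h2).fderiv
  have e : (fun y : ℝ × ℝ => S y.1 * T y.2) = (S ∘ Prod.fst) * (T ∘ Prod.snd) := rfl
  rw [e, h]
  simp
  ring

theorem hasDerivAt_sin_const_mul (a t : ℝ) :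
    HasDerivAt (fun t => Real.sin (a * t)) (a * Real.cos (a * t)) t := by
  simpa [mul_comm] using ((hasDerivAt_id t).const_mul a).sin

theorem hasDerivAt_mul_cos_const_mul (a t : ℝ) :
    HasDerivAt (fun t => a * Real.cos (a * t)) (-a ^ 2 * Real.sin (a * t)) t := by
  have h := (((hasDerivAt_id t).const_mul a).cos).const_mul a
  simp only [id, mul_one] at h
  exact h.congr_deriv (by ring)

theorem second_fderiv_sin_mul_sin_fst (a b : ℝ) (x : ℝ × ℝ) :
    fderiv ℝ (fun y => fderiv ℝ (fun z : ℝ × ℝ => Real.sin (a * z.1) * Real.sin (b * z.2))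
      y (1, 0)) x (1, 0) = -a ^ 2 * (Real.sin (a * x.1) * Real.sin (b * x.2)) := by
  have h1 := fun y => fderiv_mul_fst_snd (hasDerivAt_sin_const_mul a)
    (hasDerivAt_sin_const_mul b) y (1, 0)
  have h2 := fderiv_mul_fst_snd (hasDerivAt_mul_cos_const_mul a)
    (hasDerivAt_sin_const_mul b) x (1, 0)
  simp only [one_mul, zero_mul, add_zero] at h1 h2
  simp only [h1, h2]
  ring

theorem second_fderiv_sin_mul_sin_snd (a b : ℝ) (x : ℝ × ℝ) :
    fderiv ℝ (fun y => fderiv ℝ (fun z : ℝ × ℝ => Real.sin (a * z.1) * Real.sin (b * z.2))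
      y (0, 1)) x (0, 1) = -b ^ 2 * (Real.sin (a * x.1) * Real.sin (b * x.2)) := by
  have h1 := fun y => fderiv_mul_fst_snd (hasDerivAt_sin_const_mul a)
    (hasDerivAt_sin_const_mul b) y (0, 1)
  have h2 := fderiv_mul_fst_snd (hasDerivAt_sin_const_mul a)
    (hasDerivAt_mul_cos_const_mul b) x (0, 1)
  simp only [one_mul, zero_mul, zero_add] at h1 h2
  simp only [h1, h2]
  ring

/-- Rapid decay of the integrals of a test function against products of sines. -/
theorem exists_pow_mul_abs_integral_sin_mul_sin_le (j : ℕ) :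
    ∀ f : ℝ × ℝ → ℝ, ContDiff ℝ (⊤ : ℕ∞) f → HasCompactSupport f →
      ∃ C : ℝ, ∀ a b : ℝ, (a ^ 2 + b ^ 2) ^ j *
        |∫ x, f x * (Real.sin (a * x.1) * Real.sin (b * x.2))| ≤ C := by
  induction j with
  | zero =>
    intro f hf hc
    refine ⟨∫ x, ‖f x‖, fun a b => ?_⟩
    rw [pow_zero, one_mul, ← Real.norm_eq_abs]
    refine norm_integral_le_of_norm_le
      (hf.continuous.integrable_of_hasCompactSupport hc).norm (.of_forall fun x => ?_)
    rw [norm_mul, norm_mul]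
    have h1 : ‖Real.sin (a * x.1)‖ ≤ 1 := Real.abs_sin_le_one _
    have h2 : ‖Real.sin (b * x.2)‖ ≤ 1 := Real.abs_sin_le_one _
    exact mul_le_of_le_one_right (norm_nonneg _) (mul_le_one₀ h1 (norm_nonneg _) h2)
  | succ j ih =>
    intro f hf hc
    set u : ℝ × ℝ → ℝ := fun x => fderiv ℝ (fun y => fderiv ℝ f y (1, 0)) x (1, 0) with hu
    set w : ℝ × ℝ → ℝ := fun x => fderiv ℝ (fun y => fderiv ℝ f y (0, 1)) x (0, 1) with hw
    have hus : ContDiff ℝ (⊤ : ℕ∞) u := (hf.directional_fderiv _).directional_fderiv _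
    have hws : ContDiff ℝ (⊤ : ℕ∞) w := (hf.directional_fderiv _).directional_fderiv _
    have huc : HasCompactSupport u := (hc.fderiv_apply ℝ _).fderiv_apply ℝ _
    have hwc : HasCompactSupport w := (hc.fderiv_apply ℝ _).fderiv_apply ℝ _
    obtain ⟨C, hC⟩ := ih (u + w) (hus.add hws) (huc.add hwc)
    refine ⟨C, fun a b => ?_⟩
    set g : ℝ × ℝ → ℝ := fun z => Real.sin (a * z.1) * Real.sin (b * z.2) with hg
    have hgs : ContDiff ℝ (⊤ : ℕ∞) g := by
      rw [hg]; fun_prop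
    have h1 := integral_mul_second_fderiv_eq_of_hasCompactSupport hf hc hgs (1, 0)
    have h2 := integral_mul_second_fderiv_eq_of_hasCompactSupport hf hc hgs (0, 1)
    have e1 : ∀ x, fderiv ℝ (fun y => fderiv ℝ g y (1, 0)) x (1, 0) = -a ^ 2 * g x :=
      second_fderiv_sin_mul_sin_fst a b
    have e2 : ∀ x, fderiv ℝ (fun y => fderiv ℝ g y (0, 1)) x (0, 1) = -b ^ 2 * g x :=
      second_fderiv_sin_mul_sin_snd a b
    simp only [e1, e2, mul_left_comm (f _), integral_const_mul] at h1 h2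
    have h3 : ∫ x, (u + w) x * g x = (∫ x, u x * g x) + ∫ x, w x * g x := by
      rw [← integral_add (f := fun x => u x * g x) (g := fun x => w x * g x)
        ((hus.continuous.mul hgs.continuous).integrable_of_hasCompactSupport huc.mul_right)
        ((hws.continuous.mul hgs.continuous).integrable_of_hasCompactSupport hwc.mul_right)]
      simp only [Pi.add_apply, add_mul]
    have h4 : (a ^ 2 + b ^ 2) * (∫ x, f x * g x) = -∫ x, (u + w) x * g x := by
      rw [h3, hu, hw, ← h1, ← h2]
      ring
    have hn : 0 ≤ a ^ 2 + b ^ 2 := by positivity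
    calc (a ^ 2 + b ^ 2) ^ (j + 1) * |∫ x, f x * g x|
        = (a ^ 2 + b ^ 2) ^ j * |(a ^ 2 + b ^ 2) * ∫ x, f x * g x| := by
          rw [abs_mul, abs_of_nonneg hn]; ring
      _ ≤ C := by rw [h4, abs_neg]; exact hC a b

theorem sineCoef_eq_integral {f : ℝ × ℝ → ℝ}
    (hsupp : tsupport f ⊆ Ioo (0 : ℝ) 1 ×ˢ Ioo (0 : ℝ) 1) (k₁ k₂ : ℕ) :
    sineCoef f k₁ k₂ = ∫ x : ℝ × ℝ, f x *
      (Real.sin (Real.pi * k₁ * x.1) * Real.sin (Real.pi * k₂ * x.2)) := by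
  rw [sineCoef, setIntegral_eq_integral_of_forall_compl_eq_zero]
  · simp only [mul_assoc]
  · intro x hx
    have : f x = 0 := by
      by_contra h
      have := hsupp (subset_tsupport f h)
      exact hx (prod_mono Ioo_subset_Icc_self Ioo_subset_Icc_self this)
    simp [this]

theorem exists_sq_add_sq_pow_mul_abs_sineCoef_le {f : ℝ × ℝ → ℝ}
    (hf : ContDiff ℝ (⊤ : ℕ∞) f) (hcpt : HasCompactSupport f)
    (hsupp : tsupport f ⊆ Ioo (0 : ℝ) 1 ×ˢ Ioo (0 : ℝ) 1) (j : ℕ) :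
    ∃ C : ℝ, ∀ k₁ k₂ : ℕ, ((k₁ : ℝ) ^ 2 + (k₂ : ℝ) ^ 2) ^ j * |sineCoef f k₁ k₂| ≤ C := by
  obtain ⟨C, hC⟩ := exists_pow_mul_abs_integral_sin_mul_sin_le j f hf hcpt
  refine ⟨C, fun k₁ k₂ => le_trans ?_ (hC (Real.pi * k₁) (Real.pi * k₂))⟩
  rw [sineCoef_eq_integral hsupp]
  gcongr <;>
  · exact le_mul_of_one_le_left (by positivity) (by linarith [Real.pi_gt_three])

/-- On the unit quarter circle, the map `(b, a) ↦ b / (a + b)` is controlled by `b ^ 2`. -/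
theorem abs_div_add_sub_div_add_le {a b μ l m : ℝ} (ha : 0 ≤ a) (hb : 0 ≤ b) (hμ : 0 < μ)
    (hl : 0 < l) (hab : a ^ 2 + b ^ 2 = 1) (hml : μ ^ 2 + l ^ 2 = 1) (hm : 0 < m) (hmμ : m ≤ μ)
    (hm_l : m ≤ l) :
    m * |l / (μ + l) - b / (a + b)| ≤ |b ^ 2 - l ^ 2| := by
  have h1 : 1 ≤ a + b := by nlinarith [mul_nonneg ha hb]
  have h2 : 1 ≤ μ + l := by nlinarith [mul_pos hμ hl]
  have e : l / (μ + l) - b / (a + b) = (l * a - b * μ) / ((μ + l) * (a + b)) := by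
    field_simp; ring
  have h3 : |l / (μ + l) - b / (a + b)| ≤ |l * a - b * μ| := by
    rw [e, abs_div]
    refine div_le_self (abs_nonneg _) ?_
    rw [abs_of_nonneg (by positivity)]
    nlinarith
  have h4 : m ≤ l * a + b * μ := by nlinarith
  calc m * |l / (μ + l) - b / (a + b)| ≤ (l * a + b * μ) * |l * a - b * μ| := by gcongr
    _ = |b ^ 2 - l ^ 2| := by
      rw [← abs_of_nonneg (show 0 ≤ l * a + b * μ by positivity), ← abs_mul, abs_sub_comm]
      congr 1
      linear_combination l ^ 2 * hab - b ^ 2 * hml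

theorem Diophantine.exists_le_mul_pow {lam : ℝ} (hlam : lam ∈ Ioo (0 : ℝ) 1)
    (hdio : Diophantine (lam / (Real.sqrt (1 - lam ^ 2) + lam))) :
    ∃ d > (0 : ℝ), ∃ M : ℕ, ∀ k₁ k₂ : ℕ, 1 ≤ k₁ → 1 ≤ k₂ → ∀ ε : ℝ,
      |(k₂ : ℝ) ^ 2 / ((k₁ : ℝ) ^ 2 + (k₂ : ℝ) ^ 2) - lam ^ 2| ≤ ε →
      d ≤ ε * ((k₁ : ℝ) ^ 2 + (k₂ : ℝ) ^ 2) ^ M := by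
  obtain ⟨c, hc, β, hβ, h⟩ := hdio
  obtain ⟨hl0, hl1⟩ := hlam
  have hpos : 0 < 1 - lam ^ 2 := by nlinarith
  set μ := Real.sqrt (1 - lam ^ 2) with hμdef
  have hμ : 0 < μ := Real.sqrt_pos.2 hpos
  have hμ2 : μ ^ 2 = 1 - lam ^ 2 := Real.sq_sqrt hpos.le
  have hm : 0 < min μ lam := lt_min hμ hl0
  refine ⟨min μ lam * c, mul_pos hm hc, ⌈2 + β⌉₊, fun k₁ k₂ h1 h2 ε hε => ?_⟩
  have h1' : (1 : ℝ) ≤ k₁ := by exact_mod_cast h1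
  have h2' : (1 : ℝ) ≤ k₂ := by exact_mod_cast h2
  set n := (k₁ : ℝ) ^ 2 + (k₂ : ℝ) ^ 2 with hn
  have hn0 : 0 < n := by positivity
  have hs0 : 0 < Real.sqrt n := Real.sqrt_pos.2 hn0
  have hs2 : Real.sqrt n ^ 2 = n := Real.sq_sqrt hn0.le
  have key := abs_div_add_sub_div_add_le (a := k₁ / Real.sqrt n) (b := k₂ / Real.sqrt n)
    (by positivity) (by positivity) hμ hl0
    (by rw [div_pow, div_pow, hs2, ← add_div, ← hn, div_self hn0.ne']) (by rw [hμ2]; ring) hm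
    (min_le_left _ _) (min_le_right _ _)
  have hfrac : (k₂ / Real.sqrt n) / (k₁ / Real.sqrt n + k₂ / Real.sqrt n) =
      ((k₂ : ℤ) : ℝ) / ((k₁ + k₂ : ℕ) : ℝ) := by
    push_cast; field_simp
  rw [hfrac, div_pow, hs2] at key
  have hd := h k₂ (k₁ + k₂) (by omega)
  have hq1 : (1 : ℝ) ≤ ((k₁ + k₂ : ℕ) : ℝ) := by push_cast; linarith
  have hqn : ((k₁ + k₂ : ℕ) : ℝ) ≤ n := by push_cast; nlinarith
  have hpow : ((k₁ + k₂ : ℕ) : ℝ) ^ (2 + β) ≤ n ^ ⌈2 + β⌉₊ :=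
    calc ((k₁ + k₂ : ℕ) : ℝ) ^ (2 + β) ≤ ((k₁ + k₂ : ℕ) : ℝ) ^ ((⌈2 + β⌉₊ : ℕ) : ℝ) :=
          Real.rpow_le_rpow_of_exponent_le hq1 (Nat.le_ceil _)
      _ = ((k₁ + k₂ : ℕ) : ℝ) ^ ⌈2 + β⌉₊ := Real.rpow_natCast _ _
      _ ≤ n ^ ⌈2 + β⌉₊ := by gcongr
  have hd2 : c / n ^ ⌈2 + β⌉₊ ≤ c / ((k₁ + k₂ : ℕ) : ℝ) ^ (2 + β) := by gcongr
  have hfin : min μ lam * (c / n ^ ⌈2 + β⌉₊) ≤ ε :=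
    (mul_le_mul_of_nonneg_left (hd2.trans hd) hm.le).trans (key.trans hε)
  rwa [← mul_div_assoc, div_le_iff₀ (by positivity)] at hfin

theorem stmt_8 (lam : ℝ) (hlam : lam ∈ Ioo (0 : ℝ) 1)
    (hdio : Diophantine (lam / (Real.sqrt (1 - lam ^ 2) + lam)))
    (f : ℝ × ℝ → ℝ) (hf : ContDiff ℝ (⊤ : ℕ∞) f)
    (hcpt : HasCompactSupport f)
    (hsupp : tsupport f ⊆ Ioo (0 : ℝ) 1 ×ˢ Ioo (0 : ℝ) 1) :
    ∀ N : ℕ, ∃ C > (0 : ℝ), ∀ ε ∈ Ioc (0 : ℝ) 1,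
      ∑' k : {p : ℕ × ℕ // 1 ≤ p.1 ∧ 1 ≤ p.2 ∧
          |(p.2 : ℝ) ^ 2 / ((p.1 : ℝ) ^ 2 + (p.2 : ℝ) ^ 2) - lam ^ 2| ≤ ε},
        (sineCoef f k.1.1 k.1.2) ^ 2 ≤ C * ε ^ N := by
  intro N
  obtain ⟨d, hd, M, hM⟩ := hdio.exists_le_mul_pow hlam
  obtain ⟨C, hC⟩ := exists_sq_add_sq_pow_mul_abs_sineCoef_le hf hcpt hsupp (M * N + 1)
  set G : ℕ × ℕ → ℝ := fun p => 1 / (p.1 : ℝ) ^ 2 * (1 / (p.2 : ℝ) ^ 2) with hG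
  have hG0 : ∀ p, 0 ≤ G p := fun p => by positivity
  have hsum1 : Summable (fun n : ℕ => 1 / (n : ℝ) ^ 2) :=
    Real.summable_one_div_nat_pow.2 one_lt_two
  have hGs : Summable G :=
    hsum1.mul_of_nonneg hsum1 (fun n => by positivity) (fun n => by positivity)
  refine ⟨C ^ 2 / d ^ N * (∑' p, G p) + 1, by
    have : 0 ≤ ∑' p, G p := tsum_nonneg hG0
    positivity, fun ε hε => ?_⟩
  have hε0 := hε.1
  have hterm : ∀ k : {p : ℕ × ℕ // 1 ≤ p.1 ∧ 1 ≤ p.2 ∧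
      |(p.2 : ℝ) ^ 2 / ((p.1 : ℝ) ^ 2 + (p.2 : ℝ) ^ 2) - lam ^ 2| ≤ ε},
      (sineCoef f k.1.1 k.1.2) ^ 2 ≤ C ^ 2 / d ^ N * ε ^ N * G k.1 := by
    rintro ⟨⟨k₁, k₂⟩, h1, h2, h3⟩
    have hk := hC k₁ k₂
    have hkd := hM k₁ k₂ h1 h2 ε h3
    have h1' : (1 : ℝ) ≤ k₁ := by exact_mod_cast h1
    have h2' : (1 : ℝ) ≤ k₂ := by exact_mod_cast h2
    simp only [hG]
    set n := (k₁ : ℝ) ^ 2 + (k₂ : ℝ) ^ 2 with hn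
    have hn1 : 1 ≤ n := by nlinarith
    have hnk : (k₁ : ℝ) * k₂ ≤ n := by nlinarith [sq_nonneg ((k₁ : ℝ) - k₂)]
    have hS : (n ^ (M * N + 1)) ^ 2 * sineCoef f k₁ k₂ ^ 2 ≤ C ^ 2 := by
      rw [← sq_abs (sineCoef f k₁ k₂), ← mul_pow]
      gcongr
    have hdN : d ^ N ≤ ε ^ N * n ^ (M * N) := by
      rw [pow_mul, ← mul_pow]
      gcongr
    have hlow : ((k₁ : ℝ) * k₂) ^ 2 * n ^ (M * N) ≤ (n ^ (M * N + 1)) ^ 2 := by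
      calc ((k₁ : ℝ) * k₂) ^ 2 * n ^ (M * N)
          ≤ n ^ 2 * n ^ (M * N) * n ^ (M * N) := by
            refine le_trans ?_ (le_mul_of_one_le_right (by positivity) (one_le_pow₀ hn1))
            gcongr
        _ = _ := by ring
    have hfin : d ^ N * (((k₁ : ℝ) * k₂) ^ 2 * sineCoef f k₁ k₂ ^ 2) ≤ C ^ 2 * ε ^ N :=
      calc d ^ N * (((k₁ : ℝ) * k₂) ^ 2 * sineCoef f k₁ k₂ ^ 2)
          ≤ (ε ^ N * n ^ (M * N)) * (((k₁ : ℝ) * k₂) ^ 2 * sineCoef f k₁ k₂ ^ 2) := by gcongr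
        _ = ε ^ N * ((((k₁ : ℝ) * k₂) ^ 2 * n ^ (M * N)) * sineCoef f k₁ k₂ ^ 2) := by ring
        _ ≤ ε ^ N * ((n ^ (M * N + 1)) ^ 2 * sineCoef f k₁ k₂ ^ 2) := by gcongr
        _ ≤ ε ^ N * C ^ 2 := by gcongr
        _ = C ^ 2 * ε ^ N := mul_comm _ _
    have e : C ^ 2 / d ^ N * ε ^ N * (1 / (k₁ : ℝ) ^ 2 * (1 / (k₂ : ℝ) ^ 2)) =
        C ^ 2 * ε ^ N / (d ^ N * ((k₁ : ℝ) * k₂) ^ 2) := by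
      field_simp
    rw [e, le_div_iff₀ (by positivity)]
    linarith
  have hsub := (hGs.subtype {p : ℕ × ℕ | 1 ≤ p.1 ∧ 1 ≤ p.2 ∧
      |(p.2 : ℝ) ^ 2 / ((p.1 : ℝ) ^ 2 + (p.2 : ℝ) ^ 2) - lam ^ 2| ≤ ε}).mul_left
      (C ^ 2 / d ^ N * ε ^ N)
  calc _ ≤ ∑' k : {p : ℕ × ℕ // 1 ≤ p.1 ∧ 1 ≤ p.2 ∧
          |(p.2 : ℝ) ^ 2 / ((p.1 : ℝ) ^ 2 + (p.2 : ℝ) ^ 2) - lam ^ 2| ≤ ε},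
          C ^ 2 / d ^ N * ε ^ N * G k.1 :=
        Summable.tsum_le_tsum hterm
          (Summable.of_nonneg_of_le (fun _ => sq_nonneg _) hterm hsub) hsub
    _ ≤ C ^ 2 / d ^ N * ε ^ N * ∑' p, G p := by
        rw [tsum_mul_left]
        gcongr
        exact Summable.tsum_subtype_le G _ hG0 hGs
    _ ≤ (C ^ 2 / d ^ N * (∑' p, G p) + 1) * ε ^ N := by
        have : 0 < ε ^ N := by positivity
        linarith
end

section
/- Let λ₀ ∈ (0,1) and let μ be a finite Borel measure on ℝ supported in [0,1]. Suppose there exist constants C > 0 and N ≥ 3 such that μ((λ₀² − ε, λ₀² + ε)) ≤ C·ε^N for all ε ∈ (0,1]. Then there exists a constant C' such that for all t ∈ ℝ, ∫ ((cos(t√z) − cos(tλ₀))/(λ₀² − z))² dμ(z) ≤ C', where the integrand is defined to be 0 at z = λ₀² (a μ-null point). -/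
open Set MeasureTheory

theorem ofReal_inv_sq_le_one_add_tsum (c z : ℝ) :
    ENNReal.ofReal (((c - z) ^ 2)⁻¹) ≤
      1 + ∑' n : ℕ, (Ioo (c - (1 / 2) ^ n) (c + (1 / 2) ^ n)).indicator
        (fun _ => ENNReal.ofReal (4 ^ (n + 1))) z := by
  rcases eq_or_ne (c - z) 0 with h0 | h0
  · simp [h0]
  have hpos : 0 < |c - z| := abs_pos.mpr h0
  rcases le_or_gt 1 |c - z| with h1 | h1
  · refine le_trans ?_ le_self_add
    rw [ENNReal.ofReal_le_one]
    apply inv_le_one_of_one_le₀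
    rw [← sq_abs]
    exact one_le_pow₀ h1
  · classical
    have hex : ∃ k : ℕ, (1 / 2 : ℝ) ^ k ≤ |c - z| :=
      (exists_pow_lt_of_lt_one hpos (by norm_num)).imp fun _ h => h.le
    obtain ⟨n, hn⟩ : ∃ n, Nat.find hex = n + 1 := by
      refine Nat.exists_eq_succ_of_ne_zero fun h => ?_
      have := Nat.find_spec hex
      rw [h, pow_zero] at this
      exact this.not_gt h1
    have hlow : (1 / 2 : ℝ) ^ (n + 1) ≤ |c - z| := hn ▸ Nat.find_spec hex
    have hup : |c - z| < (1 / 2 : ℝ) ^ n := not_le.mp (Nat.find_min hex (by lia))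
    have hle : ((c - z) ^ 2)⁻¹ ≤ 4 ^ (n + 1) := by
      have h : ((1 / 2 : ℝ) ^ (n + 1)) ^ 2 ≤ (c - z) ^ 2 := by
        rw [← sq_abs (c - z)]
        gcongr
      refine (inv_anti₀ (by positivity) h).trans_eq ?_
      rw [← pow_mul, mul_comm, pow_mul, ← inv_pow]
      norm_num
    have hmem : z ∈ Ioo (c - (1 / 2) ^ n) (c + (1 / 2) ^ n) := by
      rw [abs_lt] at hup
      constructor <;> linarith
    refine le_trans ?_ (le_add_left (ENNReal.le_tsum n))
    rw [indicator_of_mem hmem]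
    exact ENNReal.ofReal_le_ofReal hle

theorem lintegral_inv_sq_lt_top (μ : Measure ℝ) [IsFiniteMeasure μ] (c C : ℝ)
    (hμ : ∀ ε ∈ Ioc (0 : ℝ) 1, μ (Ioo (c - ε) (c + ε)) ≤ ENNReal.ofReal (C * ε ^ 3)) :
    ∫⁻ z, ENNReal.ofReal (((c - z) ^ 2)⁻¹) ∂μ < ⊤ := by
  refine (lintegral_mono (ofReal_inv_sq_le_one_add_tsum c)).trans_lt ?_
  rw [lintegral_add_left measurable_const,
    lintegral_tsum fun n => (measurable_const.indicator measurableSet_Ioo).aemeasurable]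
  refine ENNReal.add_lt_top.mpr ⟨by simp, ?_⟩
  have hterm (n : ℕ) : ∫⁻ z, (Ioo (c - (1 / 2) ^ n) (c + (1 / 2) ^ n)).indicator
      (fun _ => ENNReal.ofReal (4 ^ (n + 1))) z ∂μ ≤ ENNReal.ofReal (4 * C * (1 / 2) ^ n) := by
    rw [lintegral_indicator_const measurableSet_Ioo]
    calc _ ≤ ENNReal.ofReal (4 ^ (n + 1)) * ENNReal.ofReal (C * ((1 / 2) ^ n) ^ 3) := by
          gcongr
          exact hμ _ ⟨by positivity, pow_le_one₀ (by norm_num) (by norm_num)⟩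
      _ = ENNReal.ofReal (4 * C * (1 / 2) ^ n) := by
          rw [← ENNReal.ofReal_mul (by positivity)]
          congr 1
          have h : (4 : ℝ) ^ n * ((1 / 2) ^ n) ^ 2 = 1 := by
            rw [← pow_mul, mul_comm n, pow_mul, ← mul_pow]
            norm_num
          linear_combination 4 * C * (1 / 2) ^ n * h
  exact (ENNReal.tsum_le_tsum hterm).trans_lt
    (summable_geometric_two.mul_left (4 * C)).tsum_ofReal_lt_top

theorem stmt_11 (lam : ℝ) (hlam : lam ∈ Ioo (0 : ℝ) 1)
    (μ : Measure ℝ) [IsFiniteMeasure μ] (hsupp : μ (Icc (0 : ℝ) 1)ᶜ = 0)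
    (C N : ℝ) (hC : 0 < C) (hN : 3 ≤ N)
    (hμ : ∀ ε ∈ Ioc (0 : ℝ) 1,
      μ (Ioo (lam ^ 2 - ε) (lam ^ 2 + ε)) ≤ ENNReal.ofReal (C * ε ^ N)) :
    ∃ C' : ℝ, ∀ t : ℝ,
      (∫⁻ z, ENNReal.ofReal
          (if z = lam ^ 2 then 0
           else ((Real.cos (t * Real.sqrt z) - Real.cos (t * lam)) / (lam ^ 2 - z)) ^ 2) ∂μ)
        ≤ ENNReal.ofReal C' := by
  have hfin : ∫⁻ z, ENNReal.ofReal (((lam ^ 2 - z) ^ 2)⁻¹) ∂μ < ⊤ := by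
    refine lintegral_inv_sq_lt_top μ (lam ^ 2) C fun ε hε => (hμ ε hε).trans ?_
    gcongr
    exact (Real.rpow_le_rpow_of_exponent_ge hε.1 hε.2 hN).trans_eq (by norm_cast)
  refine ⟨(ENNReal.ofReal 4 * ∫⁻ z, ENNReal.ofReal (((lam ^ 2 - z) ^ 2)⁻¹) ∂μ).toReal,
    fun t => ?_⟩
  rw [ENNReal.ofReal_toReal (ENNReal.mul_lt_top ENNReal.ofReal_lt_top hfin).ne,
    ← lintegral_const_mul' _ _ ENNReal.ofReal_ne_top]
  refine lintegral_mono fun z => ?_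
  rw [← ENNReal.ofReal_mul (by norm_num)]
  apply ENNReal.ofReal_le_ofReal
  split_ifs
  · positivity
  · rw [div_pow, div_eq_mul_inv]
    gcongr
    have h₁ := Real.abs_cos_le_one (t * Real.sqrt z)
    have h₂ := Real.abs_cos_le_one (t * lam)
    rw [abs_le] at h₁ h₂
    nlinarith
end

section
/- Let ω ∈ ℂ with Re ω ∈ (0,1) and Im ω ≠ 0. Define A(x,ω) = −x₁²/ω² + x₂²/(1−ω²) for x = (x₁,x₂) ∈ ℝ², and c_ω = i·sgn(Im ω)/(4πω√(1−ω²)), where √ denotes the principal branch of the square root on ℂ∖(−∞,0]. Then x ↦ log A(x,ω) (principal complex logarithm) is locally integrable on ℝ², and for every C^∞ compactly supported φ : ℝ² → ℂ one has c_ω · ∫_{ℝ²} log(A(x,ω)) · ((1−ω²)∂²φ/∂x₂²(x) − ω²∂²φ/∂x₁²(x)) dx = φ(0); that is, E_ω(x) = c_ω log A(x,ω) is a fundamental solution of the operator P(ω) = (1−ω²)∂²_{x₂} − ω²∂²_{x₁}. -/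
open Set MeasureTheory Filter Topology

lemma mem_slitPlane_of_mul_im_pos {σ : ℝ} {z : ℂ} (h : 0 < σ * z.im) : z ∈ Complex.slitPlane := by
  refine Complex.mem_slitPlane_iff.2 (Or.inr fun h0 => ?_)
  simp [h0] at h

lemma mul_im_le_norm {σ : ℝ} (hσ : |σ| = 1) (z : ℂ) : σ * z.im ≤ ‖z‖ :=
  calc σ * z.im ≤ |σ * z.im| := le_abs_self _
    _ = |z.im| := by rw [abs_mul, hσ, one_mul]
    _ ≤ ‖z‖ := Complex.abs_im_le_norm z

/-- The complex diagonal quadratic form `a x₁² + b x₂²` on the plane. -/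
noncomputable def diagForm (a b : ℂ) (x : ℝ × ℝ) : ℂ := a * (x.1 : ℂ) ^ 2 + b * (x.2 : ℂ) ^ 2

lemma contDiff_diagForm (a b : ℂ) {n : WithTop ℕ∞} : ContDiff ℝ n (diagForm a b) := by
  have h1 : ContDiff ℝ n (fun x : ℝ × ℝ => (x.1 : ℂ)) :=
    Complex.ofRealCLM.contDiff.comp contDiff_fst
  have h2 : ContDiff ℝ n (fun x : ℝ × ℝ => (x.2 : ℂ)) :=
    Complex.ofRealCLM.contDiff.comp contDiff_snd
  exact (contDiff_const.mul (h1.pow 2)).add (contDiff_const.mul (h2.pow 2))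

lemma mul_im_diagForm_add {σ : ℝ} (hσ : |σ| = 1) (a b : ℂ) (t : ℝ) (x : ℝ × ℝ) :
    σ * (diagForm a b x + (t : ℂ) ^ 2 * (σ * Complex.I)).im =
      σ * a.im * x.1 ^ 2 + σ * b.im * x.2 ^ 2 + t ^ 2 := by
  have h2 : σ * σ = 1 := by rw [← abs_mul_abs_self, hσ, one_mul]
  have e : diagForm a b x + (t : ℂ) ^ 2 * (σ * Complex.I) =
      a * ((x.1 ^ 2 : ℝ) : ℂ) + b * ((x.2 ^ 2 : ℝ) : ℂ) + ((t ^ 2 * σ : ℝ) : ℂ) * Complex.I := by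
    rw [diagForm]; push_cast; ring
  rw [e]
  simp only [Complex.add_im, Complex.im_mul_ofReal, Complex.im_ofReal_mul, Complex.I_im]
  linear_combination t ^ 2 * h2

lemma integral_inv_sq_mul_cos_add_sin {α β : ℂ} (h : 0 < (α * (starRingEnd ℂ) β).re) :
    ∫ θ in (-Real.pi)..Real.pi,
      (α ^ 2 * (Real.cos θ : ℂ) ^ 2 + β ^ 2 * (Real.sin θ : ℂ) ^ 2)⁻¹ =
        2 * Real.pi / (α * β) := by
  have hα : α ≠ 0 := by rintro rfl; simp at h
  have hβ : β ≠ 0 := by rintro rfl; simp at h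
  have hlt : ‖α - β‖ < ‖α + β‖ := by
    rw [← sq_lt_sq₀ (norm_nonneg _) (norm_nonneg _), ← Complex.normSq_eq_norm_sq,
      ← Complex.normSq_eq_norm_sq, Complex.normSq_sub, Complex.normSq_add]
    linarith
  have hs : α + β ≠ 0 := norm_pos_iff.1 ((norm_nonneg _).trans_lt hlt)
  set q : ℂ := (α - β) / (α + β) with hq
  have hq1 : ‖q‖ < 1 := by
    rw [hq, norm_div, div_lt_one (norm_pos_iff.2 hs)]; exact hlt
  set e : ℝ → ℂ := fun θ => Complex.exp (2 * θ * Complex.I) with he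
  have hen (θ : ℝ) : ‖e θ‖ = 1 := by
    rw [he]; simpa using Complex.norm_exp_ofReal_mul_I (2 * θ)
  have he0 (θ : ℝ) : e θ ≠ 0 := Complex.exp_ne_zero _
  have hei (θ : ℝ) : e (-θ) = (e θ)⁻¹ := by
    simp only [he]; rw [← Complex.exp_neg]; push_cast; ring_nf
  have hslit (θ : ℝ) : 1 + q * e θ ∈ Complex.slitPlane :=
    Complex.mem_slitPlane_of_norm_lt_one (by rw [norm_mul, hen, mul_one]; exact hq1)
  have hde (θ : ℝ) : HasDerivAt e (2 * Complex.I * e θ) θ := by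
    have := ((Complex.ofRealCLM.hasDerivAt (x := θ)).const_mul (2 : ℂ)).mul_const Complex.I |>.cexp
    refine this.congr_deriv ?_
    simp [he]; ring
  have hlog (θ : ℝ) : HasDerivAt (fun θ => Complex.log (1 + q * e θ))
      (2 * Complex.I * (q * e θ) / (1 + q * e θ)) θ := by
    have := (((hde θ).const_mul q).const_add 1).clog_real (hslit θ)
    refine this.congr_deriv ?_
    ring
  have hlog' (θ : ℝ) : HasDerivAt (fun θ => Complex.log (1 + q * e (-θ)))
      (-(2 * Complex.I * (q * e (-θ)) / (1 + q * e (-θ)))) θ := by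
    have := (hlog (-θ)).scomp θ (hasDerivAt_neg θ)
    refine this.congr_deriv ?_
    simp
  have hfac (θ : ℝ) : α ^ 2 * (Real.cos θ : ℂ) ^ 2 + β ^ 2 * (Real.sin θ : ℂ) ^ 2 =
      ((α + β) / 2) ^ 2 * ((1 + q * e θ) * (1 + q * (e θ)⁻¹)) := by
    have h1 : e θ = Complex.exp (θ * Complex.I) ^ 2 := by
      rw [← Complex.exp_nat_mul]; simp only [he]; congr 1; push_cast; ring
    have h2 : Complex.exp (θ * Complex.I) ≠ 0 := Complex.exp_ne_zero _
    rw [h1, Complex.ofReal_cos, Complex.ofReal_sin, Complex.cos, Complex.sin, neg_mul,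
      Complex.exp_neg, hq]
    field_simp
    ring_nf
    simp only [Complex.I_sq]
    ring
  have hD (θ : ℝ) : HasDerivAt (fun θ : ℝ => (2 * Complex.I * α * β)⁻¹ *
      (Complex.log (1 + q * e (-θ)) - Complex.log (1 + q * e θ) + 2 * θ * Complex.I))
      (α ^ 2 * (Real.cos θ : ℂ) ^ 2 + β ^ 2 * (Real.sin θ : ℂ) ^ 2)⁻¹ θ := by
    have h1 := ((Complex.ofRealCLM.hasDerivAt (x := θ)).const_mul (2 : ℂ)).mul_const Complex.I
    have := (((hlog' θ).sub (hlog θ)).add h1).const_mul (2 * Complex.I * α * β)⁻¹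
    refine this.congr_deriv ?_
    have n1 : 1 + q * e θ ≠ 0 := Complex.slitPlane_ne_zero (hslit θ)
    have n2 : 1 + q * (e θ)⁻¹ ≠ 0 := hei θ ▸ Complex.slitPlane_ne_zero (hslit (-θ))
    have hq2 : (1 - q ^ 2) * (α + β) ^ 2 = 4 * (α * β) := by
      rw [hq]; field_simp; ring
    have hsum : 1 - q * e θ / (1 + q * e θ) - q * (e θ)⁻¹ / (1 + q * (e θ)⁻¹) =
        (1 - q ^ 2) / ((1 + q * e θ) * (1 + q * (e θ)⁻¹)) := by
      rw [eq_div_iff (mul_ne_zero n1 n2)]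
      generalize hx : q * e θ = x at *
      generalize hy : q * (e θ)⁻¹ = y at *
      have hxy : x * y = q ^ 2 := by
        rw [← hx, ← hy]
        linear_combination q ^ 2 * mul_inv_cancel₀ (he0 θ)
      rw [← hxy]
      field_simp
      ring
    have hq3 : 1 - q ^ 2 = 4 * (α * β) / (α + β) ^ 2 := by
      rw [eq_div_iff (pow_ne_zero _ hs), hq2]
    rw [hfac, hei]
    calc _ = (2 * Complex.I * α * β)⁻¹ * (2 * Complex.I *
          (1 - q * e θ / (1 + q * e θ) - q * (e θ)⁻¹ / (1 + q * (e θ)⁻¹))) := by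
            simp only [Complex.ofRealCLM_apply, Complex.ofReal_one]; ring
      _ = _ := by
        rw [hsum, hq3]
        generalize 1 + q * e θ = x at *
        generalize 1 + q * (e θ)⁻¹ = y at *
        field_simp
        ring
  have hne (θ : ℝ) : α ^ 2 * (Real.cos θ : ℂ) ^ 2 + β ^ 2 * (Real.sin θ : ℂ) ^ 2 ≠ 0 := by
    rw [hfac, ← hei]
    exact mul_ne_zero (pow_ne_zero _ (div_ne_zero hs two_ne_zero))
      (mul_ne_zero (Complex.slitPlane_ne_zero (hslit θ)) (Complex.slitPlane_ne_zero (hslit (-θ))))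
  rw [intervalIntegral.integral_eq_sub_of_hasDerivAt (fun θ _ => hD θ)]
  · have hpi : e Real.pi = 1 := by
      simp only [he]; exact Complex.exp_two_pi_mul_I
    rw [neg_neg, hei, hpi, inv_one, sub_self]
    field_simp
    push_cast
    ring
  · refine Continuous.intervalIntegrable (Continuous.inv₀ ?_ hne) _ _
    fun_prop

lemma hasDerivAt_radial {g η : ℂ} (hg : g ≠ 0) {r : ℝ} (h : (r : ℂ) ^ 2 * g + η ≠ 0) :
    HasDerivAt (fun r : ℝ => -(2 * g)⁻¹ * ((r : ℂ) ^ 2 * g + η)⁻¹)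
      (r * (((r : ℂ) ^ 2 * g + η) ^ 2)⁻¹) r := by
  have h1 := ((((Complex.ofRealCLM.hasDerivAt (x := r)).pow 2).mul_const g).add_const η).inv h
    |>.const_mul (-(2 * g)⁻¹)
  refine h1.congr_deriv ?_
  simp
  field_simp

lemma tendsto_radial {g : ℂ} (η : ℂ) (hg : g ≠ 0) :
    Tendsto (fun r : ℝ => -(2 * g)⁻¹ * ((r : ℂ) ^ 2 * g + η)⁻¹) atTop (𝓝 0) := by
  rw [← mul_zero (-(2 * g)⁻¹)]
  refine Tendsto.const_mul _ (tendsto_inv₀_cobounded.comp ?_)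
  rw [← tendsto_norm_atTop_iff_cobounded]
  have h1 : Tendsto (fun r : ℝ => r ^ 2 * ‖g‖ - ‖η‖) atTop atTop :=
    tendsto_atTop_add_const_right _ _
      ((tendsto_pow_atTop two_ne_zero).atTop_mul_const (norm_pos_iff.2 hg))
  refine tendsto_atTop_mono (fun r => ?_) h1
  have := norm_sub_le_norm_add ((r : ℂ) ^ 2 * g) η
  simpa using this

lemma integrableOn_mul_inv_one_add_sq :
    IntegrableOn (fun r : ℝ => r * ((1 + r ^ 2) ^ 2)⁻¹) (Ioi 0) := by
  refine Integrable.mono' (integrable_inv_one_add_sq.integrableOn (s := Ioi 0))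
    (Continuous.aestronglyMeasurable ?_) ?_
  · exact continuous_id.mul (Continuous.inv₀ (by fun_prop) fun r => by positivity)
  · filter_upwards [ae_restrict_mem measurableSet_Ioi] with r hr
    have hr0 : 0 < r := hr
    rw [Real.norm_of_nonneg (by positivity), mul_inv_le_iff₀ (by positivity), ← div_eq_inv_mul,
      le_div_iff₀ (by positivity)]
    nlinarith [sq_nonneg (r - 1), mul_pos hr0 hr0, sq_nonneg r]

lemma exists_mul_le_norm_diagForm_add {σ : ℝ} (hσ : |σ| = 1) {a b : ℂ} (ha : 0 < σ * a.im)
    (hb : 0 < σ * b.im) : ∃ c > 0, ∀ x : ℝ × ℝ,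
      c * (1 + (x.1 ^ 2 + x.2 ^ 2)) ≤ ‖diagForm a b x + σ * Complex.I‖ := by
  refine ⟨min 1 (min (σ * a.im) (σ * b.im)), by positivity, fun x => ?_⟩
  refine le_trans ?_ (mul_im_le_norm hσ _)
  have h := mul_im_diagForm_add hσ a b 1 x
  rw [Complex.ofReal_one, one_pow, one_mul, one_pow] at h
  rw [h]
  have h1 := min_le_left 1 (min (σ * a.im) (σ * b.im))
  have h2 := (min_le_right 1 (min (σ * a.im) (σ * b.im))).trans (min_le_left _ _)
  have h3 := (min_le_right 1 (min (σ * a.im) (σ * b.im))).trans (min_le_right _ _)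
  nlinarith [mul_le_mul_of_nonneg_right h2 (sq_nonneg x.1),
    mul_le_mul_of_nonneg_right h3 (sq_nonneg x.2)]

lemma diagForm_add_mem_slitPlane {σ : ℝ} (hσ : |σ| = 1) {a b : ℂ} (ha : 0 < σ * a.im)
    (hb : 0 < σ * b.im) {t : ℝ} (ht : t ≠ 0) (x : ℝ × ℝ) :
    diagForm a b x + (t : ℂ) ^ 2 * (σ * Complex.I) ∈ Complex.slitPlane := by
  refine mem_slitPlane_of_mul_im_pos (σ := σ) ?_
  rw [mul_im_diagForm_add hσ]
  positivity

lemma integrable_inv_diagForm_add_sq {σ : ℝ} (hσ : |σ| = 1) {a b : ℂ} (ha : 0 < σ * a.im)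
    (hb : 0 < σ * b.im) :
    Integrable (fun x : ℝ × ℝ => ((diagForm a b x + σ * Complex.I) ^ 2)⁻¹) := by
  obtain ⟨c, hc, hle⟩ := exists_mul_le_norm_diagForm_add hσ ha hb
  have hne (x : ℝ × ℝ) : diagForm a b x + σ * Complex.I ≠ 0 :=
    norm_pos_iff.1 ((by positivity : (0 : ℝ) < c * (1 + (x.1 ^ 2 + x.2 ^ 2))).trans_le (hle x))
  have hint : Integrable (fun x : ℝ × ℝ => ((1 : ℝ) + ‖x‖ ^ 2) ^ (-(4 : ℝ) / 2)) :=
    integrable_rpow_neg_one_add_norm_sq (by simp; norm_num)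
  refine (hint.const_mul (c ^ 2)⁻¹).mono' (Continuous.aestronglyMeasurable ?_)
    (Eventually.of_forall fun x => ?_)
  · exact Continuous.inv₀ (((contDiff_diagForm a b (n := 0)).continuous.add
      continuous_const).pow 2) fun x => pow_ne_zero _ (hne x)
  · have hx : ‖x‖ ^ 2 ≤ x.1 ^ 2 + x.2 ^ 2 := by
      rw [Prod.norm_def]
      rcases max_choice ‖x.1‖ ‖x.2‖ with h | h <;> rw [h, Real.norm_eq_abs, sq_abs] <;>
        nlinarith [sq_nonneg x.1, sq_nonneg x.2]
    have hr : ((1 : ℝ) + ‖x‖ ^ 2) ^ (-(4 : ℝ) / 2) = ((1 + ‖x‖ ^ 2) ^ 2)⁻¹ := by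
      rw [show (-(4 : ℝ) / 2) = -((2 : ℕ) : ℝ) by norm_num, Real.rpow_neg (by positivity),
        Real.rpow_natCast]
    rw [hr, norm_inv, norm_pow, ← mul_inv, ← mul_pow]
    gcongr
    exact le_trans (by gcongr) (hle x)

lemma integral_inv_diagForm_add_sq {σ : ℝ} (hσ : |σ| = 1) {α β : ℂ}
    (ha : 0 < σ * (α ^ 2).im) (hb : 0 < σ * (β ^ 2).im)
    (hαβ : 0 < (α * (starRingEnd ℂ) β).re) :
    ∫ x : ℝ × ℝ, ((diagForm (α ^ 2) (β ^ 2) x + σ * Complex.I) ^ 2)⁻¹ =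
      Real.pi / (σ * Complex.I * (α * β)) := by
  obtain ⟨c, hc, hle⟩ := exists_mul_le_norm_diagForm_add hσ ha hb
  set g : ℝ → ℂ := fun θ => α ^ 2 * (Real.cos θ : ℂ) ^ 2 + β ^ 2 * (Real.sin θ : ℂ) ^ 2 with hgdef
  set η : ℂ := σ * Complex.I with hη
  have hη0 : η ≠ 0 := by
    have : σ ≠ 0 := by rintro rfl; simp at hσ
    simp [hη, this]
  have hg (θ : ℝ) : g θ ≠ 0 := by
    refine Complex.slitPlane_ne_zero (mem_slitPlane_of_mul_im_pos (σ := σ) ?_)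
    have := mul_im_diagForm_add hσ (α ^ 2) (β ^ 2) 0 (Real.cos θ, Real.sin θ)
    simp only [diagForm, Complex.ofReal_zero, ne_eq, two_ne_zero, not_false_eq_true, zero_pow,
      zero_mul, add_zero] at this
    rw [hgdef, this]
    rcases eq_or_ne (Real.cos θ) 0 with h0 | h0
    · have : Real.sin θ ≠ 0 := fun h1 => by simpa [h0, h1] using Real.sin_sq_add_cos_sq θ
      positivity
    · positivity
  have hpolar (r θ : ℝ) : diagForm (α ^ 2) (β ^ 2) (polarCoord.symm (r, θ)) = (r : ℂ) ^ 2 * g θ := by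
    simp only [diagForm, polarCoord_symm_apply, hgdef]; push_cast; ring
  have hbd (r θ : ℝ) : c * (1 + r ^ 2) ≤ ‖(r : ℂ) ^ 2 * g θ + η‖ := by
    have := hle (polarCoord.symm (r, θ))
    rw [hpolar] at this
    simp only [polarCoord_symm_apply] at this
    convert! this using 3
    linear_combination -r ^ 2 * Real.sin_sq_add_cos_sq θ
  have hne (r θ : ℝ) : (r : ℂ) ^ 2 * g θ + η ≠ 0 :=
    norm_pos_iff.1 ((by positivity : (0 : ℝ) < c * (1 + r ^ 2)).trans_le (hbd r θ))
  have hgc : Continuous g := by fun_prop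
  have hle' (r θ : ℝ) (hr : 0 < r) : ‖(r : ℂ) * (((r : ℂ) ^ 2 * g θ + η) ^ 2)⁻¹‖ ≤
      (c ^ 2)⁻¹ * (r * ((1 + r ^ 2) ^ 2)⁻¹) := by
    rw [norm_mul, Complex.norm_real, Real.norm_of_nonneg hr.le, norm_inv, norm_pow, mul_left_comm,
      ← mul_inv, ← mul_pow]
    gcongr
    exact hbd r θ
  have hcont : Continuous fun p : ℝ × ℝ => (p.1 : ℂ) * (((p.1 : ℂ) ^ 2 * g p.2 + η) ^ 2)⁻¹ := by
    refine Continuous.mul (by fun_prop) (Continuous.inv₀ ?_ fun p => pow_ne_zero _ (hne _ _))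
    have := hgc.comp (continuous_snd (X := ℝ) (Y := ℝ))
    fun_prop
  have hint : IntegrableOn (fun p : ℝ × ℝ => (p.1 : ℂ) * (((p.1 : ℂ) ^ 2 * g p.2 + η) ^ 2)⁻¹)
      (Ioi 0 ×ˢ Ioo (-Real.pi) Real.pi) := by
    have hb : IntegrableOn (fun p : ℝ × ℝ => (c ^ 2)⁻¹ * (p.1 * ((1 + p.1 ^ 2) ^ 2)⁻¹))
        (Ioi 0 ×ˢ Ioo (-Real.pi) Real.pi) := by
      rw [IntegrableOn, Measure.volume_eq_prod, ← Measure.prod_restrict]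
      exact (integrableOn_mul_inv_one_add_sq.comp_fst _).const_mul _
    refine hb.mono' hcont.aestronglyMeasurable ?_
    filter_upwards [ae_restrict_mem (measurableSet_Ioi.prod measurableSet_Ioo)] with p hp
    exact hle' _ _ hp.1
  have hrad (θ : ℝ) : ∫ r in Ioi (0 : ℝ), (r : ℂ) * (((r : ℂ) ^ 2 * g θ + η) ^ 2)⁻¹ =
      (2 * η)⁻¹ * (g θ)⁻¹ := by
    rw [integral_Ioi_of_hasDerivAt_of_tendsto' (fun r _ => hasDerivAt_radial (hg θ) (hne r θ)) ?_
      (tendsto_radial η (hg θ))]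
    · simp only [Complex.ofReal_zero, ne_eq, two_ne_zero, not_false_eq_true, zero_pow,
        zero_mul, zero_add]
      have := hg θ
      field_simp
      ring
    · refine (integrableOn_mul_inv_one_add_sq.const_mul (c ^ 2)⁻¹).mono'
        (hcont.comp (by fun_prop : Continuous fun r : ℝ => (r, θ))).aestronglyMeasurable ?_
      filter_upwards [ae_restrict_mem measurableSet_Ioi] with r hr
      exact hle' _ _ hr
  calc _ = ∫ p in Ioi (0 : ℝ) ×ˢ Ioo (-Real.pi) Real.pi,
        (p.1 : ℂ) * (((p.1 : ℂ) ^ 2 * g p.2 + η) ^ 2)⁻¹ := by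
        rw [← integral_comp_polarCoord_symm, polarCoord_target]
        refine integral_congr_ae (Eventually.of_forall fun p => ?_)
        simp only [Complex.real_smul]
        rw [← hpolar]
    _ = ∫ θ in Ioo (-Real.pi) Real.pi, ∫ r in Ioi (0 : ℝ),
        (r : ℂ) * (((r : ℂ) ^ 2 * g θ + η) ^ 2)⁻¹ := by
        rw [IntegrableOn, Measure.volume_eq_prod, ← Measure.prod_restrict] at hint
        rw [Measure.volume_eq_prod, ← Measure.prod_restrict, integral_prod_symm _ hint]
    _ = (2 * η)⁻¹ * (2 * Real.pi / (α * β)) := by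
        simp_rw [hrad]
        rw [integral_const_mul, ← integral_Ioc_eq_integral_Ioo,
          ← intervalIntegral.integral_of_le (by linarith [Real.pi_pos]),
          integral_inv_sq_mul_cos_add_sin hαβ]
    _ = _ := by field_simp

lemma deriv_deriv_fst {f : ℝ × ℝ → ℂ} (hf : ContDiff ℝ 2 f) (x : ℝ × ℝ) :
    deriv (fun t => deriv (fun s => f (s, x.2)) t) x.1 =
      fderiv ℝ (fun y => fderiv ℝ f y (1, 0)) x (1, 0) := by
  have key {g : ℝ × ℝ → ℂ} (hg : Differentiable ℝ g) (t y : ℝ) :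
      deriv (fun s => g (s, y)) t = fderiv ℝ g (t, y) (1, 0) :=
    ((hg (t, y)).hasFDerivAt.comp_hasDerivAt t
      ((hasDerivAt_id t).prodMk (hasDerivAt_const t y))).deriv
  have h1 : ContDiff ℝ 1 (fun y => fderiv ℝ f y (1, 0)) :=
    (hf.fderiv_right (m := 1) (by norm_num)).clm_apply contDiff_const
  simp_rw [key (hf.differentiable (by norm_num))]
  exact key (h1.differentiable (by norm_num)) x.1 x.2

lemma deriv_deriv_snd {f : ℝ × ℝ → ℂ} (hf : ContDiff ℝ 2 f) (x : ℝ × ℝ) :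
    deriv (fun t => deriv (fun s => f (x.1, s)) t) x.2 =
      fderiv ℝ (fun y => fderiv ℝ f y (0, 1)) x (0, 1) := by
  have key {g : ℝ × ℝ → ℂ} (hg : Differentiable ℝ g) (t y : ℝ) :
      deriv (fun s => g (y, s)) t = fderiv ℝ g (y, t) (0, 1) :=
    ((hg (y, t)).hasFDerivAt.comp_hasDerivAt t
      ((hasDerivAt_const t y).prodMk (hasDerivAt_id t))).deriv
  have h1 : ContDiff ℝ 1 (fun y => fderiv ℝ f y (0, 1)) :=
    (hf.fderiv_right (m := 1) (by norm_num)).clm_apply contDiff_const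
  simp_rw [key (hf.differentiable (by norm_num))]
  exact key (h1.differentiable (by norm_num)) x.2 x.1

lemma continuous_fderiv_fderiv {f : ℝ × ℝ → ℂ} (hf : ContDiff ℝ 2 f) (v : ℝ × ℝ) :
    Continuous (fun x => fderiv ℝ (fun y => fderiv ℝ f y v) x v) := by
  have h1 : ContDiff ℝ 1 (fun y => fderiv ℝ f y v) :=
    (hf.fderiv_right (m := 1) (by norm_num)).clm_apply contDiff_const
  exact (h1.continuous_fderiv (by norm_num)).clm_apply continuous_const

lemma hasCompactSupport_fderiv_fderiv {f : ℝ × ℝ → ℂ} (hc : HasCompactSupport f) (v : ℝ × ℝ) :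
    HasCompactSupport (fun x => fderiv ℝ (fun y => fderiv ℝ f y v) x v) :=
  (hc.fderiv_apply (𝕜 := ℝ) v).fderiv_apply (𝕜 := ℝ) v

lemma integral_mul_fderiv_fderiv {u φ : ℝ × ℝ → ℂ} (hu : ContDiff ℝ 2 u) (hφ : ContDiff ℝ 2 φ)
    (hc : HasCompactSupport φ) (v : ℝ × ℝ) :
    ∫ x, u x * fderiv ℝ (fun y => fderiv ℝ φ y v) x v =
      ∫ x, fderiv ℝ (fun y => fderiv ℝ u y v) x v * φ x := by
  have hu1 : ContDiff ℝ 1 (fun y => fderiv ℝ u y v) :=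
    (hu.fderiv_right (m := 1) (by norm_num)).clm_apply contDiff_const
  have hφ1 : ContDiff ℝ 1 (fun y => fderiv ℝ φ y v) :=
    (hφ.fderiv_right (m := 1) (by norm_num)).clm_apply contDiff_const
  have hc1 : HasCompactSupport (fun y => fderiv ℝ φ y v) := hc.fderiv_apply (𝕜 := ℝ) v
  have i00 : Integrable (fun x => u x * φ x) :=
    (hu.continuous.mul hφ.continuous).integrable_of_hasCompactSupport hc.mul_left
  have i10 : Integrable (fun x => fderiv ℝ u x v * φ x) :=
    (hu1.continuous.mul hφ.continuous).integrable_of_hasCompactSupport hc.mul_left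
  have i01 : Integrable (fun x => u x * fderiv ℝ φ x v) :=
    (hu.continuous.mul hφ1.continuous).integrable_of_hasCompactSupport hc1.mul_left
  have i11 : Integrable (fun x => fderiv ℝ u x v * fderiv ℝ φ x v) :=
    (hu1.continuous.mul hφ1.continuous).integrable_of_hasCompactSupport hc1.mul_left
  have i02 : Integrable (fun x => u x * fderiv ℝ (fun y => fderiv ℝ φ y v) x v) :=
    (hu.continuous.mul (continuous_fderiv_fderiv hφ v)).integrable_of_hasCompactSupport
      (hasCompactSupport_fderiv_fderiv hc v).mul_left
  have i20 : Integrable (fun x => fderiv ℝ (fun y => fderiv ℝ u y v) x v * φ x) :=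
    ((continuous_fderiv_fderiv hu v).mul hφ.continuous).integrable_of_hasCompactSupport hc.mul_left
  rw [integral_mul_fderiv_eq_neg_fderiv_mul_of_integrable i11 i02 i01
      (fun x _ => hu.differentiable (by norm_num) x)
      (fun x _ => hφ1.differentiable (by norm_num) x),
    integral_mul_fderiv_eq_neg_fderiv_mul_of_integrable i20 i11 i10
      (fun x _ => hu1.differentiable (by norm_num) x)
      (fun x _ => hφ.differentiable (by norm_num) x), neg_neg]

lemma deriv_deriv_log_mul_sq_add {a k : ℂ} (h : ∀ s : ℝ, a * (s : ℂ) ^ 2 + k ∈ Complex.slitPlane)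
    (t : ℝ) :
    deriv (fun t => deriv (fun s : ℝ => Complex.log (a * (s : ℂ) ^ 2 + k)) t) t =
      2 * a / (a * (t : ℂ) ^ 2 + k) - (2 * a * t) ^ 2 / (a * (t : ℂ) ^ 2 + k) ^ 2 := by
  have h0 (s : ℝ) : HasDerivAt (fun s : ℝ => a * (s : ℂ) ^ 2 + k) (2 * a * s) s := by
    refine ((((Complex.ofRealCLM.hasDerivAt (x := s)).pow 2).const_mul a).add_const k).congr_deriv ?_
    simp; ring
  have h1 (s : ℝ) : deriv (fun s : ℝ => Complex.log (a * (s : ℂ) ^ 2 + k)) s =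
      2 * a * s / (a * (s : ℂ) ^ 2 + k) := ((h0 s).clog_real (h s)).deriv
  have hne := Complex.slitPlane_ne_zero (h t)
  simp_rw [h1]
  have h2 := ((Complex.ofRealCLM.hasDerivAt (x := t)).const_mul (2 * a)).div (h0 t) hne
  refine Eq.trans h2.deriv ?_
  simp only [Complex.ofRealCLM_apply, Complex.ofReal_one]
  field_simp

lemma contDiff_log_diagForm_add {a b k : ℂ} {n : WithTop ℕ∞}
    (h : ∀ x, diagForm a b x + k ∈ Complex.slitPlane) :
    ContDiff ℝ n (fun z => Complex.log (diagForm a b z + k)) :=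
  contDiff_iff_contDiffAt.2 fun x => ((Complex.contDiffAt_log (h x)).restrict_scalars ℝ).comp x
    ((contDiff_diagForm a b).add contDiff_const).contDiffAt

lemma fderiv_fderiv_log_diagForm {a b k : ℂ} (ha : a ≠ 0) (hb : b ≠ 0)
    (h : ∀ x, diagForm a b x + k ∈ Complex.slitPlane) (x : ℝ × ℝ) :
    a⁻¹ * fderiv ℝ (fun y => fderiv ℝ (fun z => Complex.log (diagForm a b z + k)) y (1, 0)) x (1, 0) +
      b⁻¹ * fderiv ℝ (fun y => fderiv ℝ (fun z => Complex.log (diagForm a b z + k)) y (0, 1)) x (0, 1)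
      = 4 * k * ((diagForm a b x + k) ^ 2)⁻¹ := by
  have hu : ContDiff ℝ 2 (fun z => Complex.log (diagForm a b z + k)) :=
    contDiff_log_diagForm_add h
  have e1 (s : ℝ) : diagForm a b (s, x.2) + k = a * (s : ℂ) ^ 2 + (b * (x.2 : ℂ) ^ 2 + k) := by
    simp only [diagForm]; ring
  have e2 (s : ℝ) : diagForm a b (x.1, s) + k = b * (s : ℂ) ^ 2 + (a * (x.1 : ℂ) ^ 2 + k) := by
    simp only [diagForm]; ring
  rw [← deriv_deriv_fst hu, ← deriv_deriv_snd hu]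
  simp_rw [e1, e2]
  rw [deriv_deriv_log_mul_sq_add (fun s => e1 s ▸ h _),
    deriv_deriv_log_mul_sq_add (fun s => e2 s ▸ h _), ← e1, ← e2]
  have hne := Complex.slitPlane_ne_zero (h x)
  have hq : diagForm a b x = a * (x.1 : ℂ) ^ 2 + b * (x.2 : ℂ) ^ 2 := rfl
  simp only [Prod.mk.eta]
  field_simp
  rw [hq]
  ring

/-- The operator `a⁻¹ ∂₁² + b⁻¹ ∂₂²` on functions on the plane. -/
noncomputable def diagOp (a b : ℂ) (φ : ℝ × ℝ → ℂ) (x : ℝ × ℝ) : ℂ :=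
  a⁻¹ * fderiv ℝ (fun y => fderiv ℝ φ y (1, 0)) x (1, 0) +
    b⁻¹ * fderiv ℝ (fun y => fderiv ℝ φ y (0, 1)) x (0, 1)

lemma continuous_diagOp (a b : ℂ) {φ : ℝ × ℝ → ℂ} (hφ : ContDiff ℝ 2 φ) :
    Continuous (diagOp a b φ) :=
  (continuous_const.mul (continuous_fderiv_fderiv hφ _)).add
    (continuous_const.mul (continuous_fderiv_fderiv hφ _))

lemma hasCompactSupport_diagOp (a b : ℂ) {φ : ℝ × ℝ → ℂ} (hc : HasCompactSupport φ) :
    HasCompactSupport (diagOp a b φ) :=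
  (hasCompactSupport_fderiv_fderiv hc _).mul_left.add
    (hasCompactSupport_fderiv_fderiv hc _).mul_left

lemma integral_mul_diagOp (a b : ℂ) {u φ : ℝ × ℝ → ℂ} (hu : ContDiff ℝ 2 u) (hφ : ContDiff ℝ 2 φ)
    (hc : HasCompactSupport φ) :
    ∫ x, u x * diagOp a b φ x = ∫ x, diagOp a b u x * φ x := by
  have hl (v : ℝ × ℝ) : Integrable (fun x => u x * fderiv ℝ (fun y => fderiv ℝ φ y v) x v) :=
    (hu.continuous.mul (continuous_fderiv_fderiv hφ v)).integrable_of_hasCompactSupport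
      (hasCompactSupport_fderiv_fderiv hc v).mul_left
  have hr (v : ℝ × ℝ) : Integrable (fun x => fderiv ℝ (fun y => fderiv ℝ u y v) x v * φ x) :=
    ((continuous_fderiv_fderiv hu v).mul hφ.continuous).integrable_of_hasCompactSupport hc.mul_left
  simp only [diagOp, mul_add, add_mul, mul_assoc, mul_left_comm (u _)]
  rw [integral_add ((hl _).const_mul _) ((hl _).const_mul _),
    integral_add ((hr _).const_mul _) ((hr _).const_mul _)]
  simp only [integral_const_mul, integral_mul_fderiv_fderiv hu hφ hc]

lemma integral_log_diagForm_add_mul_diagOp {σ : ℝ} (hσ : |σ| = 1) {a b : ℂ} (ha : 0 < σ * a.im)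
    (hb : 0 < σ * b.im) {φ : ℝ × ℝ → ℂ} (hφ : ContDiff ℝ 2 φ) (hc : HasCompactSupport φ)
    {t : ℝ} (ht : t ≠ 0) :
    ∫ x, Complex.log (diagForm a b x + (t : ℂ) ^ 2 * (σ * Complex.I)) * diagOp a b φ x =
      4 * (σ * Complex.I) *
        ∫ x, ((diagForm a b x + σ * Complex.I) ^ 2)⁻¹ * φ (t • x) := by
  have hsl := diagForm_add_mem_slitPlane hσ ha hb ht
  have ha0 : a ≠ 0 := by rintro rfl; simp at ha
  have hb0 : b ≠ 0 := by rintro rfl; simp at hb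
  have htc : (t : ℂ) ≠ 0 := Complex.ofReal_ne_zero.2 ht
  have hu : ContDiff ℝ 2 (fun z => Complex.log (diagForm a b z + (t : ℂ) ^ 2 * (σ * Complex.I))) :=
    contDiff_log_diagForm_add hsl
  rw [integral_mul_diagOp a b hu hφ hc]
  simp only [diagOp, fderiv_fderiv_log_diagForm ha0 hb0 hsl]
  have hs := Measure.integral_comp_smul (volume : Measure (ℝ × ℝ)) (fun x =>
    ((diagForm a b x + (t : ℂ) ^ 2 * (σ * Complex.I)) ^ 2)⁻¹ * φ x) t
  have he (x : ℝ × ℝ) : ((diagForm a b (t • x) + (t : ℂ) ^ 2 * (σ * Complex.I)) ^ 2)⁻¹ =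
      ((t : ℂ) ^ 4)⁻¹ * ((diagForm a b x + σ * Complex.I) ^ 2)⁻¹ := by
    rw [← mul_inv]
    congr 1
    simp only [diagForm, Prod.smul_fst, Prod.smul_snd, smul_eq_mul]
    push_cast
    ring
  simp only [he, mul_assoc] at hs ⊢
  rw [integral_const_mul, Module.finrank_prod, Module.finrank_self, one_add_one_eq_two,
    abs_of_nonneg (by positivity),
    Complex.real_smul] at hs
  simp only [integral_const_mul]
  push_cast at hs
  generalize (∫ x, ((diagForm a b x + σ * Complex.I) ^ 2)⁻¹ * φ (t • x)) = X at *
  generalize (∫ x, ((diagForm a b x + (t : ℂ) ^ 2 * (σ * Complex.I)) ^ 2)⁻¹ * φ x) = Y at *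
  field_simp at hs
  rw [hs]
  ring

lemma tendsto_integral_mul_comp_smul {w φ : ℝ × ℝ → ℂ} (hw : Integrable w) (hφ : Continuous φ)
    (hc : HasCompactSupport φ) :
    Tendsto (fun t : ℝ => ∫ x, w x * φ (t • x)) (𝓝 0) (𝓝 ((∫ x, w x) * φ 0)) := by
  obtain ⟨C, hC⟩ := hφ.bounded_above_of_compact_support hc
  rw [← integral_mul_const]
  refine tendsto_integral_filter_of_dominated_convergence (fun x => ‖w x‖ * C)
    (Eventually.of_forall fun t => ?_) (Eventually.of_forall fun t => Eventually.of_forall fun x => ?_)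
    (hw.norm.mul_const _) (Eventually.of_forall fun x => ?_)
  · exact hw.aestronglyMeasurable.mul (hφ.comp (continuous_const_smul t)).aestronglyMeasurable
  · rw [norm_mul]; gcongr; exact hC _
  · have : Continuous fun t : ℝ => w x * φ (t • x) := by fun_prop
    simpa using this.tendsto 0

lemma locallyIntegrable_two_mul_abs_log_fst_add (C : ℝ) :
    LocallyIntegrable (fun x : ℝ × ℝ => 2 * |Real.log x.1| + C) := by
  rw [locallyIntegrable_iff]
  intro K hK
  obtain ⟨R, hR⟩ := hK.isBounded.subset_closedBall 0
  refine IntegrableOn.mono_set (t := Icc (-R) R ×ˢ Icc (-R) R) ?_ fun x hx => ?_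
  · rw [IntegrableOn, Measure.volume_eq_prod, ← Measure.prod_restrict]
    refine Integrable.comp_fst (f := fun s => 2 * |Real.log s| + C) ?_ _
    have h : IntegrableOn Real.log (Icc (-R) R) := by
      rcases le_or_gt (-R) R with h | h
      · exact (intervalIntegrable_iff_integrableOn_Icc_of_le h).1
          intervalIntegral.intervalIntegrable_log'
      · simp [Icc_eq_empty h.not_ge]
    exact (h.norm.const_mul 2).add (integrable_const C)
  · have := hR hx
    rw [mem_closedBall_zero_iff, Prod.norm_def, max_le_iff] at this
    exact ⟨abs_le.1 this.1, abs_le.1 this.2⟩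

lemma ae_fst_ne_zero : ∀ᵐ x : ℝ × ℝ, x.1 ≠ 0 :=
  Measure.quasiMeasurePreserving_fst.ae (Measure.ae_ne volume (0 : ℝ))

lemma norm_log_le_of_le {z : ℂ} {m M : ℝ} (hm : 0 < m) (h1 : m ≤ ‖z‖) (h2 : ‖z‖ ≤ M) :
    ‖Complex.log z‖ ≤ |Real.log m| + |Real.log M| + Real.pi := by
  have h3 : |Real.log ‖z‖| ≤ |Real.log m| + |Real.log M| := by
    refine (abs_le_max_abs_abs (Real.log_le_log hm h1)
      (Real.log_le_log (hm.trans_le h1) h2)).trans (max_le ?_ ?_)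
    · linarith [abs_nonneg (Real.log M)]
    · linarith [abs_nonneg (Real.log m)]
  calc _ ≤ |(Complex.log z).re| + |(Complex.log z).im| := Complex.norm_le_abs_re_add_abs_im _
    _ ≤ _ := by
      rw [Complex.log_re, Complex.log_im]
      exact add_le_add h3 (Complex.abs_arg_le_pi z)

lemma exists_norm_log_diagForm_le {σ : ℝ} (hσ : |σ| = 1) {a b : ℂ} (ha : 0 < σ * a.im)
    (hb : 0 < σ * b.im) {K : Set (ℝ × ℝ)} (hK : IsCompact K) :
    ∃ C : ℝ, ∀ x ∈ K, x.1 ≠ 0 → ∀ t ∈ Icc (-1 : ℝ) 1,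
      ‖Complex.log (diagForm a b x + (t : ℂ) ^ 2 * (σ * Complex.I))‖ ≤
        2 * |Real.log x.1| + C := by
  have hq := (contDiff_diagForm a b (n := 0)).continuous
  obtain ⟨M, hM⟩ := (hK.prod (isCompact_Icc (a := (-1 : ℝ)) (b := 1))).exists_bound_of_continuousOn
    (f := fun p : (ℝ × ℝ) × ℝ => diagForm a b p.1 + (p.2 : ℂ) ^ 2 * (σ * Complex.I))
    (by fun_prop)
  refine ⟨|Real.log (σ * a.im)| + |Real.log M| + Real.pi, fun x hx hx1 t ht => ?_⟩
  have hlow : σ * a.im * x.1 ^ 2 ≤ ‖diagForm a b x + (t : ℂ) ^ 2 * (σ * Complex.I)‖ := by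
    refine le_trans ?_ (mul_im_le_norm hσ _)
    rw [mul_im_diagForm_add hσ]
    nlinarith [mul_nonneg hb.le (sq_nonneg x.2), sq_nonneg t]
  have h := norm_log_le_of_le (by positivity) hlow (hM (x, t) ⟨hx, ht⟩)
  have h3 : |Real.log (σ * a.im * x.1 ^ 2)| ≤ |Real.log (σ * a.im)| + 2 * |Real.log x.1| := by
    rw [Real.log_mul ha.ne' (by positivity), Real.log_pow]
    refine (abs_add_le _ _).trans (by rw [abs_mul]; simp)
  linarith

lemma locallyIntegrable_log_diagForm {σ : ℝ} (hσ : |σ| = 1) {a b : ℂ} (ha : 0 < σ * a.im)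
    (hb : 0 < σ * b.im) : LocallyIntegrable (fun x => Complex.log (diagForm a b x)) := by
  rw [locallyIntegrable_iff]
  intro K hK
  obtain ⟨C, hC⟩ := exists_norm_log_diagForm_le hσ ha hb hK
  have hint := locallyIntegrable_two_mul_abs_log_fst_add C
  refine (hint.integrableOn_isCompact hK).mono'
    (Complex.measurable_log.comp
      (contDiff_diagForm a b (n := 0)).continuous.measurable).aestronglyMeasurable ?_
  filter_upwards [ae_restrict_mem hK.measurableSet, ae_restrict_of_ae ae_fst_ne_zero] with x hx hx1
  simpa using hC x hx hx1 0 (by simp)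

lemma tendsto_integral_log_diagForm_add_mul {σ : ℝ} (hσ : |σ| = 1) {a b : ℂ} (ha : 0 < σ * a.im)
    (hb : 0 < σ * b.im) {ψ : ℝ × ℝ → ℂ} (hψ : Continuous ψ) (hc : HasCompactSupport ψ) :
    Tendsto (fun t : ℝ =>
      ∫ x, Complex.log (diagForm a b x + (t : ℂ) ^ 2 * (σ * Complex.I)) * ψ x) (𝓝 0)
      (𝓝 (∫ x, Complex.log (diagForm a b x) * ψ x)) := by
  obtain ⟨C, hC⟩ := exists_norm_log_diagForm_le hσ ha hb hc.isCompact
  have hq := (contDiff_diagForm a b (n := 0)).continuous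
  have hint := locallyIntegrable_two_mul_abs_log_fst_add C
  refine tendsto_integral_filter_of_dominated_convergence
    (fun x => (2 * |Real.log x.1| + C) * ‖ψ x‖) (Eventually.of_forall fun t => ?_) ?_
    (hint.integrable_smul_right_of_hasCompactSupport hψ.norm hc.norm) ?_
  · refine AEStronglyMeasurable.mul ?_ hψ.aestronglyMeasurable
    exact (Complex.measurable_log.comp (hq.add continuous_const).measurable).aestronglyMeasurable
  · filter_upwards [Icc_mem_nhds (show (-1 : ℝ) < 0 by norm_num) one_pos] with t ht
    filter_upwards [ae_fst_ne_zero] with x hx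
    rw [norm_mul]
    by_cases h : x ∈ tsupport ψ
    · gcongr
      exact hC x h hx t ht
    · simp [image_eq_zero_of_notMem_tsupport h]
  · filter_upwards [ae_fst_ne_zero] with x hx
    have hsl : diagForm a b x ∈ Complex.slitPlane := by
      refine mem_slitPlane_of_mul_im_pos (σ := σ) ?_
      have := mul_im_diagForm_add hσ a b 0 x
      simp only [Complex.ofReal_zero, ne_eq, two_ne_zero, not_false_eq_true, zero_pow,
        zero_mul, add_zero] at this
      rw [this]
      positivity
    have h0 : Tendsto (fun t : ℝ => diagForm a b x + (t : ℂ) ^ 2 * (σ * Complex.I)) (𝓝 0)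
        (𝓝 (diagForm a b x)) := by
      have : Continuous fun t : ℝ => diagForm a b x + (t : ℂ) ^ 2 * (σ * Complex.I) := by fun_prop
      simpa using this.tendsto 0
    exact (h0.clog hsl).mul_const _

/-- `αβ / (4π) · log (α² x₁² + β² x₂²)` is a fundamental solution of `α⁻² ∂₁² + β⁻² ∂₂²`. -/
theorem integral_log_diagForm_mul_diagOp {σ : ℝ} (hσ : |σ| = 1) {α β : ℂ}
    (ha : 0 < σ * (α ^ 2).im) (hb : 0 < σ * (β ^ 2).im)
    (hαβ : 0 < (α * (starRingEnd ℂ) β).re) {φ : ℝ × ℝ → ℂ} (hφ : ContDiff ℝ 2 φ)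
    (hc : HasCompactSupport φ) :
    ∫ x, Complex.log (diagForm (α ^ 2) (β ^ 2) x) * diagOp (α ^ 2) (β ^ 2) φ x =
      4 * Real.pi / (α * β) * φ 0 := by
  have hσ0 : (σ : ℂ) ≠ 0 := by
    rw [Complex.ofReal_ne_zero]
    rintro rfl
    simp at hσ
  have h1 := (tendsto_integral_log_diagForm_add_mul hσ ha hb
    (continuous_diagOp (α ^ 2) (β ^ 2) hφ) (hasCompactSupport_diagOp _ _ hc)).mono_left
      (nhdsWithin_le_nhds (s := {0}ᶜ))
  have h2 := ((tendsto_integral_mul_comp_smul (integrable_inv_diagForm_add_sq hσ ha hb)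
    hφ.continuous hc).const_mul (4 * ((σ : ℂ) * Complex.I))).mono_left
      (nhdsWithin_le_nhds (s := {0}ᶜ))
  have h3 := h2.congr' (f₂ := _) (by
    filter_upwards [self_mem_nhdsWithin] with t ht
    exact (integral_log_diagForm_add_mul_diagOp hσ ha hb hφ hc ht).symm)
  rw [tendsto_nhds_unique h1 h3, integral_inv_diagForm_add_sq hσ ha hb hαβ]
  field_simp

lemma mul_im_sq {σ : ℝ} (z : ℂ) : σ * (z ^ 2).im = 2 * (z.re * (σ * z.im)) := by
  rw [sq, Complex.mul_im]; ring

lemma re_mul_conj_pos {σ : ℝ} (hσ : |σ| = 1) {α β : ℂ} (hα : 0 < α.re) (hβ : 0 < β.re)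
    (ha : 0 < σ * (α ^ 2).im) (hb : 0 < σ * (β ^ 2).im) : 0 < (α * (starRingEnd ℂ) β).re := by
  rw [mul_im_sq] at ha hb
  have h1 : 0 < σ * α.im := pos_of_mul_pos_right (by linarith) hα.le
  have h2 : 0 < σ * β.im := pos_of_mul_pos_right (by linarith) hβ.le
  have h3 : σ * σ = 1 := by rw [← abs_mul_abs_self, hσ, one_mul]
  have h4 : α.im * β.im = (σ * α.im) * (σ * β.im) := by linear_combination -α.im * β.im * h3
  rw [Complex.mul_re, Complex.conj_re, Complex.conj_im, mul_neg, sub_neg_eq_add, h4]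
  positivity

theorem stmt_13 (ω : ℂ) (hre : ω.re ∈ Ioo (0 : ℝ) 1) (him : ω.im ≠ 0) :
    LocallyIntegrable
      (fun x : ℝ × ℝ =>
        Complex.log (-(x.1 : ℂ) ^ 2 / ω ^ 2 + (x.2 : ℂ) ^ 2 / (1 - ω ^ 2))) volume ∧
    ∀ φ : ℝ × ℝ → ℂ, ContDiff ℝ (⊤ : ℕ∞) φ → HasCompactSupport φ →
      (Complex.I * (Real.sign ω.im : ℂ) /
          (4 * (Real.pi : ℂ) * ω * (1 - ω ^ 2) ^ ((1 : ℂ) / 2))) *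
        (∫ x : ℝ × ℝ,
          Complex.log (-(x.1 : ℂ) ^ 2 / ω ^ 2 + (x.2 : ℂ) ^ 2 / (1 - ω ^ 2)) *
            ((1 - ω ^ 2) * deriv (fun t => deriv (fun s => φ (x.1, s)) t) x.2 -
              ω ^ 2 * deriv (fun t => deriv (fun s => φ (s, x.2)) t) x.1))
        = φ (0, 0) := by
  set σ : ℝ := Real.sign ω.im with hσdef
  have hσim : 0 < σ * ω.im := Real.sign_mul_pos_of_ne_zero _ him
  have hσ : |σ| = 1 := by
    rcases Real.sign_apply_eq_of_ne_zero _ him with h | h <;> simp [hσdef, h]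
  have hσ2 : (σ : ℂ) ^ 2 = 1 := by
    rw [← Complex.ofReal_pow, ← sq_abs, hσ]; simp
  have hω : ω ≠ 0 := by rintro rfl; simp at him
  have him2 : 0 < σ * (ω ^ 2).im := by
    rw [mul_im_sq]; have := hre.1; positivity
  set s : ℂ := (1 - ω ^ 2) ^ ((1 : ℂ) / 2) with hs
  have hs2 : s ^ 2 = 1 - ω ^ 2 := by
    rw [hs, one_div]
    exact Complex.cpow_nat_inv_pow _ two_ne_zero
  have hs0 : s ≠ 0 := by
    intro h0
    have : (ω ^ 2).im = 0 := by
      have : ω ^ 2 = 1 := by linear_combination hs2 - s * h0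
      simp [this]
    simp [this] at him2
  have hsre : 0 < s.re := by
    rw [hs, one_div, Complex.cpow_inv_two_re]
    refine Real.sqrt_pos.2 (half_pos ?_)
    have him1 : (1 - ω ^ 2).im ≠ 0 := by
      intro h0
      rw [Complex.sub_im, Complex.one_im, zero_sub, neg_eq_zero] at h0
      simp [h0] at him2
    have h1 := Complex.abs_re_lt_norm.2 him1
    linarith [neg_abs_le (1 - ω ^ 2).re]
  set α : ℂ := Complex.I * σ / ω with hα
  set β : ℂ := s⁻¹ with hβ
  have hα2 : α ^ 2 = -(ω ^ 2)⁻¹ := by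
    rw [hα, div_pow, mul_pow, hσ2, Complex.I_sq]; ring
  have hβ2 : β ^ 2 = (1 - ω ^ 2)⁻¹ := by rw [hβ, inv_pow, hs2]
  have hinv : ∀ z : ℂ, 0 < σ * (-z).im → 0 < σ * (z⁻¹).im := by
    intro z hz
    have hz0 : z ≠ 0 := by rintro rfl; simp at hz
    rw [Complex.inv_im, ← mul_div_assoc]
    exact div_pos hz (Complex.normSq_pos.2 hz0)
  have ha : 0 < σ * (α ^ 2).im := by
    rw [hα2, ← inv_neg]; exact hinv _ (by rwa [neg_neg])
  have hb : 0 < σ * (β ^ 2).im := by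
    rw [hβ2]; exact hinv _ (by simpa using him2)
  have hαre : 0 < α.re := by
    have : α.re = σ * ω.im / Complex.normSq ω := by
      rw [hα, Complex.div_re]; simp
    rw [this]
    exact div_pos hσim (Complex.normSq_pos.2 hω)
  have hβre : 0 < β.re := by
    rw [hβ, Complex.inv_re]
    exact div_pos hsre (Complex.normSq_pos.2 hs0)
  have hform (x : ℝ × ℝ) : -(x.1 : ℂ) ^ 2 / ω ^ 2 + (x.2 : ℂ) ^ 2 / (1 - ω ^ 2) =
      diagForm (α ^ 2) (β ^ 2) x := by
    rw [diagForm, hα2, hβ2]; ring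
  simp only [hform]
  refine ⟨locallyIntegrable_log_diagForm hσ ha hb, fun φ hφ hc => ?_⟩
  have hφ2 : ContDiff ℝ 2 φ := hφ.of_le (WithTop.coe_le_coe.2 le_top)
  have hop (x : ℝ × ℝ) : (1 - ω ^ 2) * deriv (fun t => deriv (fun s => φ (x.1, s)) t) x.2 -
      ω ^ 2 * deriv (fun t => deriv (fun s => φ (s, x.2)) t) x.1 =
      diagOp (α ^ 2) (β ^ 2) φ x := by
    rw [diagOp, deriv_deriv_fst hφ2, deriv_deriv_snd hφ2, hα2, hβ2, inv_neg, inv_inv, inv_inv]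
    ring
  simp only [hop]
  rw [integral_log_diagForm_mul_diagOp hσ ha hb (re_mul_conj_pos hσ hαre hβre ha hb) hφ2 hc,
    ← Prod.mk_zero_zero, ← mul_assoc]
  have hαβ : α * β ≠ 0 := by
    refine mul_ne_zero ?_ ?_ <;> intro h0
    · simp [h0] at hαre
    · simp [h0] at hβre
  have hcoef : Complex.I * σ / (4 * (Real.pi : ℂ) * ω * s) = α * β / (4 * Real.pi) := by
    rw [hα, hβ]; field_simp
  have hpi : (Real.pi : ℂ) ≠ 0 := Complex.ofReal_ne_zero.2 Real.pi_ne_zero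
  rw [hcoef, div_mul_div_cancel₀ (by simp), div_self hαβ, one_mul]
end

section
/- Let λ ∈ (0,1). Define A(x,λ) = −x₁²/λ² + x₂²/(1−λ²) (a real number) for x = (x₁,x₂) ∈ ℝ², and c_λ = i/(4πλ√(1−λ²)). Then for every C^∞ compactly supported φ : ℝ² → ℂ one has c_λ · ∫_{ℝ²} (log|A(x,λ)| + iπ·𝟙_{A(x,λ)<0}) · ((1−λ²)∂²φ/∂x₂²(x) − λ²∂²φ/∂x₁²(x)) dx = φ(0); that is, E_{λ+i0}(x) = c_λ·log(A(x,λ)+i0) is a fundamental solution of the hyperbolic operator P(λ) = (1−λ²)∂²_{x₂} − λ²∂²_{x₁}. -/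
open Set MeasureTheory

lemma hasCompactSupport_slice_fst {E : Type*} [Zero E] {G : ℝ × ℝ → E}
    (hG : HasCompactSupport G) (v : ℝ) :
    HasCompactSupport (fun s => G (s, v)) :=
  hG.comp_isClosedEmbedding (Isometry.isClosedEmbedding fun x y => by simp [Prod.edist_eq])

lemma hasCompactSupport_slice_snd {E : Type*} [Zero E] {G : ℝ × ℝ → E}
    (hG : HasCompactSupport G) (u : ℝ) :
    HasCompactSupport (fun s => G (u, s)) :=
  hG.comp_isClosedEmbedding (Isometry.isClosedEmbedding fun x y => by simp [Prod.edist_eq])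

section Slices

variable {E : Type*} [NormedAddCommGroup E] [NormedSpace ℝ E] {G : ℝ × ℝ → E}

lemma hasDerivAt_slice_fst (hG : Differentiable ℝ G) (u v : ℝ) :
    HasDerivAt (fun s => G (s, v)) (fderiv ℝ G (u, v) (1, 0)) u :=
  (hG (u, v)).hasFDerivAt.comp_hasDerivAt u ((hasDerivAt_id u).prodMk (hasDerivAt_const u v))

lemma hasDerivAt_slice_snd (hG : Differentiable ℝ G) (u v : ℝ) :
    HasDerivAt (fun s => G (u, s)) (fderiv ℝ G (u, v) (0, 1)) v :=
  (hG (u, v)).hasFDerivAt.comp_hasDerivAt v ((hasDerivAt_const v u).prodMk (hasDerivAt_id v))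

lemma contDiff_fderiv_apply_one (hG : ContDiff ℝ 2 G) (w : ℝ × ℝ) :
    ContDiff ℝ 1 (fun q => fderiv ℝ G q w) :=
  (hG.fderiv_right (by norm_num)).clm_apply contDiff_const

lemma fderiv_fderiv_apply (hG : ContDiff ℝ 2 G) (p w z : ℝ × ℝ) :
    fderiv ℝ (fun q => fderiv ℝ G q w) p z = fderiv ℝ (fderiv ℝ G) p z w := by
  have h : ContDiff ℝ 1 (fderiv ℝ G) := hG.fderiv_right (by norm_num)
  rw [fderiv_clm_apply ((h.differentiable (by norm_num)) p) (differentiableAt_const w)]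
  simp

lemma fderiv_fderiv_apply_comm (hG : ContDiff ℝ 2 G) (p w z : ℝ × ℝ) :
    fderiv ℝ (fderiv ℝ G) p z w = fderiv ℝ (fderiv ℝ G) p w z :=
  (hG.contDiffAt.isSymmSndFDerivAt (by simp)).eq z w

lemma integral_slice_fderiv_fst_eq_zero [CompleteSpace E] (hG : ContDiff ℝ 1 G)
    (hc : HasCompactSupport G) (v : ℝ) : ∫ u, fderiv ℝ G (u, v) (1, 0) = 0 := by
  refine integral_eq_zero_of_hasDerivAt_of_integrable
    (hasDerivAt_slice_fst (hG.differentiable one_ne_zero) · v) ?_ ?_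
  · exact (Continuous.integrable_of_hasCompactSupport (by fun_prop)
      (hasCompactSupport_slice_fst (hc.fderiv_apply ℝ (1, 0)) v))
  · exact (Continuous.integrable_of_hasCompactSupport (by fun_prop)
      (hasCompactSupport_slice_fst hc v))

lemma integral_slice_fderiv_snd_eq_zero [CompleteSpace E] (hG : ContDiff ℝ 1 G)
    (hc : HasCompactSupport G) (u : ℝ) : ∫ v, fderiv ℝ G (u, v) (0, 1) = 0 := by
  refine integral_eq_zero_of_hasDerivAt_of_integrable
    (hasDerivAt_slice_snd (hG.differentiable one_ne_zero) u) ?_ ?_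
  · exact (Continuous.integrable_of_hasCompactSupport (by fun_prop)
      (hasCompactSupport_slice_snd (hc.fderiv_apply ℝ (0, 1)) u))
  · exact (Continuous.integrable_of_hasCompactSupport (by fun_prop)
      (hasCompactSupport_slice_snd hc u))

end Slices

lemma integrable_log_fst_mul {H : ℝ × ℝ → ℂ} (hH : Continuous H) (hc : HasCompactSupport H) :
    Integrable (fun p : ℝ × ℝ => (Real.log p.1 : ℂ) * H p) := by
  obtain ⟨R, hR⟩ := hc.isCompact.isBounded.subset_closedBall 0
  obtain ⟨C, hC⟩ := hc.exists_bound_of_continuous hH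
  have h1 : Integrable ((Icc (-R) R).indicator fun u => (Real.log u : ℂ)) := by
    rw [integrable_indicator_iff measurableSet_Icc]
    by_cases h : -R ≤ R
    · rw [integrableOn_Icc_iff_integrableOn_Ioc,
        ← intervalIntegrable_iff_integrableOn_Ioc_of_le h]
      exact ⟨intervalIntegral.intervalIntegrable_log'.1.ofReal,
        intervalIntegral.intervalIntegrable_log'.2.ofReal⟩
    · simp [Icc_eq_empty h]
  have h2 : Integrable ((Icc (-R) R).indicator fun _ : ℝ => (1 : ℂ)) := by
    rw [integrable_indicator_iff measurableSet_Icc]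
    simp
  refine ((h1.mul_prod h2).mul_bdd hH.aestronglyMeasurable (ae_of_all _ hC)).congr
    (ae_of_all _ fun p => ?_)
  by_cases hp : H p = 0
  · simp [hp]
  · have := hR (subset_tsupport H hp)
    simp only [mem_closedBall_zero_iff, Prod.norm_def, Real.norm_eq_abs, sup_le_iff, abs_le] at this
    simp [indicator, this]

lemma integral_log_fst_mul_eq_zero {H : ℝ × ℝ → ℂ} (hH : Continuous H)
    (hc : HasCompactSupport H) (h0 : ∀ u, ∫ v, H (u, v) = 0) :
    ∫ p : ℝ × ℝ, (Real.log p.1 : ℂ) * H p = 0 := by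
  rw [Measure.volume_eq_prod, integral_prod _ (integrable_log_fst_mul hH hc)]
  simp [integral_const_mul, h0]

lemma integrable_log_snd_mul {H : ℝ × ℝ → ℂ} (hH : Continuous H) (hc : HasCompactSupport H) :
    Integrable (fun p : ℝ × ℝ => (Real.log p.2 : ℂ) * H p) :=
  (integrable_log_fst_mul (H := H ∘ Prod.swap) (hH.comp continuous_swap)
    (hc.comp_homeomorph (Homeomorph.prodComm ℝ ℝ))).swap

lemma integral_log_snd_mul_eq_zero {H : ℝ × ℝ → ℂ} (hH : Continuous H)
    (hc : HasCompactSupport H) (h0 : ∀ v, ∫ u, H (u, v) = 0) :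
    ∫ p : ℝ × ℝ, (Real.log p.2 : ℂ) * H p = 0 := by
  rw [Measure.volume_eq_prod, integral_prod_symm _ (integrable_log_snd_mul hH hc)]
  simp [integral_const_mul, h0]

lemma integrable_ite_mul {H : ℝ × ℝ → ℂ} (hH : Continuous H) (hc : HasCompactSupport H) :
    Integrable (fun p : ℝ × ℝ => (if p.1 * p.2 < 0 then 1 else 0) * H p) := by
  have hm : MeasurableSet {p : ℝ × ℝ | p.1 * p.2 < 0} :=
    measurableSet_lt (by fun_prop) measurable_const
  refine ((hH.integrable_of_hasCompactSupport hc).indicator hm).congr (ae_of_all _ fun p => ?_)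
  by_cases hp : p.1 * p.2 < 0 <;> simp [indicator, hp]

lemma integral_ite_mul_mixed_deriv {G : ℝ × ℝ → ℂ} (hG : ContDiff ℝ 2 G)
    (hc : HasCompactSupport G) :
    ∫ p : ℝ × ℝ, (if p.1 * p.2 < 0 then 1 else 0) *
      fderiv ℝ (fun q => fderiv ℝ G q (1, 0)) p (0, 1) = -2 * G (0, 0) := by
  have hg := contDiff_fderiv_apply_one hG (1, 0)
  have hgc := hc.fderiv_apply ℝ (1, 0)
  set g : ℝ × ℝ → ℂ := fun q => fderiv ℝ G q (1, 0) with hgdef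
  have hI := integrable_ite_mul (H := fun p => fderiv ℝ g p (0, 1)) (by fun_prop)
    (hgc.fderiv_apply ℝ (0, 1))
  have hslice (u : ℝ) : deriv (fun s => g (u, s)) = fun v => fderiv ℝ g (u, v) (0, 1) :=
    funext fun v => (hasDerivAt_slice_snd (hg.differentiable one_ne_zero) u v).deriv
  have hsliceG : deriv (fun s => G (s, 0)) = fun u => g (u, 0) :=
    funext fun u => (hasDerivAt_slice_fst (hG.differentiable two_ne_zero) u 0).deriv
  have hgu (u : ℝ) : ContDiff ℝ 1 (fun s => g (u, s)) := by fun_prop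
  have hGu : ContDiff ℝ 1 (fun s => G (s, (0 : ℝ))) := (hG.of_le (by norm_num)).comp (by fun_prop)
  have hpos {u : ℝ} (hu : 0 < u) :
      ∫ v, (if u * v < 0 then 1 else 0) * fderiv ℝ g (u, v) (0, 1) = g (u, 0) := by
    rw [← (hasCompactSupport_slice_snd hgc u).integral_Iic_deriv_eq (hgu u) 0, hslice,
      integral_Iic_eq_integral_Iio, ← integral_indicator measurableSet_Iio]
    congr with v
    by_cases hv : v < 0 <;> simp [indicator, hv, mul_neg_iff, hu, hu.not_gt]
  have hneg {u : ℝ} (hu : u < 0) :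
      ∫ v, (if u * v < 0 then 1 else 0) * fderiv ℝ g (u, v) (0, 1) = -g (u, 0) := by
    rw [← (hasCompactSupport_slice_snd hgc u).integral_Ioi_deriv_eq (hgu u) 0, hslice,
      ← integral_indicator measurableSet_Ioi]
    congr with v
    by_cases hv : 0 < v <;> simp [indicator, hv, mul_neg_iff, hu, hu.not_gt]
  rw [Measure.volume_eq_prod, integral_prod _ hI,
    ← intervalIntegral.integral_Iic_add_Ioi (b := (0 : ℝ)) hI.integral_prod_left.integrableOn
      hI.integral_prod_left.integrableOn,
    integral_Iic_eq_integral_Iio, setIntegral_congr_fun measurableSet_Iio fun u hu => hneg hu,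
    setIntegral_congr_fun measurableSet_Ioi fun u hu => hpos hu, integral_neg,
    ← integral_Iic_eq_integral_Iio, ← hsliceG,
    (hasCompactSupport_slice_fst hc 0).integral_Iic_deriv_eq hGu,
    (hasCompactSupport_slice_fst hc 0).integral_Ioi_deriv_eq hGu]
  ring

/-- `log (u v + i0)` is, up to a constant, a fundamental solution of `∂_u ∂_v`. -/
lemma integral_log_mul_mixed_deriv {G : ℝ × ℝ → ℂ} (hG : ContDiff ℝ 2 G)
    (hc : HasCompactSupport G) :
    ∫ p : ℝ × ℝ, ((Real.log |p.1 * p.2| : ℂ) +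
        Complex.I * (Real.pi : ℂ) * (if p.1 * p.2 < 0 then 1 else 0)) *
      fderiv ℝ (fderiv ℝ G) p (0, 1) (1, 0) = -2 * Real.pi * Complex.I * G (0, 0) := by
  have hg := contDiff_fderiv_apply_one hG (1, 0)
  have hgc := hc.fderiv_apply ℝ (1, 0)
  have hcont : Continuous fun p => fderiv ℝ (fun q => fderiv ℝ G q (1, 0)) p (0, 1) := by fun_prop
  have hsupp := hgc.fderiv_apply ℝ (0, 1)
  have hcomm (p : ℝ × ℝ) : fderiv ℝ (fun q => fderiv ℝ G q (1, 0)) p (0, 1) =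
      fderiv ℝ (fun q => fderiv ℝ G q (0, 1)) p (1, 0) := by
    rw [fderiv_fderiv_apply hG, fderiv_fderiv_apply hG, fderiv_fderiv_apply_comm hG]
  have h1 := integral_log_fst_mul_eq_zero hcont hsupp
    (integral_slice_fderiv_snd_eq_zero hg hgc)
  have h2 := integral_log_snd_mul_eq_zero hcont hsupp (by
    simp_rw [hcomm]
    exact integral_slice_fderiv_fst_eq_zero (contDiff_fderiv_apply_one hG (0, 1))
      (hc.fderiv_apply ℝ (0, 1)))
  have h3 := integral_ite_mul_mixed_deriv hG hc
  have hfst : ∀ᵐ p : ℝ × ℝ, p.1 ≠ 0 :=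
    Measure.quasiMeasurePreserving_fst.ae (Measure.ae_ne volume 0)
  have hsnd : ∀ᵐ p : ℝ × ℝ, p.2 ≠ 0 :=
    Measure.quasiMeasurePreserving_snd.ae (Measure.ae_ne volume 0)
  have hsum : ∀ᵐ p : ℝ × ℝ, ((Real.log |p.1 * p.2| : ℂ) +
        Complex.I * (Real.pi : ℂ) * (if p.1 * p.2 < 0 then 1 else 0)) *
      fderiv ℝ (fderiv ℝ G) p (0, 1) (1, 0) =
      ((Real.log p.1 : ℂ) * fderiv ℝ (fun q => fderiv ℝ G q (1, 0)) p (0, 1) +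
        (Real.log p.2 : ℂ) * fderiv ℝ (fun q => fderiv ℝ G q (1, 0)) p (0, 1)) +
      Complex.I * (Real.pi : ℂ) * ((if p.1 * p.2 < 0 then 1 else 0) *
        fderiv ℝ (fun q => fderiv ℝ G q (1, 0)) p (0, 1)) := by
    filter_upwards [hfst, hsnd] with p hp1 hp2
    rw [Real.log_abs, Real.log_mul hp1 hp2, fderiv_fderiv_apply hG]
    push_cast
    ring
  have hI1 := integrable_log_fst_mul hcont hsupp
  have hI2 := integrable_log_snd_mul hcont hsupp
  rw [integral_congr_ae hsum]
  refine (integral_add (hI1.add hI2) ((integrable_ite_mul hcont hsupp).const_mul _)).trans ?_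
  rw [integral_add' hI1 hI2, h1, h2, integral_const_mul, h3]
  ring

/-- The linear change of variables `(u, v) ↦ (a (u - v), b (u + v))` to null coordinates. -/
noncomputable def nullCoordinates {a b : ℝ} (ha : a ≠ 0) (hb : b ≠ 0) : (ℝ × ℝ) ≃ₗ[ℝ] (ℝ × ℝ) where
  toFun p := (a * (p.1 - p.2), b * (p.1 + p.2))
  invFun x := ((x.2 / b + x.1 / a) / 2, (x.2 / b - x.1 / a) / 2)
  map_add' p q := by ext <;> simp <;> ring
  map_smul' c p := by ext <;> simp <;> ring
  left_inv p := by ext <;> simp <;> field_simp <;> ring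
  right_inv x := by ext <;> simp <;> field_simp <;> ring

lemma nullCoordinates_apply {a b : ℝ} (ha : a ≠ 0) (hb : b ≠ 0) (p : ℝ × ℝ) :
    nullCoordinates ha hb p = (a * (p.1 - p.2), b * (p.1 + p.2)) := rfl

lemma det_nullCoordinates {a b : ℝ} (ha : a ≠ 0) (hb : b ≠ 0) :
    LinearMap.det (nullCoordinates ha hb : (ℝ × ℝ) →ₗ[ℝ] (ℝ × ℝ)) = 2 * a * b := by
  rw [← LinearMap.det_toMatrix (Module.Basis.finTwoProd ℝ), Matrix.det_fin_two]
  simp [LinearMap.toMatrix_apply, nullCoordinates_apply]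
  ring

lemma integral_comp_nullCoordinates {a b : ℝ} (ha : 0 < a) (hb : 0 < b) (F : ℝ × ℝ → ℂ) :
    ∫ x, F x = (2 * a * b : ℂ) * ∫ p, F (nullCoordinates ha.ne' hb.ne' p) := by
  set L := nullCoordinates ha.ne' hb.ne'
  have hdet : 0 < LinearMap.det (L : (ℝ × ℝ) →ₗ[ℝ] (ℝ × ℝ)) := by
    rw [det_nullCoordinates]; positivity
  have hmap := Measure.map_linearMap_addHaar_eq_smul_addHaar (volume : Measure (ℝ × ℝ)) hdet.ne'
  have hint := (L.toContinuousLinearEquiv.toHomeomorph.measurableEmbedding).integral_map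
    (μ := volume) F
  have hL : (L.toContinuousLinearEquiv.toHomeomorph : ℝ × ℝ → ℝ × ℝ) =
    (L : (ℝ × ℝ) →ₗ[ℝ] (ℝ × ℝ)) := rfl
  rw [hL, hmap, integral_smul_measure, ENNReal.toReal_ofReal (abs_nonneg _),
    abs_of_pos (inv_pos.2 hdet), det_nullCoordinates] at hint
  change _ = _ * ∫ p, F ((L : (ℝ × ℝ) →ₗ[ℝ] (ℝ × ℝ)) p)
  rw [← hint, Complex.real_smul]
  push_cast
  have : (a : ℂ) ≠ 0 := by exact_mod_cast ha.ne'
  have : (b : ℂ) ≠ 0 := by exact_mod_cast hb.ne'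
  field_simp

lemma fderiv_fderiv_comp_linear {φ : ℝ × ℝ → ℂ} (hφ : ContDiff ℝ 2 φ)
    (L : (ℝ × ℝ) →L[ℝ] (ℝ × ℝ)) (p w z : ℝ × ℝ) :
    fderiv ℝ (fderiv ℝ (φ ∘ L)) p w z = fderiv ℝ (fderiv ℝ φ) (L p) (L w) (L z) := by
  have hd : Differentiable ℝ φ := hφ.differentiable two_ne_zero
  have h (q : ℝ × ℝ) : fderiv ℝ (φ ∘ L) q z = fderiv ℝ φ (L q) (L z) := by
    rw [fderiv_comp q (hd _) L.differentiableAt]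
    simp
  have hd' := (contDiff_fderiv_apply_one hφ (L z)).differentiable one_ne_zero
  rw [← fderiv_fderiv_apply (hφ.comp L.contDiff), funext h,
    ← Function.comp_def (fun x => fderiv ℝ φ x (L z)) L,
    fderiv_comp p (hd' _) L.differentiableAt, ← fderiv_fderiv_apply hφ]
  simp

lemma bilinear_null_directions {B : ℝ × ℝ →L[ℝ] ℝ × ℝ →L[ℝ] ℂ} (hB : ∀ w z, B w z = B z w)
    (a b : ℝ) :
    B (-a, b) (a, b) = (b : ℂ) ^ 2 * B (0, 1) (0, 1) - (a : ℂ) ^ 2 * B (1, 0) (1, 0) := by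
  have h1 : ((-a, b) : ℝ × ℝ) = -a • (1, 0) + b • (0, 1) := by simp
  have h2 : ((a, b) : ℝ × ℝ) = a • (1, 0) + b • (0, 1) := by simp
  rw [h1, h2]
  simp only [map_add, map_smul, add_apply, smul_apply,
    Complex.real_smul, hB (0, 1) (1, 0)]
  push_cast
  ring

theorem stmt_14 (lam : ℝ) (hlam : lam ∈ Ioo (0 : ℝ) 1) :
    ∀ φ : ℝ × ℝ → ℂ, ContDiff ℝ (⊤ : ℕ∞) φ → HasCompactSupport φ →
      (Complex.I / (4 * (Real.pi : ℂ) * (lam : ℂ) * (Real.sqrt (1 - lam ^ 2) : ℂ))) *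
        (∫ x : ℝ × ℝ,
          ((Real.log |(-x.1 ^ 2 / lam ^ 2 + x.2 ^ 2 / (1 - lam ^ 2))| : ℂ) +
              Complex.I * (Real.pi : ℂ) *
                (if -x.1 ^ 2 / lam ^ 2 + x.2 ^ 2 / (1 - lam ^ 2) < 0 then 1 else 0)) *
            (((1 - lam ^ 2 : ℝ) : ℂ) * deriv (fun t => deriv (fun s => φ (x.1, s)) t) x.2 -
              ((lam ^ 2 : ℝ) : ℂ) * deriv (fun t => deriv (fun s => φ (s, x.2)) t) x.1))
        = φ (0, 0) := by
  intro φ hφ' hc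
  obtain ⟨h0, h1⟩ := hlam
  have hφ : ContDiff ℝ 2 φ := hφ'.of_le (WithTop.coe_le_coe.2 le_top)
  have hm : 0 < 1 - lam ^ 2 := by nlinarith
  set m := Real.sqrt (1 - lam ^ 2) with hmdef
  have hmpos : 0 < m := Real.sqrt_pos.2 hm
  have hsq : 1 - lam ^ 2 = m ^ 2 := (Real.sq_sqrt hm.le).symm
  have ha : 0 < lam / 2 := by positivity
  have hb : 0 < m / 2 := by positivity
  have hd : Differentiable ℝ φ := hφ.differentiable two_ne_zero
  have hdw (w : ℝ × ℝ) : Differentiable ℝ fun q => fderiv ℝ φ q w :=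
    (contDiff_fderiv_apply_one hφ w).differentiable one_ne_zero
  have hdd1 (x : ℝ × ℝ) : deriv (fun t => deriv (fun s => φ (s, x.2)) t) x.1 =
      fderiv ℝ (fderiv ℝ φ) x (1, 0) (1, 0) := by
    simp_rw [fun t => (hasDerivAt_slice_fst hd t x.2).deriv]
    rw [(hasDerivAt_slice_fst (hdw (1, 0)) x.1 x.2).deriv, fderiv_fderiv_apply hφ]
  have hdd2 (x : ℝ × ℝ) : deriv (fun t => deriv (fun s => φ (x.1, s)) t) x.2 =
      fderiv ℝ (fderiv ℝ φ) x (0, 1) (0, 1) := by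
    simp_rw [fun t => (hasDerivAt_slice_snd hd x.1 t).deriv]
    rw [(hasDerivAt_slice_snd (hdw (0, 1)) x.1 x.2).deriv, fderiv_fderiv_apply hφ]
  simp_rw [hdd1, hdd2, hsq]
  rw [integral_comp_nullCoordinates ha hb]
  set L := (nullCoordinates ha.ne' hb.ne').toContinuousLinearEquiv
  have hL (p : ℝ × ℝ) : nullCoordinates ha.ne' hb.ne' p = L p := rfl
  have hL' (p : ℝ × ℝ) : L p = (lam / 2 * (p.1 - p.2), m / 2 * (p.1 + p.2)) := rfl
  have hA (p : ℝ × ℝ) : -(L p).1 ^ 2 / lam ^ 2 + (L p).2 ^ 2 / m ^ 2 = p.1 * p.2 := by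
    rw [hL']
    field_simp
    ring
  have hP (p : ℝ × ℝ) : ((m ^ 2 : ℝ) : ℂ) * fderiv ℝ (fderiv ℝ φ) (L p) (0, 1) (0, 1) -
      ((lam ^ 2 : ℝ) : ℂ) * fderiv ℝ (fderiv ℝ φ) (L p) (1, 0) (1, 0) =
      4 * fderiv ℝ (fderiv ℝ (φ ∘ L)) p (0, 1) (1, 0) := by
    have h := fderiv_fderiv_comp_linear hφ (L : (ℝ × ℝ) →L[ℝ] (ℝ × ℝ)) p (0, 1) (1, 0)
    have hB := bilinear_null_directions (fun w z => fderiv_fderiv_apply_comm hφ (L p) z w)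
      (lam / 2) (m / 2)
    simp only [ContinuousLinearEquiv.coe_coe] at h
    have h01 : L (0, 1) = (-(lam / 2), m / 2) := by rw [hL']; simp
    have h10 : L (1, 0) = (lam / 2, m / 2) := by rw [hL']; simp
    rw [h, h01, h10, hB]
    push_cast
    ring
  simp_rw [hL, hA, hP, mul_left_comm _ (4 : ℂ)]
  rw [integral_const_mul, integral_log_mul_mixed_deriv (hφ.comp L.contDiff)
    (hc.comp_homeomorph L.toHomeomorph)]
  have hl : (lam : ℂ) ≠ 0 := by exact_mod_cast h0.ne'
  have hmc : (m : ℂ) ≠ 0 := by exact_mod_cast hmpos.ne'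
  have hpi : (Real.pi : ℂ) ≠ 0 := by exact_mod_cast Real.pi_ne_zero
  have hL0 : (φ ∘ L) (0, 0) = φ (0, 0) := by simp [hL']
  rw [hL0]
  push_cast
  field_simp
  rw [Complex.I_sq]
  ring
end

section
/- Let λ ∈ (0,1) and let φ : ℝ² → ℂ be C^∞ with compact support. Define A(x,ω) = −x₁²/ω² + x₂²/(1−ω²). Then lim_{ε→0+} ∫_{ℝ²} log(A(x,λ+iε))·φ(x) dx = ∫_{ℝ²} (log|A(x,λ)| + iπ·𝟙_{A(x,λ)<0})·φ(x) dx, where log is the principal complex logarithm; that is, the fundamental solutions E_{λ+iε} converge to E_{λ+i0} when paired against test functions. -/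
open Set MeasureTheory Filter

theorem locallyIntegrable_real_log : LocallyIntegrable Real.log volume := by
  rw [locallyIntegrable_iff]
  intro k hk
  obtain ⟨R, hR⟩ := hk.isBounded.subset_closedBall 0
  rw [Real.closedBall_eq_Icc] at hR
  rcases le_total (0 - R) (0 + R) with h | h
  · exact ((intervalIntegrable_iff_integrableOn_Icc_of_le h).1
      intervalIntegral.intervalIntegrable_log').mono_set hR
  · exact ((intervalIntegrable_iff_integrableOn_Icc_of_le h).1
      intervalIntegral.intervalIntegrable_log').mono_set
        (hR.trans fun x hx => ⟨by linarith [hx.1, hx.2], by linarith [hx.1, hx.2]⟩)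

theorem MeasureTheory.LocallyIntegrable.comp_fst_real {f : ℝ → ℝ} (hf : LocallyIntegrable f volume) :
    LocallyIntegrable (fun x : ℝ × ℝ => f x.1) volume := by
  rw [locallyIntegrable_iff]
  intro k hk
  have h1 : IntegrableOn f (Prod.fst '' k) :=
    hf.integrableOn_isCompact (hk.image continuous_fst)
  have hk2 : IsCompact (Prod.snd '' k) := hk.image continuous_snd
  have : IsFiniteMeasure (volume.restrict (Prod.snd '' k)) :=
    ⟨by simpa using hk2.measure_lt_top⟩
  have h2 := Integrable.comp_fst h1 (volume.restrict (Prod.snd '' k))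
  rw [Measure.prod_restrict, ← Measure.volume_eq_prod] at h2
  exact IntegrableOn.mono_set h2 fun x hx => ⟨⟨x, hx, rfl⟩, ⟨x, hx, rfl⟩⟩

theorem MeasureTheory.LocallyIntegrable.comp_linearEquiv {E : Type*} [NormedAddCommGroup E]
    [NormedSpace ℝ E] [MeasurableSpace E] [BorelSpace E] [FiniteDimensional ℝ E]
    {μ : Measure E} [μ.IsAddHaarMeasure] {f : E → ℝ} (hf : LocallyIntegrable f μ)
    (e : E ≃ₗ[ℝ] E) : LocallyIntegrable (f ∘ e) μ := by
  have h := (locallyIntegrable_map_homeomorph (μ := μ) (f := f)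
    e.toContinuousLinearEquiv.toHomeomorph).1
  refine h ?_
  have hmap := Measure.map_linearMap_addHaar_eq_smul_addHaar μ e.isUnit_det'.ne_zero
  change LocallyIntegrable f (Measure.map (e : E →ₗ[ℝ] E) μ)
  rw [hmap]
  intro x
  obtain ⟨s, hs, hfs⟩ := hf x
  refine ⟨s, hs, ?_⟩
  rw [IntegrableOn, Measure.restrict_smul]
  exact hfs.smul_measure ENNReal.ofReal_ne_top

/-- The coordinate change `x ↦ (a x₁ + b x₂, x₁)` of the plane. -/
noncomputable def planeCoordinates (a b : ℝ) (hb : b ≠ 0) : (ℝ × ℝ) ≃ₗ[ℝ] (ℝ × ℝ) where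
  toFun x := (a * x.1 + b * x.2, x.1)
  invFun y := (y.2, (y.1 - a * y.2) / b)
  map_add' x y := by
    ext
    · simp only [Prod.fst_add, Prod.snd_add]; ring
    · rfl
  map_smul' c x := by ext <;> simp; ring
  left_inv x := by ext <;> simp [hb]
  right_inv y := by ext <;> simp; field_simp; ring

theorem locallyIntegrable_log_linear (a : ℝ) {b : ℝ} (hb : b ≠ 0) :
    LocallyIntegrable (fun x : ℝ × ℝ => Real.log (a * x.1 + b * x.2)) volume :=
  locallyIntegrable_real_log.comp_fst_real.comp_linearEquiv (planeCoordinates a b hb)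

theorem ae_linear_ne_zero (a : ℝ) {b : ℝ} (hb : b ≠ 0) :
    ∀ᵐ x : ℝ × ℝ, a * x.1 + b * x.2 ≠ 0 := by
  let l : (ℝ × ℝ) →ₗ[ℝ] ℝ := LinearMap.fst ℝ ℝ ℝ ∘ₗ (planeCoordinates a b hb).toLinearMap
  have hl : LinearMap.ker l ≠ ⊤ := by
    intro h
    have : ((0, 1) : ℝ × ℝ) ∈ LinearMap.ker l := h ▸ Submodule.mem_top
    simp [l, planeCoordinates, hb] at this
  have h := Measure.addHaar_submodule (volume : Measure (ℝ × ℝ)) _ hl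
  rw [ae_iff]
  convert h using 2
  ext x
  simp [l, planeCoordinates]

theorem Real.abs_log_le_add_of_le_of_le {p q r : ℝ} (hp : 0 < p) (hpq : p ≤ q) (hqr : q ≤ r) :
    |Real.log q| ≤ |Real.log p| + |Real.log r| := by
  have h1 := Real.log_le_log hp hpq
  have h2 := Real.log_le_log (hp.trans_le hpq) hqr
  rw [abs_le]
  constructor <;> linarith [neg_abs_le (Real.log p), le_abs_self (Real.log r),
    abs_nonneg (Real.log p), abs_nonneg (Real.log r)]

theorem Complex.norm_log_le_abs_log_norm_add_pi (z : ℂ) :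
    ‖Complex.log z‖ ≤ |Real.log ‖z‖| + Real.pi := by
  calc ‖Complex.log z‖ ≤ |(Complex.log z).re| + |(Complex.log z).im| :=
        Complex.norm_le_abs_re_add_abs_im _
    _ ≤ _ := by
        rw [Complex.log_re, Complex.log_im]
        gcongr
        exact Complex.abs_arg_le_pi z

theorem abs_sub_le_two_mul_norm {lam ε s : ℝ} (hε : 0 < ε) (hεlam : ε ≤ 2 * lam)
    (hs : 0 ≤ s) (t : ℝ) :
    |lam ^ 2 * s - t| ≤ 2 * ‖((lam : ℂ) + Complex.I * (ε : ℂ)) ^ 2 * s - t‖ := by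
  set N : ℂ := ((lam : ℂ) + Complex.I * (ε : ℂ)) ^ 2 * s - t with hN
  have hre : N.re = (lam ^ 2 - ε ^ 2) * s - t := by
    simp [hN, pow_two]
  have him : N.im = 2 * lam * ε * s := by
    simp only [hN, pow_two, Complex.sub_im, Complex.mul_im, Complex.mul_re, Complex.add_re,
      Complex.add_im, Complex.I_re, Complex.I_im, Complex.ofReal_re, Complex.ofReal_im]
    ring
  have h1 := Complex.abs_re_le_norm N
  have h2 := Complex.abs_im_le_norm N
  have h3 : ε ^ 2 * s ≤ |N.im| := by
    rw [him]
    refine le_trans ?_ (le_abs_self _)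
    nlinarith [mul_nonneg (mul_nonneg hε.le hs) (sub_nonneg.2 hεlam)]
  have h4 : lam ^ 2 * s - t = N.re + ε ^ 2 * s := by rw [hre]; ring
  rw [h4]
  calc |N.re + ε ^ 2 * s| ≤ |N.re| + |ε ^ 2 * s| := abs_add_le _ _
    _ = |N.re| + ε ^ 2 * s := by rw [abs_of_nonneg (by positivity : 0 ≤ ε ^ 2 * s)]
    _ ≤ _ := by linarith

theorem Complex.im_neg_div_add_div_one_sub_nonneg {z : ℂ} (hz : 0 ≤ z.im) {t u : ℝ} (ht : 0 ≤ t)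
    (hu : 0 ≤ u) : 0 ≤ (-(t : ℂ) / z + (u : ℂ) / (1 - z)).im := by
  have h : (-(t : ℂ) / z + (u : ℂ) / (1 - z)).im =
      t * (z.im / Complex.normSq z) + u * (z.im / Complex.normSq (1 - z)) := by
    simp [Complex.div_im]
    ring
  rw [h]
  have := Complex.normSq_nonneg z
  have := Complex.normSq_nonneg (1 - z)
  positivity

theorem Complex.neg_div_add_div_one_sub_eq {z : ℂ} (hz : z ≠ 0) (hz1 : 1 - z ≠ 0) (t u : ℂ) :
    -t / z + u / (1 - z) = (z * (t + u) - t) / (z * (1 - z)) := by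
  field_simp
  ring

theorem stmt_15 (lam : ℝ) (hlam : lam ∈ Ioo (0 : ℝ) 1)
    (φ : ℝ × ℝ → ℂ) (hφ : ContDiff ℝ (⊤ : ℕ∞) φ) (hsupp : HasCompactSupport φ) :
    Tendsto
      (fun ε : ℝ =>
        ∫ x : ℝ × ℝ,
          Complex.log
            (-(x.1 : ℂ) ^ 2 / ((lam : ℂ) + Complex.I * (ε : ℂ)) ^ 2 +
              (x.2 : ℂ) ^ 2 / (1 - ((lam : ℂ) + Complex.I * (ε : ℂ)) ^ 2)) * φ x)
      (nhdsWithin 0 (Ioi 0))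
      (nhds
        (∫ x : ℝ × ℝ,
          ((Real.log |(-x.1 ^ 2 / lam ^ 2 + x.2 ^ 2 / (1 - lam ^ 2))| : ℂ) +
              Complex.I * (Real.pi : ℂ) *
                (if -x.1 ^ 2 / lam ^ 2 + x.2 ^ 2 / (1 - lam ^ 2) < 0 then 1 else 0)) * φ x)) := by
  obtain ⟨hlam0, hlam1⟩ := hlam
  have hμ : 0 < 1 - lam ^ 2 := by nlinarith
  set m : ℝ := Real.sqrt (1 - lam ^ 2)
  have hm2 : m ^ 2 = 1 - lam ^ 2 := Real.sq_sqrt hμ.le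
  let z : ℝ → ℂ := fun ε => ((lam : ℂ) + Complex.I * (ε : ℂ)) ^ 2
  have hz_cont : Continuous z := by fun_prop
  have hz0 : z 0 = ((lam ^ 2 : ℝ) : ℂ) := by simp [z]
  have hz0_ne : z 0 ≠ 0 := by
    rw [hz0]; exact_mod_cast (by positivity : lam ^ 2 ≠ 0)
  have hz0_ne' : 1 - z 0 ≠ 0 := by
    rw [hz0]; exact_mod_cast hμ.ne'
  have hz_tendsto : Tendsto z (nhdsWithin 0 (Ioi 0)) (nhds (z 0)) :=
    hz_cont.continuousAt.mono_left nhdsWithin_le_nhds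
  have hz_im : ∀ ε : ℝ, 0 < ε → 0 ≤ (z ε).im := by
    intro ε hε
    have : (z ε).im = 2 * lam * ε := by
      simp only [z, pow_two, Complex.mul_im, Complex.mul_re, Complex.add_re, Complex.add_im,
        Complex.I_re, Complex.I_im, Complex.ofReal_re, Complex.ofReal_im]
      ring
    rw [this]; positivity
  have hz_ne : ∀ᶠ ε in nhdsWithin (0 : ℝ) (Ioi 0), z ε ≠ 0 := hz_tendsto.eventually_ne hz0_ne
  have hz_ne' : ∀ᶠ ε in nhdsWithin (0 : ℝ) (Ioi 0), 1 - z ε ≠ 0 :=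
    (hz_tendsto.const_sub 1).eventually_ne hz0_ne'
  have hz_norm : ∀ᶠ ε in nhdsWithin (0 : ℝ) (Ioi 0), ‖z ε‖ < 2 := by
    refine hz_tendsto.norm.eventually_lt_const ?_
    rw [hz0, Complex.norm_real, Real.norm_of_nonneg (by positivity)]
    linarith
  obtain ⟨C, hC⟩ : ∃ C : ℝ, ∀ᶠ ε in nhdsWithin (0 : ℝ) (Ioi 0),
      |Real.log ‖z ε * (1 - z ε)‖| < C := by
    have h := (((hz_tendsto.mul (hz_tendsto.const_sub 1)).norm).log
      (norm_ne_zero_iff.2 (mul_ne_zero hz0_ne hz0_ne'))).abs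
    exact ⟨_, h.eventually_lt_const (lt_add_one _)⟩
  have hne : ∀ᵐ x : ℝ × ℝ, m * x.1 + lam * x.2 ≠ 0 ∧ -m * x.1 + lam * x.2 ≠ 0 :=
    (ae_linear_ne_zero m hlam0.ne').and (ae_linear_ne_zero (-m) hlam0.ne')
  have hfactor : ∀ x : ℝ × ℝ, lam ^ 2 * (x.1 ^ 2 + x.2 ^ 2) - x.1 ^ 2 =
      (m * x.1 + lam * x.2) * (-m * x.1 + lam * x.2) := by
    intro x; linear_combination x.1 ^ 2 * hm2
  let g : ℝ × ℝ → ℝ := fun x =>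
    |Real.log (m * x.1 + lam * x.2)| + |Real.log (-m * x.1 + lam * x.2)| +
      (Real.log 2 + |Real.log (3 * (x.1 ^ 2 + x.2 ^ 2 + 1))| + C + Real.pi)
  have hg : LocallyIntegrable g volume := by
    have h1 : LocallyIntegrable (fun x : ℝ × ℝ =>
        Real.log 2 + |Real.log (3 * (x.1 ^ 2 + x.2 ^ 2 + 1))| + C + Real.pi) volume := by
      apply Continuous.locallyIntegrable
      have : Continuous fun x : ℝ × ℝ => Real.log (3 * (x.1 ^ 2 + x.2 ^ 2 + 1)) :=
        Continuous.log (by fun_prop) fun x => by positivity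
      fun_prop
    have habs : ∀ a : ℝ, LocallyIntegrable
        (fun x : ℝ × ℝ => |Real.log (a * x.1 + lam * x.2)|) volume := fun a =>
      (locallyIntegrable_log_linear a hlam0.ne').mono
        (Measurable.aestronglyMeasurable
          (continuous_abs.measurable.comp (Real.measurable_log.comp (by fun_prop))))
        (ae_of_all _ fun x => by simp)
    exact ((habs m).add (habs (-m))).add h1
  refine tendsto_integral_filter_of_dominated_convergence (fun x => g x * ‖φ x‖) ?_ ?_ ?_ ?_
  · refine Eventually.of_forall fun ε => Measurable.aestronglyMeasurable ?_
    have := hφ.continuous.measurable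
    exact (Complex.measurable_log.comp (by fun_prop)).mul this
  · filter_upwards [hz_ne, hz_ne', hz_norm, hC, self_mem_nhdsWithin,
      nhdsWithin_le_nhds (Iio_mem_nhds (by positivity : 0 < 2 * lam))] with
      ε hε hε' hnorm hCε hpos hlt
    filter_upwards [hne] with x hx
    rw [norm_mul]
    gcongr
    change ‖Complex.log (-(x.1 : ℂ) ^ 2 / z ε + (x.2 : ℂ) ^ 2 / (1 - z ε))‖ ≤ g x
    rw [Complex.neg_div_add_div_one_sub_eq hε hε']
    refine (Complex.norm_log_le_abs_log_norm_add_pi _).trans ?_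
    set s : ℝ := x.1 ^ 2 + x.2 ^ 2 with hs
    have hs0 : 0 ≤ s := by positivity
    set N : ℂ := z ε * ((x.1 : ℂ) ^ 2 + (x.2 : ℂ) ^ 2) - (x.1 : ℂ) ^ 2 with hN
    have hN' : N = z ε * (s : ℂ) - ((x.1 ^ 2 : ℝ) : ℂ) := by rw [hN, hs]; push_cast; rfl
    have hlow := abs_sub_le_two_mul_norm hpos (le_of_lt hlt) hs0 (x.1 ^ 2)
    change _ ≤ 2 * ‖z ε * (s : ℂ) - ((x.1 ^ 2 : ℝ) : ℂ)‖ at hlow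
    rw [← hN', hs, hfactor] at hlow
    have hP : 0 < |(m * x.1 + lam * x.2) * (-m * x.1 + lam * x.2)| :=
      abs_pos.2 (mul_ne_zero hx.1 hx.2)
    have hNpos : 0 < ‖N‖ := by linarith
    have hup : ‖N‖ ≤ 3 * (s + 1) := by
      rw [hN']
      refine (norm_sub_le _ _).trans ?_
      rw [norm_mul, Complex.norm_real, Complex.norm_real, Real.norm_of_nonneg hs0,
        Real.norm_of_nonneg (sq_nonneg _)]
      nlinarith [sq_nonneg x.2]
    have hlogN := Real.abs_log_le_add_of_le_of_le (half_pos hP) (by linarith) hup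
    rw [Real.log_div hP.ne' two_ne_zero, Real.log_abs, Real.log_mul hx.1 hx.2] at hlogN
    rw [norm_div, Real.log_div hNpos.ne' (norm_ne_zero_iff.2 (mul_ne_zero hε hε'))]
    have h1 := abs_sub (Real.log ‖N‖) (Real.log ‖z ε * (1 - z ε)‖)
    have h2 := abs_sub (Real.log (m * x.1 + lam * x.2) + Real.log (-m * x.1 + lam * x.2))
      (Real.log 2)
    have h3 := abs_add_le (Real.log (m * x.1 + lam * x.2)) (Real.log (-m * x.1 + lam * x.2))
    rw [abs_of_nonneg (Real.log_nonneg one_le_two)] at h2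
    simp only [g]
    linarith
  · exact hg.integrable_smul_right_of_hasCompactSupport hφ.continuous.norm hsupp.norm
  · filter_upwards [hne] with x hx
    refine Tendsto.mul_const _ ?_
    set A : ℝ := -x.1 ^ 2 / lam ^ 2 + x.2 ^ 2 / (1 - lam ^ 2) with hA
    let F : ℝ → ℂ := fun ε => -(x.1 : ℂ) ^ 2 / z ε + (x.2 : ℂ) ^ 2 / (1 - z ε)
    change Tendsto (fun ε => Complex.log (F ε)) _ _
    have hF0 : F 0 = (A : ℂ) := by
      simp only [F, hz0, hA]; push_cast; rfl
    have hF : Tendsto F (nhdsWithin 0 (Ioi 0)) (nhds (A : ℂ)) := by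
      rw [← hF0]
      exact (tendsto_const_nhds.div hz_tendsto hz0_ne).add
        (tendsto_const_nhds.div (hz_tendsto.const_sub 1) hz0_ne')
    have hA_eq : A * (lam ^ 2 * (1 - lam ^ 2)) =
        (m * x.1 + lam * x.2) * (-m * x.1 + lam * x.2) := by
      rw [← hfactor, hA]; field_simp; ring
    have hA0 : A ≠ 0 := by
      rintro h
      rw [h, zero_mul] at hA_eq
      exact mul_ne_zero hx.1 hx.2 hA_eq.symm
    rcases hA0.lt_or_gt with hneg | hpos
    · have hlog := Complex.tendsto_log_nhdsWithin_im_nonneg_of_re_neg_of_im_zero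
        (z := (A : ℂ)) (by simpa using hneg) (Complex.ofReal_im A)
      have hF' : Tendsto F (nhdsWithin 0 (Ioi 0)) (nhdsWithin (A : ℂ) {w | 0 ≤ w.im}) := by
        refine tendsto_nhdsWithin_iff.2 ⟨hF, ?_⟩
        filter_upwards [self_mem_nhdsWithin] with ε hε
        have := Complex.im_neg_div_add_div_one_sub_nonneg (hz_im ε hε) (sq_nonneg x.1)
          (sq_nonneg x.2)
        push_cast at this
        exact this
      convert hlog.comp hF' using 1
      congr 1
      rw [if_pos hneg, Complex.norm_real, Real.norm_eq_abs]
      congr 1; ring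
    · rw [if_neg hpos.not_gt, mul_zero, add_zero, abs_of_pos hpos, Complex.ofReal_log hpos.le]
      exact hF.clog (Complex.ofReal_mem_slitPlane.2 hpos)
end
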